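/- For all 1 <= i, j <= N, all k, m in Z, and every P in N_q^-, one has Omega_{psi_i}(k)(Omega_{phi_j}(m)(P)) = sum_{r>=0} g_{i,j}(r) gamma^{2r} Omega_{phi_j}(m+r)(Omega_{psi_i}(k-r)(P)), where only finitely many summands are nonzero. -/

import Mathlib

/-!
STATEMENT 11: the commutation rule between `Ω_{ψ_i}(k)` and `Ω_{φ_j}(m)` as
operators on `N_q^-`.
-/


noncomputable section
open scoped BigOperators

/-- The base field `ℚ(q^{1/2})`. -/
abbrev Fq : Type := RatFunc ℚ

/-- `q^{1/2}`. -/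
def sqq : Fq := RatFunc.X

/-- `q`. -/
def qq : Fq := sqq ^ 2

/-- Generators of the quantum affine algebra `U_q(ĝ)` in the Drinfeld realization. -/
inductive Gen (N : ℕ) : Type
  | xp (i : Fin N) (r : ℤ)
  | xm (i : Fin N) (r : ℤ)
  | h  (i : Fin N) (s : ℤ)
  | K (i : Fin N)
  | Kinv (i : Fin N)
  | g2
  | g2inv
  | D
  | Dinv

open Gen

/-- The free algebra on the Drinfeld generators. -/
abbrev FA (N : ℕ) : Type := FreeAlgebra Fq (Gen N)

variable {N : ℕ}

def e (x : Gen N) : FA N := FreeAlgebra.ι Fq x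

variable (d : Fin N → ℤ) (A : Fin N → Fin N → ℤ)

/-- `q_i = q^{d_i}`. -/
def qi (i : Fin N) : Fq := qq ^ (d i)

/-- `q^{(α_i|α_j)} = q^{d_i a_{ij}}`. -/
def qp (i j : Fin N) : Fq := qq ^ (d i * A i j)

/-- The quantum integer `[n]_i`. -/
def qint (i : Fin N) (n : ℤ) : Fq := (qi d i ^ n - qi d i ^ (-n)) / (qi d i - (qi d i)⁻¹)

/-- `[n]_i!`. -/
def qfact (i : Fin N) : ℕ → Fq
  | 0 => 1
  | n + 1 => qint d i (n + 1) * qfact i n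

/-- The `q_i`-binomial coefficient `[n choose r]_{q_i}`. -/
def qbinom (i : Fin N) (n r : ℕ) : Fq := qfact d i n / (qfact d i r * qfact d i (n - r))

/-- `γ^{m/2}` as a (noncommutative) word in the free algebra. -/
def gammaHalf (m : ℤ) : FA N := if 0 ≤ m then (e g2) ^ m.toNat else (e g2inv) ^ (-m).toNat

/-- `γ^{k}`. -/
def gammaPow (k : ℤ) : FA N := gammaHalf (2 * k)

/-- The Schur-like polynomials `S_k((q_i - q_i^{-1}) h_{i,1}, (q_i - q_i^{-1}) h_{i,2}, …)`
appearing in `ψ_{i,k} = K_i S_k`, defined by the recursion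
`k S_k = ∑_{l=1}^{k} l x_l S_{k-l}` for `exp(∑ x_l z^l) = ∑ S_k z^k`. -/
def Ppos (i : Fin N) : ℕ → FA N
  | 0 => 1
  | k + 1 =>
      ((k + 1 : Fq))⁻¹ •
        ∑ l ∈ Finset.range (k + 1),
          (((l + 1 : ℕ) : Fq) * (qi d i - (qi d i)⁻¹)) •
            (e (h i ((l : ℤ) + 1)) * Ppos i (k - l))

/-- The analogous polynomials in the `h_{i,-l}`, `l > 0`, with coefficient
`-(q_i - q_i^{-1})`, appearing in `φ_{i,-k} = K_i^{-1} S_k`. -/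
def Pneg (i : Fin N) : ℕ → FA N
  | 0 => 1
  | k + 1 =>
      ((k + 1 : Fq))⁻¹ •
        ∑ l ∈ Finset.range (k + 1),
          (((l + 1 : ℕ) : Fq) * (-(qi d i - (qi d i)⁻¹))) •
            (e (h i (-((l : ℤ) + 1))) * Pneg i (k - l))

/-- The element `ψ_{i,m}` (zero for `m < 0`). -/
def psiEl (i : Fin N) (m : ℤ) : FA N := if 0 ≤ m then e (K i) * Ppos d i m.toNat else 0

/-- The element `φ_{i,m}` (zero for `m > 0`). -/
def phiEl (i : Fin N) (m : ℤ) : FA N := if m ≤ 0 then e (Kinv i) * Pneg d i (-m).toNat else 0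

/-- A summand of the Drinfeld–Serre relation:
`x_{i,k_{σ(1)}} ⋯ x_{i,k_{σ(r)}} x_{j,l} x_{i,k_{σ(r+1)}} ⋯ x_{i,k_{σ(n)}}`
(`pm = true` for the `x^+` relation, `pm = false` for `x^-`). -/
def dsTerm (pm : Bool) (i j : Fin N) (n' : ℕ) (ks : Fin n' → ℤ) (l : ℤ)
    (σ : Equiv.Perm (Fin n')) (r : ℕ) : FA N :=
  (((List.finRange n').take r).map fun t =>
      e (if pm then xp i (ks (σ t)) else xm i (ks (σ t)))).prod *
    e (if pm then xp j l else xm j l) *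
  (((List.finRange n').drop r).map fun t =>
      e (if pm then xp i (ks (σ t)) else xm i (ks (σ t)))).prod

/-- The defining relations of the quantum affine algebra `U_q(ĝ)`
(Drinfeld realization). -/
inductive QRel (N : ℕ) (d : Fin N → ℤ) (A : Fin N → Fin N → ℤ) : FA N → FA N → Prop
  | K_Kinv (i : Fin N) : QRel N d A (e (K i) * e (Kinv i)) 1
  | Kinv_K (i : Fin N) : QRel N d A (e (Kinv i) * e (K i)) 1
  | D_Dinv : QRel N d A (e D * e Dinv) 1
  | Dinv_D : QRel N d A (e Dinv * e D) 1
  | g_ginv : QRel N d A (e g2 * e g2inv) 1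
  | ginv_g : QRel N d A (e g2inv * e g2) 1
  | g2_comm (x : Gen N) : QRel N d A (e g2 * e x) (e x * e g2)
  | g2inv_comm (x : Gen N) : QRel N d A (e g2inv * e x) (e x * e g2inv)
  | K_comm_K (i j : Fin N) : QRel N d A (e (K i) * e (K j)) (e (K j) * e (K i))
  | K_comm_D (i : Fin N) : QRel N d A (e (K i) * e D) (e D * e (K i))
  | K_comm_h (i j : Fin N) (s : ℤ) :
      QRel N d A (e (K i) * e (h j s)) (e (h j s) * e (K i))
  | h_zero (i : Fin N) : QRel N d A (e (h i 0)) 0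
  | D_h (i : Fin N) (s : ℤ) :
      QRel N d A (e D * e (h i s) * e Dinv) ((qq ^ s) • e (h i s))
  | D_xp (i : Fin N) (r : ℤ) :
      QRel N d A (e D * e (xp i r) * e Dinv) ((qq ^ r) • e (xp i r))
  | D_xm (i : Fin N) (r : ℤ) :
      QRel N d A (e D * e (xm i r) * e Dinv) ((qq ^ r) • e (xm i r))
  | K_xp (i j : Fin N) (r : ℤ) :
      QRel N d A (e (K i) * e (xp j r) * e (Kinv i)) (qp d A i j • e (xp j r))
  | K_xm (i j : Fin N) (r : ℤ) :
      QRel N d A (e (K i) * e (xm j r) * e (Kinv i)) ((qp d A i j)⁻¹ • e (xm j r))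
  | h_h (i j : Fin N) (k l : ℤ) (hk : k ≠ 0) (hl : l ≠ 0) :
      QRel N d A (e (h i k) * e (h j l) - e (h j l) * e (h i k))
        (if l = -k then
          ((k : Fq)⁻¹ * qint d i (k * A i j) * (qi d j - (qi d j)⁻¹)⁻¹) •
            (gammaPow k - gammaPow (-k))
         else 0)
  | h_xp (i j : Fin N) (k l : ℤ) (hk : k ≠ 0) :
      QRel N d A (e (h i k) * e (xp j l) - e (xp j l) * e (h i k))
        (((k : Fq)⁻¹ * qint d i (k * A i j)) • (gammaHalf (-|k|) * e (xp j (k + l))))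
  | h_xm (i j : Fin N) (k l : ℤ) (hk : k ≠ 0) :
      QRel N d A (e (h i k) * e (xm j l) - e (xm j l) * e (h i k))
        ((-((k : Fq)⁻¹ * qint d i (k * A i j))) • (gammaHalf |k| * e (xm j (k + l))))
  | serre_p (i j : Fin N) (k l : ℤ) :
      QRel N d A
        (e (xp i (k+1)) * e (xp j l) - qp d A i j • (e (xp j l) * e (xp i (k+1))))
        (qp d A i j • (e (xp i k) * e (xp j (l+1))) - e (xp j (l+1)) * e (xp i k))
  | serre_m (i j : Fin N) (k l : ℤ) :
      QRel N d A
        (e (xm i (k+1)) * e (xm j l) - (qp d A i j)⁻¹ • (e (xm j l) * e (xm i (k+1))))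
        ((qp d A i j)⁻¹ • (e (xm i k) * e (xm j (l+1))) - e (xm j (l+1)) * e (xm i k))
  | xp_xm (i j : Fin N) (k l : ℤ) :
      QRel N d A (e (xp i k) * e (xm j l) - e (xm j l) * e (xp i k))
        (if i = j then
          ((qi d i - (qi d i)⁻¹)⁻¹) •
            (gammaHalf (k - l) * psiEl d i (k + l) - gammaHalf (l - k) * phiEl d i (k + l))
         else 0)
  | dserre (pm : Bool) (i j : Fin N) (hij : i ≠ j)
      (ks : Fin (1 - A i j).toNat → ℤ) (l : ℤ) :
      QRel N d A
        (∑ σ : Equiv.Perm (Fin (1 - A i j).toNat),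
          ∑ r ∈ Finset.range ((1 - A i j).toNat + 1),
            ((-1 : Fq) ^ r * qbinom d i (1 - A i j).toNat r) •
              dsTerm pm i j (1 - A i j).toNat ks l σ r)
        0

/-- The quantum affine algebra `U_q(ĝ)` (Drinfeld realization). -/
abbrev Uq (N : ℕ) (d : Fin N → ℤ) (A : Fin N → Fin N → ℤ) : Type := RingQuot (QRel N d A)

/-- The image of a generator in `U_q(ĝ)`. -/
def G (x : Gen N) : Uq N d A := RingQuot.mkAlgHom Fq (QRel N d A) (e x)

/-- The image of `ψ_{i,m}` in `U_q(ĝ)`. -/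
def psiU (i : Fin N) (m : ℤ) : Uq N d A := RingQuot.mkAlgHom Fq (QRel N d A) (psiEl d i m)

/-- The image of `φ_{i,m}` in `U_q(ĝ)`. -/
def phiU (i : Fin N) (m : ℤ) : Uq N d A := RingQuot.mkAlgHom Fq (QRel N d A) (phiEl d i m)

/-- The image of `γ^{m/2}` in `U_q(ĝ)`. -/
def gU (m : ℤ) : Uq N d A := RingQuot.mkAlgHom Fq (QRel N d A) (gammaHalf m)


/-- The generating set of the subalgebra `N_q^-`. -/
def NqSet : Set (Uq N d A) :=
  {G d A Gen.g2, G d A Gen.g2inv} ∪ Set.range (fun p : Fin N × ℤ => G d A (Gen.xm p.1 p.2))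

/-- The subalgebra `N_q^-` of `U_q(ĝ)` generated by `γ^{±1/2}` and the `x^-_{i,l}`. -/
def Nq : Subalgebra Fq (Uq N d A) := Algebra.adjoin Fq (NqSet d A)

/-- `γ^{1/2}` as an element of `N_q^-`. -/
def g2N : Nq d A :=
  ⟨G d A Gen.g2, Algebra.subset_adjoin (Set.mem_union_left _ (Set.mem_insert _ _))⟩

/-- `γ^{-1/2}` as an element of `N_q^-`. -/
def g2invN : Nq d A :=
  ⟨G d A Gen.g2inv, Algebra.subset_adjoin (Set.mem_union_left _ (Set.mem_insert_of_mem _ rfl))⟩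

/-- `x^-_{i,m}` as an element of `N_q^-`. -/
def xmN (i : Fin N) (m : ℤ) : Nq d A :=
  ⟨G d A (Gen.xm i m), Algebra.subset_adjoin (Set.mem_union_right _ ⟨(i, m), rfl⟩)⟩

/-- `γ^{m/2}` as an element of `N_q^-`. -/
def gN (m : ℤ) : Nq d A :=
  if 0 ≤ m then (g2N d A) ^ m.toNat else (g2invN d A) ^ (-m).toNat

/-- The characterizing property of the family of operators
`Ω_{ψ_i}(m), Ω_{φ_i}(m) : N_q^- → N_q^-`: they vanish for small (resp. large) index, and
`[x^+_{i,k}, P] = (q_i - q_i^{-1})^{-1} (∑_{p ≥ 0} ψ_{i,p} γ^{p/2} Ω_{ψ_i}(k-p)(P)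
   - ∑_{r ≥ 0} φ_{i,-r} γ^{r/2} Ω_{φ_i}(k+r)(P))`,
both sums having only finitely many nonzero terms.  (By the commutator lemma there is a
unique such family.) -/
def IsOmegaFamily (Ωψ Ωφ : Fin N → ℤ → ((Nq d A) →ₗ[Fq] (Nq d A))) : Prop :=
  (∀ (i : Fin N) (P : Nq d A), ∃ b : ℤ, ∀ m : ℤ, m ≤ b → Ωψ i m P = 0) ∧
  (∀ (i : Fin N) (P : Nq d A), ∃ b : ℤ, ∀ m : ℤ, b ≤ m → Ωφ i m P = 0) ∧
  (∀ (i : Fin N) (k : ℤ) (P : Nq d A), ∃ M : ℕ,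
    (∀ p : ℕ, M < p → Ωψ i (k - (p : ℤ)) P = 0 ∧ Ωφ i (k + (p : ℤ)) P = 0) ∧
    G d A (Gen.xp i k) * (P : Uq N d A) - (P : Uq N d A) * G d A (Gen.xp i k) =
      ((qi d i - (qi d i)⁻¹)⁻¹) •
        ((∑ p ∈ Finset.range (M + 1),
            psiU d A i (p : ℤ) * gU d A (p : ℤ) *
              ((Ωψ i (k - (p : ℤ)) P : Nq d A) : Uq N d A)) -
         (∑ r ∈ Finset.range (M + 1),
            phiU d A i (-(r : ℤ)) * gU d A (r : ℤ) *
              ((Ωφ i (k + (r : ℤ)) P : Nq d A) : Uq N d A))))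

/-- The Taylor coefficients at `t = 0` of `(a t - 1)/(t - a)` (for `a = q^{(α_i|α_j)}`
this is the series `g_{i,j}(t)`; for `a = q^{-(α_i|α_j)}` it is `g_{i,j,q^{-1}}(t)`). -/
def gcoef (a : Fq) : ℕ → Fq
  | 0 => a⁻¹
  | r + 1 => a ^ (-(r : ℤ) - 2) - a ^ (-(r : ℤ))

/-- `∑_{t < m} a ^ t * y * b ^ (m - 1 - t)`, the linear part in `ε` of `m`-fold products. -/
def mixedPow {R : Type*} [Ring R] (a y b : R) : ℕ → R
  | 0 => 0
  | m + 1 => a * mixedPow a y b m + y * b ^ m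

section QuantumPlane

variable {F R : Type*} [Field F] [Ring R] [Algebra F R] {s c : F} {X0 X1 Y0 Y1 : R}

lemma quantumPlane_pow_right (hX : X1 * X0 = s • (X0 * X1)) (n : ℕ) :
    (X1 - s • X0) ^ n =
      (X1 - X0) ^ n - (s ^ n - 1) • (X0 * (X1 - X0) ^ (n - 1)) := by
  induction n with
  | zero => simp
  | succ n ih =>
    rcases n with _ | n
    · simp; module
    · rw [pow_succ', ih]
      have h1 : (X1 - s • X0) * X0 = s • (X0 * (X1 - X0)) := by
        simp only [sub_mul, mul_sub, smul_mul_assoc, hX]; module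
      have h2 : X1 - s • X0 = (X1 - X0) - (s - 1) • X0 := by module
      rw [mul_sub, mul_smul_comm, ← mul_assoc, h1, h2]
      simp only [Nat.add_sub_cancel]
      generalize X1 - X0 = ξ
      rw [smul_mul_assoc, mul_assoc, ← pow_succ', sub_mul, ← pow_succ', smul_mul_assoc]
      match_scalars <;> ring

lemma quantumPlane_pow_left (hX : X1 * X0 = s • (X0 * X1)) (n : ℕ) :
    (s • X1 - X0) ^ n =
      s ^ n • (X1 - X0) ^ n + (s ^ n - 1) • ((X1 - X0) ^ (n - 1) * X0) := by
  induction n with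
  | zero => simp
  | succ n ih =>
    rcases n with _ | n
    · simp; module
    · rw [pow_succ, ih]
      have h1 : X0 * (s • X1 - X0) = (X1 - X0) * X0 := by
        simp only [sub_mul, mul_sub, mul_smul_comm, hX]
      have h2 : s • X1 - X0 = s • (X1 - X0) + (s - 1) • X0 := by module
      rw [add_mul, smul_mul_assoc _ ((X1 - X0) ^ (n + 1 - 1) * X0), mul_assoc, h1, h2]
      simp only [Nat.add_sub_cancel]
      generalize X1 - X0 = ξ
      rw [← mul_assoc (ξ ^ n), ← pow_succ, mul_add, smul_mul_assoc, mul_smul_comm, ← pow_succ,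
        mul_smul_comm, smul_mul_assoc]
      match_scalars <;> ring

lemma quantumPlane_mixedPow (hX : X1 * X0 = s • (X0 * X1)) (n : ℕ) :
    mixedPow (s • X1 - X0) 1 (X1 - s • X0) n =
      (∑ t ∈ Finset.range n, s ^ t) • (X1 - X0) ^ (n - 1) := by
  induction n with
  | zero => simp [mixedPow]
  | succ n ih =>
    rw [mixedPow, ih, one_mul, quantumPlane_pow_right hX]
    have h2 : s • X1 - X0 = s • (X1 - X0) + (s - 1) • X0 := by module
    have h3 := geom_sum_mul s n
    have h4 := geom_sum_succ (x := s) (n := n)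
    rw [h2, h4, ← h3]
    rcases n with _ | n
    · simp
    · simp only [Nat.add_sub_cancel]
      generalize X1 - X0 = ξ
      rw [mul_smul_comm, add_mul, smul_mul_assoc, smul_mul_assoc, ← pow_succ']
      match_scalars <;> ring

/-- Vanishing of the first-order deformation of the quantum Serre polynomial in the
repeated variable. -/
lemma serre_deform_repeated (hX : X1 * X0 = s • (X0 * X1))
    (hXY : X1 * Y0 + Y1 * X0 = c • (X0 * Y1 + Y0 * X1)) {n : ℕ}
    (hc : c ^ 2 * s ^ n = 1) (hs : s ≠ 1) (ρ : ℕ → F)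
    (hρ : ∀ r, r ≤ n → ρ (r + 1) * (s ^ (r + 1) - 1) = -(c * (s ^ (n + 1) - s ^ r)) * ρ r) :
    ∑ r ∈ Finset.range (n + 2), ρ r •
      (mixedPow (s • X1 - X0) 1 (X1 - s • X0) r * (Y1 - c • Y0) * (X1 - s • X0) ^ (n + 1 - r) +
        (s • X1 - X0) ^ r * (c • Y1 - Y0) *
          mixedPow (s • X1 - X0) 1 (X1 - s • X0) (n + 1 - r)) = 0 := by
  simp only [quantumPlane_mixedPow hX, smul_add, Finset.sum_add_distrib]
  rw [Finset.sum_range_succ']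
  rw [Finset.sum_range_succ _ (n + 1)]
  simp only [Finset.range_zero, Finset.sum_empty, zero_smul, zero_mul, smul_zero, add_zero,
    Nat.sub_self, mul_zero]
  rw [← Finset.sum_add_distrib]
  set τ : ℕ → F := fun r => ρ r * ∑ t ∈ Finset.range (n + 1 - r), s ^ t with hτ
  have hs1 : s - 1 ≠ 0 := sub_ne_zero.2 hs
  have hs0 : ∀ m, m ≤ n → s ^ m ≠ 0 := fun m hm h0 => by
    have : s ^ n = 0 := by rw [← Nat.sub_add_cancel hm, pow_add, h0, mul_zero]
    rw [this, mul_zero] at hc; exact zero_ne_one hc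
  have hτ1 : ∀ r, r ≤ n → ρ (r + 1) * ∑ t ∈ Finset.range (r + 1), s ^ t =
      -(τ r * s ^ r * c) := fun r hr => by
    apply mul_right_cancel₀ hs1
    have e1 := geom_sum_mul s (r + 1)
    have e2 := geom_sum_mul s (n + 1 - r)
    have e3 : s ^ (n + 1) = s ^ (n + 1 - r) * s ^ r := by
      rw [← pow_add, Nat.sub_add_cancel (by omega)]
    calc _ = ρ (r + 1) * (s ^ (r + 1) - 1) := by rw [mul_assoc, e1]
      _ = _ := by rw [hρ r hr, e3, hτ]; linear_combination (ρ r * s ^ r * c) * e2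
  set v : ℕ → F := fun r => τ r * s ^ r * c * (s ^ (n - r) - 1) with hv
  have hv1 : ∀ r, r + 1 ≤ n → τ (r + 1) * (s ^ (r + 1) - 1) = - v r := fun r hr => by
    have e1 := geom_sum_mul s (r + 1)
    have e2 := geom_sum_mul s (n + 1 - (r + 1))
    have e3 : n + 1 - (r + 1) = n - r := by omega
    rw [e3] at e2
    have := hτ1 r (by omega)
    simp only [hv]
    rw [show τ (r + 1) = ρ (r + 1) * ∑ t ∈ Finset.range (n - r), s ^ t by simp [hτ]]
    linear_combination (-ρ (r + 1) * ∑ t ∈ Finset.range (n - r), s ^ t) * e1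
      + (s ^ (n - r) - 1) * this + (ρ (r + 1) * ∑ t ∈ Finset.range (r + 1), s ^ t) * e2
  set ξ := X1 - X0 with hξ
  have key : ∀ m, m ≤ n → ∑ r ∈ Finset.range (m + 1),
      (ρ (r + 1) • ((∑ t ∈ Finset.range (r + 1), s ^ t) • ξ ^ (r + 1 - 1) * (Y1 - c • Y0) *
        (X1 - s • X0) ^ (n + 1 - (r + 1))) +
      ρ r • ((s • X1 - X0) ^ r * (c • Y1 - Y0) *
        (∑ t ∈ Finset.range (n + 1 - r), s ^ t) • ξ ^ (n + 1 - r - 1))) =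
      v m • (ξ ^ m * (Y1 - c • Y0) * X0 * ξ ^ (n - m - 1) - c • (ξ ^ m * Y0 * ξ ^ (n - m))) := by
    have term : ∀ r, r ≤ n →
      (ρ (r + 1) • ((∑ t ∈ Finset.range (r + 1), s ^ t) • ξ ^ (r + 1 - 1) * (Y1 - c • Y0) *
        (X1 - s • X0) ^ (n + 1 - (r + 1))) +
      ρ r • ((s • X1 - X0) ^ r * (c • Y1 - Y0) *
        (∑ t ∈ Finset.range (n + 1 - r), s ^ t) • ξ ^ (n + 1 - r - 1))) =
      (τ r * s ^ r * (c ^ 2 - 1)) • (ξ ^ r * Y0 * ξ ^ (n - r)) +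
      (τ r * (s ^ r - 1)) • (ξ ^ (r - 1) * X0 * (c • Y1 - Y0) * ξ ^ (n - r)) +
      v r • (ξ ^ r * (Y1 - c • Y0) * X0 * ξ ^ (n - r - 1)) := fun r hr => by
      have := hτ1 r hr
      rw [smul_mul_assoc, smul_mul_assoc, smul_smul, this, mul_smul_comm, smul_smul,
        quantumPlane_pow_left hX, show n + 1 - (r + 1) = n - r by omega,
        quantumPlane_pow_right hX, ← hξ, show n + 1 - r - 1 = n - r by omega]
      change _ + τ r • _ = _
      simp only [hv, Nat.add_sub_cancel]
      simp only [mul_sub, sub_mul, add_mul, smul_mul_assoc, mul_smul_comm, mul_assoc]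
      match_scalars <;> ring
    intro m
    induction m with
    | zero =>
      intro _
      rw [zero_add, Finset.sum_range_one, term 0 (by omega)]
      have : τ 0 * s ^ 0 * (c ^ 2 - 1) = - (v 0 * c) := by
        simp only [hv]; simp only [pow_zero, Nat.sub_zero]
        linear_combination (τ 0) * hc
      rw [this]; simp; module
    | succ m ih =>
      intro hm
      rw [Finset.sum_range_succ, ih (by omega), term (m + 1) hm, hv1 m hm]
      obtain ⟨k, rfl⟩ : ∃ k, n = m + 1 + k := ⟨n - (m + 1), by omega⟩
      rw [show m + 1 + k - m - 1 = k by omega, show m + 1 + k - m = k + 1 by omega,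
        show m + 1 + k - (m + 1) = k by omega, Nat.add_sub_cancel]
      have hco : τ (m + 1) * s ^ (m + 1) * (c ^ 2 - 1) = v m - c * v (m + 1) := by
        have h1 := hv1 m hm
        simp only [hv] at h1 ⊢
        rw [show m + 1 + k - (m + 1) = k by omega]
        rw [show s ^ (m + 1 + k) = s ^ (m + 1) * s ^ k by rw [pow_add]] at hc
        linear_combination -h1 + τ (m + 1) * hc
      have rel : X0 * (c • Y1 - Y0) = ξ * Y0 - c • (Y0 * ξ) + (Y1 - c • Y0) * X0 := by
        rw [hξ]
        have : X1 * Y0 = c • (X0 * Y1 + Y0 * X1) - Y1 * X0 := by rw [← hXY]; abel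
        simp only [mul_sub, sub_mul, smul_mul_assoc, mul_smul_comm, this]
        module
      rw [hco, mul_assoc (ξ ^ m) X0, rel]
      rw [pow_succ ξ m, pow_succ' ξ k]
      simp only [mul_sub, sub_mul, add_mul, mul_add, smul_mul_assoc, mul_smul_comm, mul_assoc]
      match_scalars <;> ring
  rw [key n le_rfl]
  simp [hv]

/-- Coefficients of `∏_{k < n} (1 - p ^ k z)`. -/
def qProdCoeff (p : F) : ℕ → ℕ → F
  | 0, 0 => 1
  | 0, _ + 1 => 0
  | n + 1, 0 => qProdCoeff p n 0
  | n + 1, r + 1 => qProdCoeff p n (r + 1) - p ^ n * qProdCoeff p n r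

lemma qProdCoeff_zero_right (p : F) (n : ℕ) : qProdCoeff p n 0 = 1 := by
  induction n with
  | zero => rfl
  | succ n ih => rw [qProdCoeff, ih]

lemma qProdCoeff_of_lt (p : F) {n r : ℕ} (h : n < r) : qProdCoeff p n r = 0 := by
  induction n generalizing r with
  | zero => obtain ⟨r, rfl⟩ : ∃ t, r = t + 1 := ⟨r - 1, by omega⟩; rfl
  | succ n ih =>
    obtain ⟨r, rfl⟩ : ∃ t, r = t + 1 := ⟨r - 1, by omega⟩
    rw [qProdCoeff, ih (by omega), ih (by omega)]; simp

lemma qProdCoeff_ratio (p : F) (n r : ℕ) :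
    qProdCoeff p n (r + 1) * (1 - p ^ (r + 1)) = (p ^ n - p ^ r) * qProdCoeff p n r := by
  induction n generalizing r with
  | zero =>
    rcases r with _ | r <;> simp [qProdCoeff]
  | succ n ih =>
    rcases r with _ | r
    · have := ih 0
      simp only [qProdCoeff, qProdCoeff_zero_right] at *
      linear_combination this
    · have h1 := ih (r + 1)
      have h2 := ih r
      simp only [qProdCoeff] at *
      linear_combination h1 - p ^ (n + 1) * h2

/-- Vanishing of the first-order deformation of the quantum Serre polynomial in the
single variable. -/
lemma serre_deform_single (hX : X1 * X0 = s • (X0 * X1)) {n : ℕ}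
    (hc : c ^ 2 * s ^ n = 1) (hs : ∀ r, r ≤ n → s ^ (r + 1) ≠ 1) (hs0 : s ≠ 0) (ρ : ℕ → F)
    (hρ : ∀ r, r ≤ n → ρ (r + 1) * (s ^ (r + 1) - 1) = -(c * (s ^ (n + 1) - s ^ r)) * ρ r) :
    ∑ r ∈ Finset.range (n + 2), ρ r •
      ((c • X1 - X0) ^ r * (X1 - c • X0) ^ (n + 1 - r)) = 0 := by
  have hc0 : c ≠ 0 := by rintro rfl; simp at hc
  set p := s⁻¹ with hp
  have hps : ∀ r, p ^ r * s ^ r = 1 := fun r => by rw [← mul_pow, hp, inv_mul_cancel₀ hs0, one_pow]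
  have hρ' : ∀ r, r ≤ n + 1 → ρ r * c ^ r = ρ 0 * qProdCoeff p (n + 1) r := by
    intro r
    induction r with
    | zero => intro _; simp [qProdCoeff_zero_right]
    | succ r ih =>
      intro hr
      have h1 := ih (by omega)
      have h2 := hρ r (by omega)
      have h3 := qProdCoeff_ratio p (n + 1) r
      have h4 : 1 - p ^ (r + 1) ≠ 0 := by
        intro h
        apply hs r (by omega)
        have := hps (r + 1)
        rw [← sub_eq_zero.1 h, one_mul] at this; exact this
      apply mul_right_cancel₀ h4
      rw [mul_assoc (ρ 0), h3]
      have e1 := hps (r + 1)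
      have e2 := hps r
      have e3 := hps (n + 1)
      have e4 : p * s = 1 := by simpa using hps 1
      have e5 : c ^ 2 = p ^ n := by
        have := hps n
        apply mul_right_cancel₀ (pow_ne_zero n hs0); rw [hc, this]
      have e6 : c ^ (r + 1) * c = p ^ n * c ^ r := by rw [← e5]; ring
      have e7 : p ^ (r + 1) * s ^ r = p := by rw [pow_succ', mul_assoc, e2, mul_one]
      have e8 : p ^ n * s ^ (n + 1) = s := by rw [pow_succ, ← mul_assoc, hps n, one_mul]
      calc ρ (r + 1) * c ^ (r + 1) * (1 - p ^ (r + 1))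
          = ρ (r + 1) * (s ^ (r + 1) - 1) * c ^ (r + 1) * p ^ (r + 1) := by
            linear_combination (-ρ (r + 1) * c ^ (r + 1)) * e1
        _ = -(p ^ n * s ^ (n + 1) * p ^ (r + 1) - p ^ (r + 1) * s ^ r * p ^ n) *
              (ρ r * c ^ r) := by
            rw [h2]; linear_combination
              (-(s ^ (n + 1) - s ^ r) * ρ r * p ^ (r + 1)) * e6
        _ = _ := by
            rw [e8, e7, h1]
            linear_combination (-ρ 0 * qProdCoeff p (n + 1) r * p ^ r) * e4
  set U := X1 - c • X0 with hU
  set V := X1 - c⁻¹ • X0 with hV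
  have hVc : c • X1 - X0 = c • V := by rw [hV, smul_sub, smul_smul, mul_inv_cancel₀ hc0, one_smul]
  have h1 : ∀ k, V * X0 ^ k = s ^ k • (X0 ^ k * (X1 - (c⁻¹ * p ^ k) • X0)) := by
    intro k
    induction k with
    | zero => simp [hV]
    | succ k ih =>
      have e1 := hps k
      have e2 := hps (k + 1)
      have e4 : p * s = 1 := by simpa using hps 1
      rw [pow_succ, ← mul_assoc, ih]
      simp only [mul_sub, sub_mul, smul_mul_assoc, mul_smul_comm, mul_assoc, hX]
      match_scalars
      · ring
      · linear_combination (-c⁻¹) * e1 + c⁻¹ * e2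
  have h2 : ∀ k, ∃ a : F, (k = n + 1 → a = 0) ∧
      ∑ r ∈ Finset.range (k + 1), qProdCoeff p k r • (V ^ r * U ^ (k - r)) = a • X0 ^ k := by
    intro k
    induction k with
    | zero => exact ⟨1, by simp, by simp [qProdCoeff]⟩
    | succ k ih =>
      obtain ⟨a, -, ha⟩ := ih
      refine ⟨a * (c⁻¹ * p ^ k - c), ?_, ?_⟩
      · intro hk
        obtain rfl : k = n := by omega
        have : c⁻¹ * p ^ k = c := by
          have := hps k
          rw [inv_mul_eq_iff_eq_mul₀ hc0]
          apply mul_right_cancel₀ (pow_ne_zero k hs0); rw [this, ← hc]; ring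
        rw [this]; ring
      · have step : ∑ r ∈ Finset.range (k + 1 + 1),
            qProdCoeff p (k + 1) r • (V ^ r * U ^ (k + 1 - r)) =
            (∑ r ∈ Finset.range (k + 1), qProdCoeff p k r • (V ^ r * U ^ (k - r))) * U -
            p ^ k • (V * ∑ r ∈ Finset.range (k + 1),
              qProdCoeff p k r • (V ^ r * U ^ (k - r))) := by
          rw [Finset.sum_range_succ']
          simp only [qProdCoeff, sub_smul, Finset.sum_sub_distrib]
          rw [sub_add_eq_add_sub]
          congr 1
          · have := Finset.sum_range_succ' (fun r => qProdCoeff p k r • (V ^ r * U ^ (k + 1 - r)))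
              (k + 1)
            rw [← this, Finset.sum_range_succ, qProdCoeff_of_lt p (Nat.lt_succ_self k), zero_smul,
              add_zero, Finset.sum_mul]
            refine Finset.sum_congr rfl fun r hr => ?_
            rw [Finset.mem_range] at hr
            rw [smul_mul_assoc, mul_assoc, ← pow_succ, show k + 1 - r = k - r + 1 by omega]
          · rw [Finset.mul_sum, Finset.smul_sum]
            refine Finset.sum_congr rfl fun r hr => ?_
            rw [mul_smul_comm, smul_smul, ← mul_assoc, ← pow_succ',
              show k + 1 - (r + 1) = k - r by omega]
        rw [step, ha, mul_smul_comm, h1, hU]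
        simp only [mul_sub, smul_mul_assoc, mul_smul_comm, pow_succ, smul_sub]
        have e1 := hps k
        match_scalars
        · linear_combination (-a) * e1
        · linear_combination (a * c⁻¹ * p ^ k) * e1
  obtain ⟨a, ha0, ha⟩ := h2 (n + 1)
  rw [ha0 rfl, zero_smul] at ha
  calc _ = ρ 0 • ∑ r ∈ Finset.range (n + 1 + 1),
        qProdCoeff p (n + 1) r • (V ^ r * U ^ (n + 1 - r)) := by
        rw [Finset.smul_sum]
        refine Finset.sum_congr rfl fun r hr => ?_
        rw [Finset.mem_range] at hr
        rw [smul_smul, ← hρ' r (by omega), hVc, smul_pow, smul_mul_assoc, smul_smul]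
    _ = 0 := by rw [ha, smul_zero]

end QuantumPlane

section ModeSeries

/-- The canonical `ℕ`-algebra structure of `Fq`, which instance search does not find. -/
abbrev natAlgebraFq : Algebra ℕ Fq := Semiring.toNatAlgebra

/-- The canonical `ℤ`-algebra structure of `Fq`, which instance search does not find. -/
abbrev intAlgebraFq : Algebra ℤ Fq := Ring.toIntAlgebra _

attribute [local instance] natAlgebraFq intAlgebraFq

variable {R : Type*} [Ring R] [Algebra Fq R]

lemma mixedPow_conj {S : Type*} [Ring S] (z a a' b : S) (h : a * z = z * a') (m : ℕ) :
    mixedPow a z b m = z * mixedPow a' 1 b m := by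
  induction m with
  | zero => simp [mixedPow]
  | succ m ih =>
    rw [mixedPow, ih, mixedPow, ← mul_assoc, h]
    simp only [mul_add, mul_assoc, one_mul]

lemma pow_conj {S : Type*} [Ring S] (z a a' : S) (h : a * z = z * a') (m : ℕ) :
    a ^ m * z = z * a' ^ m := by
  induction m with
  | zero => simp
  | succ m ih => rw [pow_succ, mul_assoc, h, ← mul_assoc, ih, mul_assoc, ← pow_succ]

/-- The generating series of the modes `x r`, weighted by the expansion of `1 / (t - b)`. -/
def modeSer (b : Fq) (x : ℕ → R) : PowerSeries R :=
  PowerSeries.mk fun r => (-(b⁻¹ ^ (r + 1))) • x r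

/-- The generating series of the shifted modes `x (r + 1)`, multiplied by the variable. -/
def modeSerShift (b : Fq) (x : ℕ → R) : PowerSeries R :=
  PowerSeries.X * PowerSeries.mk fun r => (-(b⁻¹ ^ (r + 1))) • x (r + 1)

lemma C_eq_modeSer (b : Fq) (hb : b ≠ 0) (x : ℕ → R) :
    PowerSeries.C (x 0) = modeSerShift b x - b • modeSer b x := by
  ext m
  rcases m with _ | m
  · simp [modeSer, modeSerShift, hb]
  · simp [modeSer, modeSerShift, PowerSeries.coeff_succ_X_mul]
    match_scalars
    field_simp
    ring

lemma gcoef_mk_eq_modeSer (b : Fq) (hb : b ≠ 0) (x : ℕ → R) :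
    (PowerSeries.mk fun r => gcoef b r • x r) = b • modeSerShift b x - modeSer b x := by
  ext m
  rcases m with _ | m
  · simp [modeSer, modeSerShift, gcoef]
  · simp [modeSer, modeSerShift, gcoef, PowerSeries.coeff_succ_X_mul]
    rw [show (-(m : ℤ) - 2) = -((m + 2 : ℕ) : ℤ) by push_cast; ring, zpow_neg, zpow_natCast]
    match_scalars
    field_simp
    ring

lemma modeSer_relation (b c k : Fq) (x y : ℕ → R)
    (h : ∀ r t, x (r + 1) * y t + y (t + 1) * x r = c • (y t * x (r + 1) + x r * y (t + 1))) :
    modeSerShift b x * modeSer k y + modeSerShift k y * modeSer b x =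
      c • (modeSer b x * modeSerShift k y + modeSer k y * modeSerShift b x) := by
  simp only [modeSerShift]
  rw [← mul_assoc (modeSer b x), ← mul_assoc (modeSer k y), ← PowerSeries.X_mul,
    ← PowerSeries.X_mul, mul_assoc, mul_assoc, mul_assoc, mul_assoc, ← mul_add, ← mul_add,
    ← mul_smul_comm]
  congr 1
  ext m
  simp only [modeSer, map_add, PowerSeries.coeff_mul, PowerSeries.coeff_mk, PowerSeries.coeff_smul]
  rw [← Finset.Nat.sum_antidiagonal_swap (n := m) (f := fun p =>
      (-(k⁻¹ ^ (p.1 + 1))) • y (p.1 + 1) * (-(b⁻¹ ^ (p.2 + 1))) • x p.2),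
    ← Finset.Nat.sum_antidiagonal_swap (n := m) (f := fun p =>
      (-(k⁻¹ ^ (p.1 + 1))) • y p.1 * (-(b⁻¹ ^ (p.2 + 1))) • x (p.2 + 1)),
    ← Finset.sum_add_distrib, ← Finset.sum_add_distrib, Finset.smul_sum]
  refine Finset.sum_congr rfl fun p _ => ?_
  have := h p.1 p.2
  simp only [Prod.fst_swap, Prod.snd_swap, smul_mul_assoc, mul_smul_comm, smul_smul]
  have e : x (p.1 + 1) * y p.2 = c • (y p.2 * x (p.1 + 1) + x p.1 * y (p.2 + 1)) -
    y (p.2 + 1) * x p.1 := by rw [← this]; abel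
  rw [e]
  module

lemma modeSer_relation_self (b s : Fq) (x : ℕ → R)
    (h : ∀ r t, x (r + 1) * x t + x (t + 1) * x r = s • (x t * x (r + 1) + x r * x (t + 1))) :
    modeSerShift b x * modeSer b x = s • (modeSer b x * modeSerShift b x) := by
  have := modeSer_relation b s b x x h
  rw [← two_smul Fq, ← two_smul Fq, smul_comm s] at this
  exact smul_right_injective _ (two_ne_zero : (2 : Fq) ≠ 0) this

/-- Extension by zero of a sequence to `ℤ`. -/
def extZ (Ψ : ℕ → R) (m : ℤ) : R := if 0 ≤ m then Ψ m.toNat else 0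

/-- The sum of the coefficients of a power series at the degrees `kk t`. -/
def coeffSum {ι : Type*} (T : Finset ι) (kk : ι → ℤ) (f : PowerSeries R) : R :=
  ∑ t ∈ T, extZ (fun p => PowerSeries.coeff p f) (kk t)

section

variable {ι : Type*} (T : Finset ι) (kk : ι → ℤ)

omit [Algebra Fq R] in
lemma coeffSum_add (f g : PowerSeries R) :
    coeffSum T kk (f + g) = coeffSum T kk f + coeffSum T kk g := by
  rw [coeffSum, coeffSum, coeffSum, ← Finset.sum_add_distrib]
  refine Finset.sum_congr rfl fun t _ => ?_
  unfold extZ; split_ifs <;> simp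

lemma coeffSum_smul (a : Fq) (f : PowerSeries R) :
    coeffSum T kk (a • f) = a • coeffSum T kk f := by
  rw [coeffSum, coeffSum, Finset.smul_sum]
  refine Finset.sum_congr rfl fun t _ => ?_
  unfold extZ; split_ifs <;> simp

lemma coeffSum_zero : coeffSum T kk (0 : PowerSeries R) = 0 := by
  simpa using coeffSum_smul T kk 0 (0 : PowerSeries R)

lemma coeffSum_sum {κ : Type*} (S : Finset κ) (f : κ → PowerSeries R) :
    coeffSum T kk (∑ r ∈ S, f r) = ∑ r ∈ S, coeffSum T kk (f r) := by
  classical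
  induction S using Finset.induction_on with
  | empty => simp [coeffSum_zero]
  | insert a S ha ih => rw [Finset.sum_insert ha, Finset.sum_insert ha, coeffSum_add, ih]

omit [Algebra Fq R] in
lemma coeffSum_C_mul (a : R) (f : PowerSeries R) :
    coeffSum T kk (PowerSeries.C a * f) = a * coeffSum T kk f := by
  rw [coeffSum, coeffSum, Finset.mul_sum]
  refine Finset.sum_congr rfl fun t _ => ?_
  unfold extZ; split_ifs <;> simp

omit [Algebra Fq R] in
lemma coeffSum_mul_C (a : R) (f : PowerSeries R) :
    coeffSum T kk (f * PowerSeries.C a) = coeffSum T kk f * a := by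
  rw [coeffSum, coeffSum, Finset.sum_mul]
  refine Finset.sum_congr rfl fun t _ => ?_
  unfold extZ; split_ifs <;> simp

lemma coeffSum_mixedPow (a b : R) (f : PowerSeries R) (m : ℕ) :
    coeffSum T kk (mixedPow (PowerSeries.C a) f (PowerSeries.C b) m) =
      mixedPow a (coeffSum T kk f) b m := by
  induction m with
  | zero => simp [mixedPow, coeffSum_zero]
  | succ m ih =>
    rw [mixedPow, mixedPow, coeffSum_add, coeffSum_C_mul, ih, ← map_pow, coeffSum_mul_C]

end

lemma C_mul_mk_of_exchange (b : Fq) (x Ψ : ℕ → R)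
    (h : ∀ p, x 0 * Ψ p = ∑ r ∈ Finset.range (p + 1), gcoef b r • (Ψ (p - r) * x r)) :
    PowerSeries.C (x 0) * PowerSeries.mk Ψ =
      PowerSeries.mk Ψ * PowerSeries.mk fun r => gcoef b r • x r := by
  ext p
  rw [PowerSeries.coeff_C_mul, PowerSeries.coeff_mk, h, PowerSeries.coeff_mul,
    ← Finset.Nat.sum_antidiagonal_swap, Finset.Nat.sum_antidiagonal_eq_sum_range_succ_mk]
  simp

section

variable {s c : Fq} {x y : ℤ → R} {Ψ : ℕ → R} {ι : Type*}

lemma sum_modes_exchange {b : Fq}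
    (h : ∀ (m : ℤ) (p : ℕ),
      x m * Ψ p = ∑ r ∈ Finset.range (p + 1), gcoef b r • (Ψ (p - r) * x (m + r)))
    (T : Finset ι) (kk : ι → ℤ) :
    PowerSeries.C (∑ t ∈ T, x (kk t)) * PowerSeries.mk Ψ =
      PowerSeries.mk Ψ * PowerSeries.mk fun r : ℕ => gcoef b r • ∑ t ∈ T, x (kk t + r) := by
  have := C_mul_mk_of_exchange b (fun r : ℕ => ∑ t ∈ T, x (kk t + r)) Ψ
  simp only [Nat.cast_zero, add_zero] at this
  apply this
  intro p
  rw [Finset.sum_mul, Finset.sum_congr rfl fun t _ => h (kk t) p, Finset.sum_comm]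
  simp only [Finset.mul_sum, Finset.smul_sum]

lemma sum_modes_relation
    (h : ∀ k l, x (k + 1) * y l + y (l + 1) * x k = c • (y l * x (k + 1) + x k * y (l + 1)))
    {κ : Type*} (T : Finset ι) (kk : ι → ℤ) (S : Finset κ) (ll : κ → ℤ) (r t : ℕ) :
    (∑ u ∈ T, x (kk u + (r + 1 : ℕ))) * (∑ w ∈ S, y (ll w + t)) +
      (∑ w ∈ S, y (ll w + (t + 1 : ℕ))) * (∑ u ∈ T, x (kk u + r)) =
    c • ((∑ w ∈ S, y (ll w + t)) * (∑ u ∈ T, x (kk u + (r + 1 : ℕ))) +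
      (∑ u ∈ T, x (kk u + r)) * (∑ w ∈ S, y (ll w + (t + 1 : ℕ)))) := by
  have e (f g : ℤ → R) (a b : ℕ) : (∑ w ∈ S, f (ll w + a)) * (∑ u ∈ T, g (kk u + b)) =
      ∑ u ∈ T, ∑ w ∈ S, f (ll w + a) * g (kk u + b) := by
    rw [Finset.sum_mul_sum, Finset.sum_comm]
  rw [e, e, Finset.sum_mul_sum, Finset.sum_mul_sum]
  simp only [← Finset.sum_add_distrib, Finset.smul_sum]
  refine Finset.sum_congr rfl fun u _ => Finset.sum_congr rfl fun w _ => ?_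
  have := h (kk u + r) (ll w + t)
  push_cast
  simpa only [add_assoc] using this

/-- The `ε`-part of the quantum Serre polynomial when the repeated variable is deformed. -/
lemma serre_deform_modes_repeated
    (hxx : ∀ k l, x (k + 1) * x l + x (l + 1) * x k = s • (x l * x (k + 1) + x k * x (l + 1)))
    (hxy : ∀ k l, x (k + 1) * y l + y (l + 1) * x k = c • (y l * x (k + 1) + x k * y (l + 1)))
    (hΨx : ∀ (m : ℤ) (p : ℕ),
      x m * Ψ p = ∑ r ∈ Finset.range (p + 1), gcoef s r • (Ψ (p - r) * x (m + r)))
    (hΨy : ∀ (m : ℤ) (p : ℕ),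
      y m * Ψ p = ∑ r ∈ Finset.range (p + 1), gcoef c r • (Ψ (p - r) * y (m + r)))
    {n : ℕ} (hc : c ^ 2 * s ^ n = 1) (hs : s ≠ 1) (hs0 : s ≠ 0) (hc0 : c ≠ 0) (ρ : ℕ → Fq)
    (hρ : ∀ r, r ≤ n → ρ (r + 1) * (s ^ (r + 1) - 1) = -(c * (s ^ (n + 1) - s ^ r)) * ρ r)
    (T : Finset ι) (kk : ι → ℤ) (l k : ℤ) :
    ∑ r ∈ Finset.range (n + 2), ρ r •
      (mixedPow (∑ t ∈ T, x (kk t)) (∑ t ∈ T, extZ Ψ (kk t + k)) (∑ t ∈ T, x (kk t)) r * y l *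
          (∑ t ∈ T, x (kk t)) ^ (n + 1 - r) +
        (∑ t ∈ T, x (kk t)) ^ r * y l *
          mixedPow (∑ t ∈ T, x (kk t)) (∑ t ∈ T, extZ Ψ (kk t + k)) (∑ t ∈ T, x (kk t))
            (n + 1 - r)) = 0 := by
  set X := ∑ t ∈ T, x (kk t) with hX
  set f := PowerSeries.mk Ψ with hf
  set Xr : ℕ → R := fun r => ∑ t ∈ T, x (kk t + r) with hXr
  set Yr : ℕ → R := fun r => ∑ w ∈ ({()} : Finset Unit), y (l + r) with hYr
  have hX0 : Xr 0 = X := by simp [hXr, hX]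
  have hY0 : Yr 0 = y l := by simp [hYr]
  have e1 := sum_modes_exchange hΨx T kk
  have e2 := sum_modes_exchange hΨy ({()} : Finset Unit) (fun _ => l)
  change _ = _ * PowerSeries.mk (fun r => gcoef s r • Xr r) at e1
  change _ = _ * PowerSeries.mk (fun r => gcoef c r • Yr r) at e2
  rw [← hX, gcoef_mk_eq_modeSer s hs0] at e1
  rw [gcoef_mk_eq_modeSer c hc0, Finset.sum_singleton] at e2
  have r1 := modeSer_relation_self s s Xr (fun r t => sum_modes_relation hxx T kk T kk r t)
  have r2 := modeSer_relation s c c Xr Yr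
    (fun r t => sum_modes_relation hxy T kk ({()} : Finset Unit) (fun _ => l) r t)
  have main := serre_deform_repeated r1
    (by rw [r2, add_comm] : modeSerShift s Xr * modeSer c Yr + modeSerShift c Yr * modeSer s Xr =
      c • (modeSer s Xr * modeSerShift c Yr + modeSer c Yr * modeSerShift s Xr)) hc hs ρ hρ
  rw [← C_eq_modeSer s hs0, ← C_eq_modeSer c hc0, hX0, hY0] at main
  have hD : coeffSum T (fun t => kk t + k) f = ∑ t ∈ T, extZ Ψ (kk t + k) := by
    simp [coeffSum, hf]
  have := congrArg (fun g => coeffSum T (fun t => kk t + k) (f * g)) main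
  simp only [mul_zero, coeffSum_zero, Finset.mul_sum, coeffSum_sum] at this
  rw [← this]
  refine Finset.sum_congr rfl fun r _ => ?_
  rw [mul_smul_comm, coeffSum_smul, mul_add, coeffSum_add]
  congr 2
  · rw [← mul_assoc, ← mul_assoc, ← mixedPow_conj f _ _ _ e1, ← map_pow, coeffSum_mul_C,
      coeffSum_mul_C, coeffSum_mixedPow, hD]
  · rw [← mul_assoc, ← mul_assoc, ← pow_conj f _ _ e1, mul_assoc _ f, ← e2, mul_assoc, mul_assoc,
      mul_assoc (PowerSeries.C (y l)),
      ← mixedPow_conj f _ _ _ e1, ← map_pow, coeffSum_C_mul, coeffSum_C_mul, coeffSum_mixedPow, hD]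

/-- The `ε`-part of the quantum Serre polynomial when the single variable is deformed. -/
lemma serre_deform_modes_single
    (hxx : ∀ k l, x (k + 1) * x l + x (l + 1) * x k = s • (x l * x (k + 1) + x k * x (l + 1)))
    (hΨx : ∀ (m : ℤ) (p : ℕ),
      x m * Ψ p = ∑ r ∈ Finset.range (p + 1), gcoef c r • (Ψ (p - r) * x (m + r)))
    {n : ℕ} (hc : c ^ 2 * s ^ n = 1) (hs : ∀ r, r ≤ n → s ^ (r + 1) ≠ 1) (hs0 : s ≠ 0)
    (hc0 : c ≠ 0) (ρ : ℕ → Fq)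
    (hρ : ∀ r, r ≤ n → ρ (r + 1) * (s ^ (r + 1) - 1) = -(c * (s ^ (n + 1) - s ^ r)) * ρ r)
    (T : Finset ι) (kk : ι → ℤ) (k : ℤ) :
    ∑ r ∈ Finset.range (n + 2), ρ r •
      ((∑ t ∈ T, x (kk t)) ^ r * extZ Ψ k * (∑ t ∈ T, x (kk t)) ^ (n + 1 - r)) = 0 := by
  set X := ∑ t ∈ T, x (kk t) with hX
  set f := PowerSeries.mk Ψ with hf
  set Xr : ℕ → R := fun r => ∑ t ∈ T, x (kk t + r) with hXr
  have hX0 : Xr 0 = X := by simp [hXr, hX]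
  have e1 := sum_modes_exchange hΨx T kk
  change _ = _ * PowerSeries.mk (fun r => gcoef c r • Xr r) at e1
  rw [← hX, gcoef_mk_eq_modeSer c hc0] at e1
  have r1 := modeSer_relation_self c s Xr (fun r t => sum_modes_relation hxx T kk T kk r t)
  have main := serre_deform_single r1 hc hs hs0 ρ hρ
  rw [← C_eq_modeSer c hc0, hX0] at main
  have hD : coeffSum ({()} : Finset Unit) (fun _ => k) f = extZ Ψ k := by
    simp [coeffSum, hf]
  have := congrArg (fun g => coeffSum ({()} : Finset Unit) (fun _ => k) (f * g)) main
  simp only [mul_zero, coeffSum_zero, Finset.mul_sum, coeffSum_sum] at this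
  rw [← this]
  refine Finset.sum_congr rfl fun r _ => ?_
  rw [mul_smul_comm, coeffSum_smul]
  congr 1
  rw [← mul_assoc, ← pow_conj f _ _ e1, ← map_pow, ← map_pow, coeffSum_mul_C, coeffSum_C_mul, hD]

/-- The quadratic relation between `Ψ` and `x`. -/
lemma extZ_exchange {b : Fq} (hb : b ≠ 0)
    (h : ∀ (m : ℤ) (p : ℕ),
      x m * Ψ p = ∑ r ∈ Finset.range (p + 1), gcoef b r • (Ψ (p - r) * x (m + r))) (k l : ℤ) :
    extZ Ψ (k + 1) * x l + x (l + 1) * extZ Ψ k =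
      b • (x l * extZ Ψ (k + 1) + extZ Ψ k * x (l + 1)) := by
  rcases lt_trichotomy k (-1) with hk | rfl | hk
  · simp [extZ, not_le.2 (by omega : k < 0), not_le.2 (by omega : k + 1 < 0)]
  · have := h l 0
    simp [extZ, gcoef] at this ⊢
    rw [this, smul_smul, mul_inv_cancel₀ hb, one_smul]
  · obtain ⟨p, rfl⟩ : ∃ p : ℕ, k = p := ⟨k.toNat, by omega⟩
    have e1 := h l (p + 1)
    have e2 := h (l + 1) p
    have : extZ Ψ ((p : ℤ) + 1) = Ψ (p + 1) := by
      rw [extZ, if_pos (by omega)]; rfl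
    rw [this, show extZ Ψ (p : ℤ) = Ψ p by simp [extZ], e1, e2]
    rw [Finset.sum_range_succ', Finset.sum_range_succ', Finset.sum_range_succ' _ p]
    simp only [gcoef, Nat.sub_zero, Nat.cast_zero, add_zero, smul_add, Finset.smul_sum, smul_smul]
    have hz : ∀ z : ℤ, b * b ^ (z - 1) = b ^ z := fun z => by
      rw [zpow_sub_one₀ hb, mul_comm, mul_assoc, inv_mul_cancel₀ hb, mul_one]
    have hsum : ∀ r ∈ Finset.range p,
        (b * (b ^ (-((r + 1 : ℕ) : ℤ) - 2) - b ^ (-((r + 1 : ℕ) : ℤ)))) •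
          (Ψ (p + 1 - (r + 1 + 1)) * x (l + ((r + 1 + 1 : ℕ) : ℤ))) =
        (b ^ (-(r : ℤ) - 2) - b ^ (-(r : ℤ))) •
          (Ψ (p - (r + 1)) * x (l + 1 + ((r + 1 : ℕ) : ℤ))) := fun r _ => by
      rw [show p + 1 - (r + 1 + 1) = p - (r + 1) by omega,
        show l + ((r + 1 + 1 : ℕ) : ℤ) = l + 1 + ((r + 1 : ℕ) : ℤ) by push_cast; ring, mul_sub,
        ← hz (-(r : ℤ) - 2), ← hz (-(r : ℤ))]
      congr 3 <;> push_cast <;> ring_nf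
    rw [Finset.sum_congr rfl hsum]
    simp only [neg_zero, zero_sub, zpow_zero, zero_add, Nat.add_sub_cancel,
      Nat.cast_one]
    have : b * (b ^ (-2 : ℤ) - 1) = b⁻¹ - b := by
      rw [mul_sub, mul_one, show (-2 : ℤ) = -1 - 1 by norm_num, hz, zpow_neg_one]
    rw [this, mul_inv_cancel₀ hb]
    module

end

end ModeSeries

section Deformation

attribute [local instance] natAlgebraFq intAlgebraFq

section Polarization

variable {S : Type*} [Ring S] [Algebra Fq S] {n : ℕ}

/-- The product of the `z t`, `t : Fin n`, in increasing order, with `y` inserted before the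
`r`-th factor. -/
def insertProd (y : S) (r : ℕ) (z : Fin n → S) : S :=
  (((List.finRange n).take r).map z).prod * y * (((List.finRange n).drop r).map z).prod

omit [Algebra Fq S] in
lemma map_update_prod_of_mem {ι : Type*} [DecidableEq ι] (L : List ι) (hL : L.Nodup) (i : ι)
    (hi : i ∈ L) (z : ι → S) :
    ∃ u v : S, ∀ a, (L.map (Function.update z i a)).prod = u * a * v := by
  obtain ⟨L₁, L₂, rfl⟩ := List.append_of_mem hi
  rw [List.nodup_append] at hL
  obtain ⟨-, h2, h3⟩ := hL
  have h1 : i ∉ L₁ := fun h => h3 i h i (by simp) rfl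
  have h4 : i ∉ L₂ := (List.nodup_cons.1 h2).1
  have e : ∀ M : List ι, i ∉ M → ∀ a, M.map (Function.update z i a) = M.map z := fun M hM a =>
    List.map_congr_left fun j hj => Function.update_of_ne (by rintro rfl; exact hM hj) _ _
  refine ⟨(L₁.map z).prod, (L₂.map z).prod, fun a => ?_⟩
  simp [e _ h1, e _ h4, mul_assoc]

omit [Algebra Fq S] in
lemma insertProd_update (y : S) (r : ℕ) (z : Fin n → S) (i : Fin n) :
    ∃ u v : S, ∀ a, insertProd y r (Function.update z i a) = u * a * v := by
  have hnd : ((List.finRange n).take r ++ (List.finRange n).drop r).Nodup := by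
    rw [List.take_append_drop]; exact List.nodup_finRange n
  have hi : i ∈ (List.finRange n).take r ++ (List.finRange n).drop r := by
    rw [List.take_append_drop]; exact List.mem_finRange i
  rw [List.nodup_append] at hnd
  obtain ⟨n1, n2, n3⟩ := hnd
  have e : ∀ M : List (Fin n), i ∉ M → ∀ a, M.map (Function.update z i a) = M.map z :=
    fun M hM a => List.map_congr_left fun j hj =>
      Function.update_of_ne (by rintro rfl; exact hM hj) _ _
  rcases List.mem_append.1 hi with h | h
  · obtain ⟨u, v, huv⟩ := map_update_prod_of_mem _ n1 i h z
    have h' : i ∉ (List.finRange n).drop r := fun h' => n3 i h i h' rfl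
    exact ⟨u, v * y * (((List.finRange n).drop r).map z).prod, fun a => by
      rw [insertProd, huv, e _ h']; simp only [mul_assoc]⟩
  · obtain ⟨u, v, huv⟩ := map_update_prod_of_mem _ n2 i h z
    have h' : i ∉ (List.finRange n).take r := fun h' => n3 i h' i h rfl
    exact ⟨(((List.finRange n).take r).map z).prod * y * u, v, fun a => by
      rw [insertProd, huv, e _ h']; simp only [mul_assoc]⟩

/-- `insertProd` as a multilinear map. -/
def insertProdMultilinear (y : S) (r : ℕ) : MultilinearMap Fq (fun _ : Fin n => S) S where
  toFun := insertProd y r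
  map_update_add' := by
    intro inst z i a b
    rw [Subsingleton.elim inst (instDecidableEqFin n)]
    obtain ⟨u, v, h⟩ := insertProd_update y r z i
    simp only [h, mul_add, add_mul]
  map_update_smul' := by
    intro inst z i c a
    rw [Subsingleton.elim inst (instDecidableEqFin n)]
    obtain ⟨u, v, h⟩ := insertProd_update y r z i
    simp only [h, mul_smul_comm, smul_mul_assoc]

omit [Algebra Fq S] in
lemma insertProd_const (y z : S) {r : ℕ} (hr : r ≤ n) :
    insertProd y r (fun _ : Fin n => z) = z ^ r * y * z ^ (n - r) := by
  simp [insertProd, hr]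

lemma sum_superset_neg_one_pow (U : Finset (Fin n)) :
    ∑ T : Finset (Fin n), (if U ⊆ T then (-1 : ℤ) ^ (Tᶜ).card else 0) =
      if U = Finset.univ then 1 else 0 := by
  have h1 : ∑ T : Finset (Fin n), (if U ⊆ T then (-1 : ℤ) ^ (Tᶜ).card else 0) =
      ∑ T ∈ (Uᶜ).powerset, (-1 : ℤ) ^ T.card := by
    rw [← Finset.sum_filter]
    refine Finset.sum_nbij' (fun T => Tᶜ) (fun T => Tᶜ) ?_ ?_ ?_ ?_ ?_
    · intro T hT; simpa using hT
    · intro T hT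
      simp only [Finset.mem_powerset] at hT
      simpa using (Finset.subset_compl_comm.1 hT)
    · intro T _; simp
    · intro T _; simp
    · intro T _; rfl
  rw [h1, Finset.sum_powerset_neg_one_pow_card]
  simp [Finset.compl_eq_empty_iff]

/-- Polarization: the symmetrized Serre polynomial is a combination of Serre polynomials in the
partial sums of the variables. -/
lemma sum_perm_insertProd (ρ : ℕ → Fq) (y : S) (x : Fin n → S) :
    ∑ σ : Equiv.Perm (Fin n), ∑ r ∈ Finset.range (n + 1), ρ r • insertProd y r (x ∘ σ) =
      ∑ T : Finset (Fin n), (-1 : ℤ) ^ (Tᶜ).card • ∑ r ∈ Finset.range (n + 1),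
        ρ r • ((∑ t ∈ T, x t) ^ r * y * (∑ t ∈ T, x t) ^ (n - r)) := by
  have h1 (T : Finset (Fin n)) : ∑ r ∈ Finset.range (n + 1),
        ρ r • ((∑ t ∈ T, x t) ^ r * y * (∑ t ∈ T, x t) ^ (n - r)) =
      ∑ f : Fin n → Fin n, if Finset.univ.image f ⊆ T then
        ∑ r ∈ Finset.range (n + 1), ρ r • insertProd y r (x ∘ f) else 0 := by
    rw [← Finset.sum_filter]
    have hT : (Finset.univ.filter fun f : Fin n → Fin n => Finset.univ.image f ⊆ T) =
        Fintype.piFinset fun _ => T := by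
      ext f; simp [Finset.image_subset_iff]
    rw [hT, Finset.sum_comm]
    refine Finset.sum_congr rfl fun r hr => ?_
    rw [Finset.mem_range] at hr
    rw [← insertProd_const (n := n) y _ (by omega), ← Finset.smul_sum]
    congr 1
    have := (insertProdMultilinear (n := n) y r).map_sum_finset (α := fun _ => Fin n)
      (fun (_ : Fin n) (t : Fin n) => x t) (fun _ => T)
    exact this
  simp only [h1]
  rw [Finset.sum_congr rfl fun T _ => Finset.smul_sum,
    Finset.sum_comm (s := (Finset.univ : Finset (Finset (Fin n))))]
  refine Fintype.sum_of_injective (fun σ : Equiv.Perm (Fin n) => (σ : Fin n → Fin n))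
    DFunLike.coe_injective
    (fun σ => ∑ r ∈ Finset.range (n + 1), ρ r • insertProd y r (x ∘ σ))
    (fun f => ∑ T : Finset (Fin n), (-1 : ℤ) ^ (Tᶜ).card •
      if Finset.univ.image f ⊆ T then
        ∑ r ∈ Finset.range (n + 1), ρ r • insertProd y r (x ∘ f) else 0) ?_ ?_
  · intro f hf
    have hne : Finset.univ.image f ≠ Finset.univ := fun h => hf
      ⟨Equiv.ofBijective f (Finite.injective_iff_bijective.1 (Finite.injective_iff_surjective.2
        (by
          rw [← Set.range_eq_univ]
          simpa using congrArg (fun s : Finset (Fin n) => (s : Set (Fin n))) h))), rfl⟩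
    have := sum_superset_neg_one_pow (Finset.univ.image f)
    rw [if_neg hne] at this
    calc _ = ∑ T : Finset (Fin n), (if Finset.univ.image f ⊆ T then (-1 : ℤ) ^ (Tᶜ).card else 0) •
          ∑ r ∈ Finset.range (n + 1), ρ r • insertProd y r (x ∘ f) :=
          Finset.sum_congr rfl fun T _ => by split_ifs <;> simp
      _ = 0 := by rw [← Finset.sum_smul, this, zero_smul]
  · intro σ
    have : Finset.univ.image (σ : Fin n → Fin n) = Finset.univ :=
      Finset.image_univ_of_surjective σ.surjective
    have h := sum_superset_neg_one_pow (Finset.univ.image (σ : Fin n → Fin n))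
    rw [if_pos this] at h
    symm
    calc _ = ∑ T : Finset (Fin n), (if Finset.univ.image σ ⊆ T then (-1 : ℤ) ^ (Tᶜ).card else 0) •
          ∑ r ∈ Finset.range (n + 1), ρ r • insertProd y r (x ∘ σ) :=
          Finset.sum_congr rfl fun T _ => by split_ifs <;> simp
      _ = _ := by rw [← Finset.sum_smul, h, one_smul]

end Polarization

variable {R : Type*} [Ring R] [Algebra Fq R]

/-- The sequence `Ψ` can be moved to the left across the modes `x`, with structure series `g_b`. -/
def Exchange (b : Fq) (x : ℤ → R) (Ψ : ℕ → R) : Prop :=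
  ∀ (m : ℤ) (p : ℕ),
    x m * Ψ p = ∑ r ∈ Finset.range (p + 1), gcoef b r • (Ψ (p - r) * x (m + r))

/-- The quadratic Drinfeld relation. -/
def QuadRel (c : Fq) (x y : ℤ → R) : Prop :=
  ∀ k l, x (k + 1) * y l + y (l + 1) * x k = c • (y l * x (k + 1) + x k * y (l + 1))

lemma Exchange.zero (b : Fq) (x : ℤ → R) : Exchange b x 0 := fun m p => by simp

lemma Exchange.central_mul {b : Fq} {x : ℤ → R} {Ψ : ℕ → R} (h : Exchange b x Ψ) (z : R)
    (hz : ∀ m, Commute z (x m)) : Exchange b x fun p => z * Ψ p := fun m p => by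
  rw [← mul_assoc, ← (hz m).eq, mul_assoc, h m p, Finset.mul_sum]
  refine Finset.sum_congr rfl fun r _ => ?_
  rw [mul_smul_comm, mul_assoc]

lemma QuadRel.reflect {c : Fq} (hc : c ≠ 0) {x y : ℤ → R} (h : QuadRel c x y) :
    QuadRel c⁻¹ (fun m => x (-m)) (fun m => y (-m)) := fun k l => by
  have := h (-k - 1) (-l - 1)
  simp only [sub_add_cancel] at this
  beta_reduce
  rw [show -(k + 1) = -k - 1 by ring, show -(l + 1) = -l - 1 by ring]
  rw [eq_inv_smul_iff₀ hc, add_comm (x (-k - 1) * y (-l)), ← this, add_comm]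

/-- The scalar conditions on the coefficients of a quantum Serre polynomial of degree `n + 1`. -/
structure SerreCoeff (s c : Fq) (n : ℕ) (ρ : ℕ → Fq) : Prop where
  sq : c ^ 2 * s ^ n = 1
  pow_ne : ∀ r, r ≤ n → s ^ (r + 1) ≠ 1
  s_ne : s ≠ 0
  c_ne : c ≠ 0
  ratio : ∀ r, r ≤ n → ρ (r + 1) * (s ^ (r + 1) - 1) = -(c * (s ^ (n + 1) - s ^ r)) * ρ r

lemma SerreCoeff.inv {s c : Fq} {n : ℕ} {ρ : ℕ → Fq} (h : SerreCoeff s c n ρ) :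
    SerreCoeff s⁻¹ c⁻¹ n ρ where
  sq := by rw [inv_pow, inv_pow, ← mul_inv, h.sq, inv_one]
  pow_ne r hr h' := h.pow_ne r hr (by rw [inv_pow] at h'; exact inv_eq_one.1 h')
  s_ne := inv_ne_zero h.s_ne
  c_ne := inv_ne_zero h.c_ne
  ratio r hr := by
    have h1 := h.ratio r hr
    have h2 := h.sq
    have hs := h.s_ne
    have hc := h.c_ne
    obtain ⟨k, rfl⟩ := Nat.exists_eq_add_of_le hr
    have e : c⁻¹ = c * s ^ (r + k) :=
      inv_eq_of_mul_eq_one_right (by linear_combination h2)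
    rw [e]
    have e1 : s ^ (r + 1) * (s⁻¹ ^ (r + 1) - 1) = -(s ^ (r + 1) - 1) := by
      rw [mul_sub, ← mul_pow, mul_inv_cancel₀ hs]; ring
    have e2 : s ^ (r + 1) * (s ^ (r + k) * (s⁻¹ ^ (r + k + 1) - s⁻¹ ^ r)) =
        -(s ^ (r + k + 1) - s ^ r) := by
      rw [pow_succ s⁻¹ (r + k), pow_add s⁻¹ r k, pow_add s r k, pow_succ s r, pow_succ s (r + k),
        pow_add s r k, inv_pow, inv_pow]
      field_simp
      ring
    refine mul_left_cancel₀ (pow_ne_zero (r + 1) hs) ?_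
    linear_combination ρ (r + 1) * e1 + c * ρ r * e2 - h1

end Deformation

section Currents

attribute [local instance] natAlgebraFq intAlgebraFq

variable {R : Type*} [Ring R] [Algebra Fq R]

/-- The modes `∑_{p ≥ 0} Ψ_p δ_{l+k,p} - ∑_{p ≥ 0} Φ_p δ_{l+k,-p}`. -/
def currentMode (Ψ Φ : ℕ → R) (k l : ℤ) : R := extZ Ψ (l + k) - extZ Φ (-l - k)

/-- Exchange relations of a pair of half-currents with the modes `x`. -/
def BiExchange (b : Fq) (x : ℤ → R) (Ψ Φ : ℕ → R) : Prop :=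
  Exchange b x Ψ ∧ Exchange b⁻¹ (fun m => x (-m)) Φ

lemma BiExchange.zero (b : Fq) (x : ℤ → R) : BiExchange b x 0 0 :=
  ⟨Exchange.zero _ _, Exchange.zero _ _⟩

omit [Algebra Fq R] in
lemma currentMode_zero (k l : ℤ) : currentMode (0 : ℕ → R) 0 k l = 0 := by
  simp [currentMode, extZ]

lemma QuadRel.swap {c : Fq} {x y : ℤ → R} (h : QuadRel c x y) : QuadRel c y x := fun k l => by
  have := h l k
  rw [add_comm, this, add_comm]

lemma BiExchange.quadRel {b : Fq} (hb : b ≠ 0) {x : ℤ → R} {Ψ Φ : ℕ → R}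
    (h : BiExchange b x Ψ Φ) (k : ℤ) : QuadRel b (currentMode Ψ Φ k) x := fun m l => by
  have h1 := extZ_exchange hb h.1 (m + k) l
  have h2 := extZ_exchange (inv_ne_zero hb) h.2 (-m - 1 - k) (-l - 1)
  rw [eq_inv_smul_iff₀ hb] at h2
  simp only [currentMode]
  rw [show m + 1 + k = m + k + 1 by ring, show -(m + 1) - k = -m - 1 - k by ring]
  simp only [show -m - 1 - k + 1 = -m - k by ring, show -(-l - 1 + 1) = l by ring,
    show -(-l - 1) = l + 1 by ring] at h2
  simp only [sub_mul, mul_sub]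
  have h2' : extZ Φ (-m - 1 - k) * x l + x (l + 1) * extZ Φ (-m - k) =
      b • (x l * extZ Φ (-m - 1 - k) + extZ Φ (-m - k) * x (l + 1)) := by
    rw [add_comm (x l * _), h2, add_comm]
  have h3 := congrArg₂ (· - ·) h1 h2'
  simp only [← smul_sub] at h3
  convert h3 using 1
  · abel
  · congr 1; abel

/-- The dual number `a + ε b`. -/
def dual {R : Type*} (a b : R) : DualNumber R := (a, b)

section
variable {R : Type*}

@[simp] lemma fst_dual (a b : R) : TrivSqZeroExt.fst (dual a b) = a := rfl

@[simp] lemma snd_dual (a b : R) : TrivSqZeroExt.snd (dual a b) = b := rfl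

end

/-- Deformation of the quadratic relation to dual numbers. -/
lemma QuadRel.dual {c : Fq} {x y Dx Dy : ℤ → R} (h : QuadRel c x y) (hx : QuadRel c Dx y)
    (hy : QuadRel c x Dy) :
    QuadRel c (fun m => (dual (x m) (Dx m))) (fun m => (dual (y m) (Dy m))) :=
  fun k l => by
    have h1 := h k l
    have h2 := hx k l
    have h3 := hy k l
    ext
    · simpa using h1
    · simp only [TrivSqZeroExt.snd_add, TrivSqZeroExt.snd_mul, TrivSqZeroExt.snd_smul, fst_dual,
        snd_dual, smul_eq_mul, MulOpposite.smul_eq_mul_unop, MulOpposite.unop_op]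
      change (x (k+1) * Dy l + Dx (k+1) * y l) + (y (l+1) * Dx k + Dy (l+1) * x k) =
        c • ((y l * Dx (k+1) + Dy l * x (k+1)) + (x k * Dy (l+1) + Dx k * y (l+1)))
      have : c • ((y l * Dx (k+1) + Dy l * x (k+1)) + (x k * Dy (l+1) + Dx k * y (l+1))) =
        c • (y l * Dx (k+1) + Dx k * y (l+1)) + c • (Dy l * x (k+1) + x k * Dy (l+1)) := by
        rw [← smul_add]; congr 1; abel
      rw [this, ← h2, ← h3]; abel

omit [Algebra Fq R] in
lemma dualNumber_fst_pow (z : DualNumber R) (r : ℕ) :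
    TrivSqZeroExt.fst (z ^ r) = TrivSqZeroExt.fst z ^ r := TrivSqZeroExt.fst_pow _ _

omit [Algebra Fq R] in
lemma dualNumber_snd_pow (z : DualNumber R) (r : ℕ) :
    TrivSqZeroExt.snd (z ^ r) =
      mixedPow (TrivSqZeroExt.fst z) (TrivSqZeroExt.snd z) (TrivSqZeroExt.fst z) r := by
  induction r with
  | zero => simp [mixedPow]
  | succ r ih => rw [pow_succ', TrivSqZeroExt.snd_mul, ih]; simp [mixedPow]

omit [Algebra Fq R] in
lemma mixedPow_sub (a y y' b : R) (m : ℕ) :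
    mixedPow a (y - y') b m = mixedPow a y b m - mixedPow a y' b m := by
  induction m with
  | zero => simp [mixedPow]
  | succ m ih => simp only [mixedPow, ih]; noncomm_ring

/-- Deformation of the Drinfeld–Serre relation to dual numbers. -/
lemma dserre_dual {s c : Fq} {n : ℕ} {ρ : ℕ → Fq} (hρ : SerreCoeff s c n ρ) {x y : ℤ → R}
    (hxx : QuadRel s x x) (hxy : QuadRel c x y) {Ψ Φ Ψ' Φ' : ℕ → R}
    (hΨx : BiExchange s x Ψ Φ) (hΨy : BiExchange c y Ψ Φ) (hΨ'x : BiExchange c x Ψ' Φ')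
    (ks : Fin (n + 1) → ℤ) (k l : ℤ) :
    TrivSqZeroExt.snd (∑ σ : Equiv.Perm (Fin (n + 1)), ∑ r ∈ Finset.range (n + 2), ρ r •
      insertProd (dual (y l) (currentMode Ψ' Φ' k l)) r
        ((fun t => dual (x (ks t)) (currentMode Ψ Φ k (ks t))) ∘ σ)) = 0 := by
  rw [sum_perm_insertProd, TrivSqZeroExt.snd_sum]
  refine Finset.sum_eq_zero fun T _ => ?_
  rw [TrivSqZeroExt.snd_smul, TrivSqZeroExt.snd_sum]
  have hs1 : s ≠ 1 := by simpa using hρ.pow_ne 0 (Nat.zero_le _)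
  have hi := hρ.inv
  have hs1' : s⁻¹ ≠ 1 := by simpa using hi.pow_ne 0 (Nat.zero_le _)
  set X := ∑ t ∈ T, x (ks t) with hX
  have a1 := serre_deform_modes_repeated hxx hxy hΨx.1 hΨy.1 hρ.sq hs1 hρ.s_ne hρ.c_ne ρ hρ.ratio
    T ks l k
  have a2 := serre_deform_modes_repeated (x := fun m => x (-m)) (y := fun m => y (-m))
    (hxx.reflect hρ.s_ne) (hxy.reflect hρ.c_ne) hΨx.2 hΨy.2
    hi.sq hs1' hi.s_ne hi.c_ne ρ hi.ratio T (fun t => - ks t) (-l) (-k)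
  have a3 := serre_deform_modes_single hxx hΨ'x.1 hρ.sq hρ.pow_ne hρ.s_ne hρ.c_ne ρ hρ.ratio
    T ks (l + k)
  have a4 := serre_deform_modes_single (x := fun m => x (-m)) (hxx.reflect hρ.s_ne)
    hΨ'x.2 hi.sq hi.pow_ne hi.s_ne
    hi.c_ne ρ hi.ratio T (fun t => - ks t) (-l - k)
  simp only [neg_neg, ← sub_eq_add_neg] at a2 a4
  rw [← hX] at a1 a2 a3 a4
  have hfst : TrivSqZeroExt.fst (∑ t ∈ T, (dual (x (ks t)) (currentMode Ψ Φ k (ks t)))) =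
      X := by
    rw [TrivSqZeroExt.fst_sum]; rfl
  have hsnd : TrivSqZeroExt.snd (∑ t ∈ T, (dual (x (ks t)) (currentMode Ψ Φ k (ks t)))) =
      (∑ t ∈ T, extZ Ψ (ks t + k)) - ∑ t ∈ T, extZ Φ (- ks t - k) := by
    rw [TrivSqZeroExt.snd_sum, ← Finset.sum_sub_distrib]; rfl
  convert smul_zero ((-1 : ℤ) ^ (Tᶜ).card) using 2
  have key := congrArg₂ (· - ·) (congrArg₂ (· + ·) a1 a3) (congrArg₂ (· + ·) a2 a4)
  simp only [add_zero, sub_zero] at key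
  rw [← key, ← Finset.sum_add_distrib, ← Finset.sum_add_distrib, ← Finset.sum_sub_distrib]
  refine Finset.sum_congr rfl fun r _ => ?_
  rw [TrivSqZeroExt.snd_smul, TrivSqZeroExt.snd_mul, TrivSqZeroExt.snd_mul, dualNumber_snd_pow,
    dualNumber_snd_pow, TrivSqZeroExt.fst_mul, dualNumber_fst_pow, dualNumber_fst_pow, hfst, hsnd]
  simp only [← smul_add, ← smul_sub, mixedPow_sub]
  congr 1
  change X ^ r * y l * _ + (X ^ r * currentMode Ψ' Φ' k l + _ * y l) * X ^ (n + 1 - r) = _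
  simp only [currentMode]
  noncomm_ring

end Currents

section Scalars

lemma sqq_zpow_ne_one {n : ℤ} (hn : n ≠ 0) : sqq ^ n ≠ 1 := by
  have key : ∀ m : ℕ, m ≠ 0 → sqq ^ m ≠ 1 := by
    intro m hm h
    have h1 : algebraMap (Polynomial ℚ) Fq (Polynomial.X ^ m) = algebraMap _ _ 1 := by
      simpa [sqq] using h
    have h2 := IsFractionRing.injective (Polynomial ℚ) Fq h1
    have := congrArg Polynomial.natDegree h2
    simp at this
    exact hm this
  intro h
  rcases Int.natAbs_eq n with h' | h'
  · rw [h', zpow_natCast] at h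
    exact key _ (by simpa using hn) h
  · rw [h', zpow_neg, zpow_natCast, inv_eq_one] at h
    exact key _ (by simpa using hn) h

lemma qq_ne_zero : qq ≠ 0 := pow_ne_zero _ RatFunc.X_ne_zero

lemma qq_zpow_ne_one {n : ℤ} (hn : n ≠ 0) : qq ^ n ≠ 1 := by
  rw [qq, ← zpow_natCast, ← zpow_mul]
  exact sqq_zpow_ne_one (by simpa using hn)

lemma sub_inv_ne_zero {a : Fq} (ha : a ≠ 0) (h : a ^ (2 : ℤ) ≠ 1) : a - a⁻¹ ≠ 0 := fun h' => h (by
  have : a = a⁻¹ := sub_eq_zero.1 h'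
  rw [zpow_two]; nth_rw 2 [this]; exact mul_inv_cancel₀ ha)

variable {N : ℕ} (d : Fin N → ℤ) (A : Fin N → Fin N → ℤ)

lemma qi_ne_zero (i : Fin N) : qi d i ≠ 0 := zpow_ne_zero _ qq_ne_zero

lemma qp_ne_zero (i j : Fin N) : qp d A i j ≠ 0 := zpow_ne_zero _ qq_ne_zero

lemma qp_eq (i j : Fin N) : qp d A i j = qi d i ^ A i j := zpow_mul _ _ _

variable {d}

lemma qi_zpow_ne_one {i : Fin N} (hd : 0 < d i) {n : ℤ} (hn : n ≠ 0) : qi d i ^ n ≠ 1 := by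
  rw [qi, ← zpow_mul]; exact qq_zpow_ne_one (mul_ne_zero hd.ne' hn)

lemma qi_sub_inv_ne_zero {i : Fin N} (hd : 0 < d i) : qi d i - (qi d i)⁻¹ ≠ 0 :=
  sub_inv_ne_zero (qi_ne_zero d i) (qi_zpow_ne_one hd two_ne_zero)

lemma qint_ne_zero {i : Fin N} (hd : 0 < d i) {n : ℤ} (hn : n ≠ 0) : qint d i n ≠ 0 := by
  refine div_ne_zero ?_ (qi_sub_inv_ne_zero hd)
  rw [zpow_neg]
  refine sub_inv_ne_zero (zpow_ne_zero _ (qi_ne_zero d i)) ?_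
  rw [← zpow_mul]
  exact qi_zpow_ne_one hd (mul_ne_zero hn two_ne_zero)

lemma qfact_ne_zero {i : Fin N} (hd : 0 < d i) (n : ℕ) : qfact d i n ≠ 0 := by
  induction n with
  | zero => exact one_ne_zero
  | succ n ih => exact mul_ne_zero (qint_ne_zero hd (by omega)) ih

lemma qbinom_succ {i : Fin N} (hd : 0 < d i) {n r : ℕ} (hr : r ≤ n) :
    qbinom d i (n + 1) (r + 1) * qint d i (r + 1) =
      qbinom d i (n + 1) r * qint d i (n + 1 - r) := by
  obtain ⟨k, rfl⟩ := Nat.exists_eq_add_of_le hr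
  have h1 := qfact_ne_zero hd r
  have h2 := qfact_ne_zero hd k
  have h3 : qint d i ((r : ℤ) + 1) ≠ 0 := qint_ne_zero hd (by omega)
  have h4 : qint d i ((k : ℤ) + 1) ≠ 0 := qint_ne_zero hd (by omega)
  rw [qbinom, qbinom, show r + k + 1 - (r + 1) = k by omega, show r + k + 1 - r = k + 1 by omega,
    show ((r + k : ℕ) : ℤ) + 1 - r = k + 1 by push_cast; ring]
  simp only [qfact]
  field_simp

variable {A}

lemma serreCoeff_qbinom {i j : Fin N} (hd : 0 < d i) (hdiag : A i i = 2) (hoff : A i j ≤ 0) :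
    SerreCoeff (qp d A i i)⁻¹ (qp d A i j)⁻¹ (-A i j).toNat
      (fun r => (-1 : Fq) ^ r * qbinom d i ((-A i j).toNat + 1) r) := by
  obtain ⟨n, hn⟩ := Int.eq_ofNat_of_zero_le (show 0 ≤ -A i j by omega)
  have hA : A i j = -(n : ℤ) := by omega
  rw [hA, neg_neg, Int.toNat_natCast, qp_eq, qp_eq, hdiag, hA, zpow_neg, inv_inv, zpow_natCast]
  have hQ := qi_ne_zero d i
  have hL := qi_sub_inv_ne_zero hd
  have hb := fun r (hr : r ≤ n) => qbinom_succ (n := n) hd hr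
  have hq : ∀ m : ℕ, (qi d i ^ (2 : ℤ))⁻¹ ^ m = ((qi d i) ^ m)⁻¹ ^ 2 := fun m => by
    rw [inv_pow, inv_pow, ← pow_mul, mul_comm, pow_mul]; norm_cast
  refine ⟨?_, ?_, inv_ne_zero (zpow_ne_zero _ hQ), pow_ne_zero _ hQ, ?_⟩
  · rw [hq, ← mul_pow, mul_inv_cancel₀ (pow_ne_zero _ hQ), one_pow]
  · intro r _ h
    rw [inv_pow, inv_eq_one, ← zpow_natCast, ← zpow_mul] at h
    exact qi_zpow_ne_one hd (by push_cast; omega) h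
  · intro r hr
    have h := hb r hr
    obtain ⟨k, rfl⟩ := Nat.exists_eq_add_of_le hr
    rw [qint, qint, show ((r + k : ℕ) : ℤ) + 1 - r = ((k + 1 : ℕ) : ℤ) by push_cast; ring,
      show (r : ℤ) + 1 = ((r + 1 : ℕ) : ℤ) by push_cast; ring,
      zpow_neg, zpow_neg, zpow_natCast, zpow_natCast, ← mul_div_assoc, ← mul_div_assoc,
      div_left_inj' hL] at h
    simp only [hq]
    generalize qbinom d i (r + k + 1) (r + 1) = B1 at *
    generalize qbinom d i (r + k + 1) r = B0 at *
    generalize qi d i = Q at *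
    have e1 : B1 * ((Q ^ (r + 1))⁻¹ ^ 2 - 1) =
        - ((Q ^ (r + 1))⁻¹ * (B1 * (Q ^ (r + 1) - (Q ^ (r + 1))⁻¹))) := by
      field_simp
      ring
    rw [pow_succ (-1 : Fq) r]
    rw [show (-1 : Fq) ^ r * -1 * B1 * ((Q ^ (r + 1))⁻¹ ^ 2 - 1) =
      -(-1 : Fq) ^ r * (B1 * ((Q ^ (r + 1))⁻¹ ^ 2 - 1)) by ring, e1, h]
    simp only [pow_add, pow_one]
    field_simp
    ring

end Scalars

section Exchange

attribute [local instance] natAlgebraFq intAlgebraFq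

lemma gcoef_recursion {b : Fq} (hb : b ≠ 0) (n : ℕ) :
    ((n + 1 : ℕ) : Fq) * gcoef b (n + 1) =
      ∑ l ∈ Finset.range (n + 1), (b⁻¹ ^ (l + 1) - b ^ (l + 1)) * gcoef b (n - l) := by
  have hbu : b * b⁻¹ = 1 := mul_inv_cancel₀ hb
  have hg : ∀ r : ℕ, gcoef b (r + 1) = b⁻¹ ^ (r + 1) * (b⁻¹ - b) := fun r => by
    simp only [gcoef]
    rw [show -(r : ℤ) - 2 = -((r + 2 : ℕ) : ℤ) by push_cast; ring, zpow_neg, zpow_neg,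
      zpow_natCast, zpow_natCast, ← inv_pow, ← inv_pow]
    linear_combination (b⁻¹ ^ r) * hbu
  have h0 : gcoef b 0 = b⁻¹ := rfl
  rw [Finset.sum_range_succ, Nat.sub_self, h0, hg]
  generalize hu : b⁻¹ = u at *
  have e1 : ∑ l ∈ Finset.range n, (u ^ (l + 1) - b ^ (l + 1)) * gcoef b (n - l) =
      ∑ l ∈ Finset.range n, (u ^ (n + 1) * (u - b) -
        (b * u) * (b ^ l * u ^ (n - 1 - l)) * (u - b)) := by
    refine Finset.sum_congr rfl fun l hl => ?_
    rw [Finset.mem_range] at hl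
    obtain ⟨k, rfl⟩ := Nat.exists_eq_add_of_lt hl
    rw [show l + k + 1 - l = k + 1 by omega, show l + k + 1 - 1 - l = k by omega, hg]
    ring
  have e2 := geom_sum₂_mul b u n
  rw [e1, Finset.sum_sub_distrib, Finset.sum_const, Finset.card_range, ← Finset.sum_mul,
    ← Finset.mul_sum, hbu, nsmul_eq_mul]
  push_cast
  linear_combination (-1 : Fq) * e2 - (u ^ n - b ^ n) * hbu

variable {R : Type*} [Ring R] [Algebra Fq R]

lemma sum_range_triangle_comm {M : Type*} [AddCommMonoid M] (p : ℕ) (f : ℕ → ℕ → M) :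
    ∑ l ∈ Finset.range (p + 1), ∑ r ∈ Finset.range (p - l + 1), f l r =
      ∑ r ∈ Finset.range (p + 1), ∑ l ∈ Finset.range (p - r + 1), f l r :=
  Finset.sum_comm' fun l r => by simp only [Finset.mem_range]; omega

/-- The recursion satisfied by the coefficients of `exp (a ∑ H_l z^l)`. -/
def ExpRec (a : Fq) (H P : ℕ → R) : Prop :=
  P 0 = 1 ∧ ∀ p : ℕ, ((p + 1 : ℕ) : Fq) • P (p + 1) =
    ∑ l ∈ Finset.range (p + 1), (((l + 1 : ℕ) : Fq) * a) • (H (l + 1) * P (p - l))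

lemma ExpRec.exchange_aux {a b : Fq} (hb : b ≠ 0) {H P : ℕ → R} (hP : ExpRec a H P) {x : ℤ → R}
    (hH : ∀ (m : ℤ) (l : ℕ), (((l + 1 : ℕ) : Fq) * a) • (x m * H (l + 1) - H (l + 1) * x m) =
      (b⁻¹ ^ (l + 1) - b ^ (l + 1)) • x (m + (l + 1 : ℕ))) (p : ℕ) :
    ∀ m : ℤ, x m * P p = ∑ r ∈ Finset.range (p + 1), (b * gcoef b r) • (P (p - r) * x (m + r)) := by
  induction p using Nat.strong_induction_on with
  | _ p ih =>
  intro m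
  rcases p with - | p
  · simp [hP.1, gcoef, hb]
  have hp : ((p + 1 : ℕ) : Fq) ≠ 0 := Nat.cast_ne_zero.2 (Nat.succ_ne_zero p)
  refine smul_right_injective R hp ?_
  beta_reduce
  have e1 : ((p + 1 : ℕ) : Fq) • (x m * P (p + 1)) = ∑ l ∈ Finset.range (p + 1),
      ((((l + 1 : ℕ) : Fq) * a) • (H (l + 1) * (x m * P (p - l))) +
        (b⁻¹ ^ (l + 1) - b ^ (l + 1)) • (x (m + (l + 1 : ℕ)) * P (p - l))) := by
    rw [← mul_smul_comm, hP.2, Finset.mul_sum]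
    refine Finset.sum_congr rfl fun l _ => ?_
    rw [← smul_mul_assoc (b⁻¹ ^ (l + 1) - b ^ (l + 1)), ← hH, mul_smul_comm, smul_mul_assoc,
      ← smul_add]
    congr 1
    noncomm_ring
  have e2 : ∑ l ∈ Finset.range (p + 1), (((l + 1 : ℕ) : Fq) * a) • (H (l + 1) * (x m * P (p - l))) =
      ∑ r ∈ Finset.range (p + 1), (((p - r + 1 : ℕ) : Fq) * (b * gcoef b r)) •
        (P (p + 1 - r) * x (m + r)) := by
    calc _ = ∑ l ∈ Finset.range (p + 1), ∑ r ∈ Finset.range (p - l + 1),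
          (((l + 1 : ℕ) : Fq) * a * (b * gcoef b r)) • (H (l + 1) * P (p - l - r) * x (m + r)) := by
          refine Finset.sum_congr rfl fun l _ => ?_
          rw [ih (p - l) (by omega) m, Finset.mul_sum, Finset.smul_sum]
          refine Finset.sum_congr rfl fun r _ => ?_
          rw [mul_smul_comm, smul_smul, mul_assoc (H _)]
      _ = _ := by
          rw [sum_range_triangle_comm]
          refine Finset.sum_congr rfl fun r hr => ?_
          rw [Finset.mem_range] at hr
          have := hP.2 (p - r)
          rw [show p + 1 - r = p - r + 1 by omega, mul_comm _ (b * _), mul_smul, ← smul_mul_assoc,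
            this, Finset.sum_mul, Finset.smul_sum]
          refine Finset.sum_congr rfl fun l _ => ?_
          rw [smul_mul_assoc, smul_smul, mul_comm (b * _), show p - l - r = p - r - l by omega]
  have e3 : ∑ l ∈ Finset.range (p + 1),
      (b⁻¹ ^ (l + 1) - b ^ (l + 1)) • (x (m + (l + 1 : ℕ)) * P (p - l)) =
      ∑ r ∈ Finset.range (p + 1), (((r + 1 : ℕ) : Fq) * (b * gcoef b (r + 1))) •
        (P (p - r) * x (m + (r + 1 : ℕ))) := by
    calc _ = ∑ l ∈ Finset.range (p + 1), ∑ r ∈ Finset.range (p + 1 - l),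
          ((b⁻¹ ^ (l + 1) - b ^ (l + 1)) * (b * gcoef b r)) •
            (P (p - (l + r)) * x (m + (l + r + 1 : ℕ))) := by
          refine Finset.sum_congr rfl fun l hl => ?_
          rw [Finset.mem_range] at hl
          rw [ih (p - l) (by omega), Finset.smul_sum, show p + 1 - l = p - l + 1 by omega]
          refine Finset.sum_congr rfl fun r _ => ?_
          rw [smul_smul, Nat.sub_sub]
          congr 3
          push_cast; ring
      _ = _ := by
          rw [← Finset.sum_range_diag_flip (p + 1) fun l r =>
            ((b⁻¹ ^ (l + 1) - b ^ (l + 1)) * (b * gcoef b r)) •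
              (P (p - (l + r)) * x (m + (l + r + 1 : ℕ)))]
          refine Finset.sum_congr rfl fun r _ => ?_
          have h := gcoef_recursion hb r
          rw [show ((r + 1 : ℕ) : Fq) * (b * gcoef b (r + 1)) =
            b * (((r + 1 : ℕ) : Fq) * gcoef b (r + 1)) by ring, h, Finset.mul_sum, Finset.sum_smul]
          refine Finset.sum_congr rfl fun l hl => ?_
          rw [Finset.mem_range] at hl
          rw [show l + (r - l) = r by omega]
          congr 1
          ring
  have e4 : ∑ r ∈ Finset.range (p + 1), (((p - r + 1 : ℕ) : Fq) * (b * gcoef b r)) •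
        (P (p + 1 - r) * x (m + r)) = ∑ r ∈ Finset.range (p + 1 + 1),
        ((((p + 1 : ℕ) : Fq) - (r : Fq)) * (b * gcoef b r)) • (P (p + 1 - r) * x (m + r)) := by
    rw [Finset.sum_range_succ _ (p + 1), sub_self, zero_mul, zero_smul, add_zero]
    refine Finset.sum_congr rfl fun r hr => ?_
    rw [Finset.mem_range] at hr
    rw [show p - r + 1 = p + 1 - r by omega, Nat.cast_sub (by omega)]
  have e5 : ∑ r ∈ Finset.range (p + 1), (((r + 1 : ℕ) : Fq) * (b * gcoef b (r + 1))) •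
        (P (p - r) * x (m + (r + 1 : ℕ))) = ∑ r ∈ Finset.range (p + 1 + 1),
        ((r : Fq) * (b * gcoef b r)) • (P (p + 1 - r) * x (m + r)) := by
    rw [Finset.sum_range_succ' _ (p + 1), Nat.cast_zero, zero_mul, zero_smul, add_zero]
    refine Finset.sum_congr rfl fun r _ => ?_
    rw [Nat.add_sub_add_right]
  rw [e1, Finset.sum_add_distrib, e2, e3, e4, e5, Finset.smul_sum, ← Finset.sum_add_distrib]
  refine Finset.sum_congr rfl fun r _ => ?_
  rw [← add_smul, smul_smul]
  congr 1
  ring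

/-- The exchange relation of `κ * exp (a ∑ H_l z^l)` with modes on which `κ` and `H_l` act by
conjugation and by shifts. -/
lemma ExpRec.exchange {a b : Fq} (hb : b ≠ 0) {H P : ℕ → R} (hP : ExpRec a H P) {x : ℤ → R}
    (hH : ∀ (m : ℤ) (l : ℕ), (((l + 1 : ℕ) : Fq) * a) • (x m * H (l + 1) - H (l + 1) * x m) =
      (b⁻¹ ^ (l + 1) - b ^ (l + 1)) • x (m + (l + 1 : ℕ))) {κ : R}
    (hκ : ∀ m, x m * κ = b⁻¹ • (κ * x m)) : Exchange b x fun p => κ * P p := fun m p => by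
  rw [← mul_assoc, hκ, smul_mul_assoc, mul_assoc, hP.exchange_aux hb hH, Finset.mul_sum,
    Finset.smul_sum]
  refine Finset.sum_congr rfl fun r _ => ?_
  rw [mul_smul_comm, smul_smul, inv_mul_cancel_left₀ hb, mul_assoc]

/-- A derivation-like element acts on `exp (a ∑ H_l z^l)` by multiplication. -/
lemma ExpRec.commutator {a : Fq} {H P : ℕ → R} (hP : ExpRec a H P) {y z : R} (t : ℕ)
    (hz : ∀ l, Commute z (H (l + 1)))
    (hy : ∀ l, y * H (l + 1) - H (l + 1) * y = if l = t then z else 0) (p : ℕ) :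
    y * P p - P p * y = if t < p then a • (z * P (p - (t + 1))) else 0 := by
  induction p using Nat.strong_induction_on with
  | _ p ih =>
  rcases p with - | p
  · simp [hP.1]
  have hp : ((p + 1 : ℕ) : Fq) ≠ 0 := Nat.cast_ne_zero.2 (Nat.succ_ne_zero p)
  refine smul_right_injective R hp ?_
  beta_reduce
  have e1 : ((p + 1 : ℕ) : Fq) • (y * P (p + 1) - P (p + 1) * y) =
      ∑ l ∈ Finset.range (p + 1), (((l + 1 : ℕ) : Fq) * a) •
        ((if l = t then z else 0) * P (p - l) +
          H (l + 1) * (if t < p - l then a • (z * P (p - l - (t + 1))) else 0)) := by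
    rw [smul_sub, ← mul_smul_comm, ← smul_mul_assoc, hP.2, Finset.mul_sum, Finset.sum_mul,
      ← Finset.sum_sub_distrib]
    refine Finset.sum_congr rfl fun l _ => ?_
    rw [← ih (p - l) (by omega), ← hy, mul_smul_comm, smul_mul_assoc, ← smul_sub]
    congr 1
    noncomm_ring
  rw [e1]
  simp only [smul_add, Finset.sum_add_distrib, ite_mul, zero_mul, smul_ite, smul_zero,
    Finset.sum_ite_eq', Finset.mem_range, mul_ite, mul_zero]
  by_cases ht : t < p + 1
  · rw [if_pos ht, if_pos ht, Nat.add_sub_add_right]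
    have e2 : ∑ l ∈ Finset.range (p + 1), (if t < p - l then
        (((l + 1 : ℕ) : Fq) * a) • (H (l + 1) * a • (z * P (p - l - (t + 1)))) else 0) =
        (((p - t : ℕ) : Fq) * a) • (z * P (p - t)) := by
      obtain ⟨u, rfl⟩ := Nat.exists_eq_add_of_le (Nat.lt_succ_iff.1 ht)
      rw [Nat.add_sub_cancel_left]
      rw [← Finset.sum_filter]
      have hset : (Finset.range (t + u + 1)).filter (fun l => t < t + u - l) = Finset.range u := by
        ext l; simp only [Finset.mem_filter, Finset.mem_range]; omega
      rw [hset]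
      rcases u with - | u
      · simp
      rw [mul_comm, mul_smul, ← mul_smul_comm, hP.2, Finset.mul_sum, Finset.smul_sum]
      refine Finset.sum_congr rfl fun l hl => ?_
      rw [mul_smul_comm, mul_smul_comm, smul_smul, smul_smul, mul_comm a, ← mul_assoc,
        ← (hz l).eq, mul_assoc, mul_assoc, show t + (u + 1) - l - (t + 1) = u - l by omega]
    rw [e2, ← add_smul, smul_smul, ← add_mul]
    congr 2
    rw [← Nat.cast_add]; congr 1; omega
  · rw [if_neg ht, if_neg ht, zero_add]
    refine Finset.sum_eq_zero fun l _ => if_neg (by omega)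

end Exchange

section HalfCurrents

attribute [local instance] natAlgebraFq intAlgebraFq

variable {N : ℕ} {R : Type*} [Ring R] [Algebra Fq R]

/-- `γ^{1/2}` acts invertibly and centrally in the image of `f`. -/
structure GammaCentral (f : FA N →ₐ[Fq] R) : Prop where
  mul_inv : f (e g2) * f (e g2inv) = 1
  inv_mul : f (e g2inv) * f (e g2) = 1
  comm : ∀ x : Gen N, Commute (f (e g2)) (f (e x))

namespace GammaCentral

variable {f : FA N →ₐ[Fq] R} (hf : GammaCentral f)
include hf

/-- `γ^{1/2}` as a unit. -/
def unit : Rˣ := ⟨f (e g2), f (e g2inv), hf.mul_inv, hf.inv_mul⟩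

lemma map_gammaHalf (m : ℤ) : f (gammaHalf m) = ((hf.unit ^ m : Rˣ) : R) := by
  rw [gammaHalf]
  split_ifs with h
  · obtain ⟨n, rfl⟩ := Int.eq_ofNat_of_zero_le h
    simp [unit]
  · obtain ⟨n, hn⟩ := Int.eq_ofNat_of_zero_le (show 0 ≤ -m by omega)
    obtain rfl : m = -(n : ℤ) := by omega
    rw [neg_neg, Int.toNat_natCast, map_pow, zpow_neg, zpow_natCast, ← inv_pow]
    rfl

lemma map_add (m n : ℤ) : f (gammaHalf (m + n)) = f (gammaHalf m) * f (gammaHalf n) := by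
  simp only [hf.map_gammaHalf, zpow_add, Units.val_mul]

omit hf in
lemma _root_.gammaHalf_zero : (gammaHalf 0 : FA N) = 1 := by simp [gammaHalf]

lemma commute_of_commute {z : R} (hz : Commute (f (e g2)) z) (m : ℤ) :
    Commute (f (gammaHalf m)) z := by
  rw [hf.map_gammaHalf]
  have : Commute ((hf.unit : Rˣ) : R) z := hz
  exact this.units_zpow_left m

lemma commute_map (w : FA N) : Commute (f (e g2)) (f w) := by
  induction w using FreeAlgebra.induction with
  | grade0 r => rw [AlgHom.commutes]; exact Algebra.commute_algebraMap_right _ _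
  | grade1 x => exact hf.comm x
  | mul a b ha hb => rw [map_mul]; exact ha.mul_right hb
  | add a b ha hb => rw [_root_.map_add]; exact ha.add_right hb

lemma commute_gamma (m : ℤ) (w : FA N) : Commute (f (gammaHalf m)) (f w) :=
  hf.commute_of_commute (hf.commute_map w) m

lemma expRec_twist {a : Fq} {H P : ℕ → R} (hP : ExpRec a H P)
    (hHc : ∀ p, Commute (f (e g2)) (H p)) (w : ℤ) :
    ExpRec a (fun l => f (gammaHalf (w * l)) * H l) (fun p => f (gammaHalf (w * p)) * P p) := by
  refine ⟨by simp [hP.1, gammaHalf_zero], fun p => ?_⟩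
  rw [← mul_smul_comm, hP.2, Finset.mul_sum]
  refine Finset.sum_congr rfl fun l hl => ?_
  rw [Finset.mem_range] at hl
  rw [mul_smul_comm, show w * ((p + 1 : ℕ) : ℤ) = w * ((l + 1 : ℕ) : ℤ) + w * ((p - l : ℕ) : ℤ) by
    rw [← mul_add]; congr 1; omega, hf.map_add]
  congr 1
  simp only [mul_assoc]
  rw [← mul_assoc (H _) _ (P _), ← (hf.commute_of_commute (hHc (l + 1)) (w * ((p - l : ℕ) : ℤ))).eq,
    mul_assoc]

end GammaCentral

variable (d : Fin N → ℤ)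

lemma expRec_Ppos (f : FA N →ₐ[Fq] R) (i : Fin N) :
    ExpRec (qi d i - (qi d i)⁻¹) (fun l => f (e (h i l))) (fun p => f (Ppos d i p)) := by
  refine ⟨by simp [Ppos], fun p => ?_⟩
  have hp : ((p + 1 : ℕ) : Fq) ≠ 0 := Nat.cast_ne_zero.2 (Nat.succ_ne_zero p)
  beta_reduce
  rw [Ppos, map_smul, map_sum, show ((p : Fq) + 1) = ((p + 1 : ℕ) : Fq) by push_cast; rfl,
    smul_inv_smul₀ hp]
  refine Finset.sum_congr rfl fun l _ => ?_
  rw [map_smul, map_mul]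
  push_cast
  rfl

lemma expRec_Pneg (f : FA N →ₐ[Fq] R) (i : Fin N) :
    ExpRec (-(qi d i - (qi d i)⁻¹)) (fun l => f (e (h i (-l)))) (fun p => f (Pneg d i p)) := by
  refine ⟨by simp [Pneg], fun p => ?_⟩
  have hp : ((p + 1 : ℕ) : Fq) ≠ 0 := Nat.cast_ne_zero.2 (Nat.succ_ne_zero p)
  beta_reduce
  rw [Pneg, map_smul, map_sum, show ((p : Fq) + 1) = ((p + 1 : ℕ) : Fq) by push_cast; rfl,
    smul_inv_smul₀ hp]
  refine Finset.sum_congr rfl fun l _ => ?_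
  rw [map_smul, map_mul]
  push_cast
  rfl

lemma psiEl_natCast (i : Fin N) (p : ℕ) : psiEl d i (p : ℤ) = e (K i) * Ppos d i p := by
  simp [psiEl]

lemma phiEl_neg_natCast (i : Fin N) (p : ℕ) :
    phiEl d i (-(p : ℤ)) = e (Kinv i) * Pneg d i p := by
  simp [phiEl]

/-- Exchange relations of the currents `ψ_i`, `φ_i`. -/
lemma biExchange_psi_phi {f : FA N →ₐ[Fq] R} (hf : GammaCentral f) {i : Fin N} {x : ℤ → R}
    {b : Fq} (hb : b ≠ 0) (w : ℤ) (hx : ∀ m, Commute (f (e g2)) (x m))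
    (hK : ∀ m, x m * f (e (K i)) = b⁻¹ • (f (e (K i)) * x m))
    (hKinv : ∀ m, x m * f (e (Kinv i)) = b • (f (e (Kinv i)) * x m))
    (hh : ∀ s m : ℤ, s ≠ 0 → ((s : Fq) * (qi d i - (qi d i)⁻¹)) •
      (x m * f (e (h i s)) - f (e (h i s)) * x m) =
        (b ^ (-s) - b ^ s) • (f (gammaHalf (-w * |s|)) * x (m + s))) :
    BiExchange b x (fun p => f (gammaHalf (w * p)) * f (psiEl d i p))
      (fun p => f (gammaHalf (w * p)) * f (phiEl d i (-(p : ℤ)))) := by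
  have hc := hf.commute_map
  have key : ∀ m s : ℤ, s ≠ 0 → ((s : Fq) * (qi d i - (qi d i)⁻¹)) •
      (x m * (f (gammaHalf (w * |s|)) * f (e (h i s))) -
        f (gammaHalf (w * |s|)) * f (e (h i s)) * x m) =
      (b ^ (-s) - b ^ s) • x (m + s) := fun m s hs => by
    rw [← mul_assoc (x m), ← (hf.commute_of_commute (hx m) (w * |s|)).eq, mul_assoc, mul_assoc,
      ← mul_sub, ← mul_smul_comm, hh s m hs, mul_smul_comm, ← mul_assoc, ← hf.map_add,
      ← add_mul, add_neg_cancel, zero_mul, gammaHalf_zero, map_one, one_mul]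
  constructor
  · have h1 := (hf.expRec_twist (expRec_Ppos d f i) (fun p => hc _) w).exchange hb
      (x := x) (κ := f (e (K i))) ?_ hK
    · refine Eq.mp ?_ h1
      congr 1
      funext p
      rw [psiEl_natCast, map_mul, ← mul_assoc, ← mul_assoc, (hf.commute_gamma _ _).eq]
    · intro m l
      have := key m ((l + 1 : ℕ) : ℤ) (by omega)
      rw [Nat.abs_cast, zpow_neg, zpow_natCast, ← inv_pow, Int.cast_natCast] at this
      exact this
  · have h1 := (hf.expRec_twist (expRec_Pneg d f i) (fun p => hc _) w).exchange
      (inv_ne_zero hb) (x := fun m => x (-m)) (κ := f (e (Kinv i))) ?_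
      (fun m => by rw [inv_inv]; exact hKinv _)
    · refine Eq.mp ?_ h1
      congr 1
      funext p
      rw [phiEl_neg_natCast, map_mul, ← mul_assoc, ← mul_assoc, (hf.commute_gamma _ _).eq]
    · intro m l
      have := key (-m) (-((l + 1 : ℕ) : ℤ)) (by omega)
      rw [abs_neg, Nat.abs_cast, neg_neg, zpow_neg, zpow_natCast, ← inv_pow, Int.cast_neg,
        Int.cast_natCast, neg_mul, ← mul_neg] at this
      rw [inv_inv, neg_add]
      exact this

/-- The commutators `[h_{j,s}, ψ_{i,p}]`. -/
lemma h_psi_commutator {f : FA N →ₐ[Fq] R} (hf : GammaCentral f) {i j : Fin N} {s : ℤ}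
    {c : Fq} (hi : qi d i - (qi d i)⁻¹ ≠ 0)
    (hK : Commute (f (e (h j s))) (f (e (K i))))
    (hh : ∀ l : ℤ, l ≠ 0 → f (e (h j s)) * f (e (h i l)) - f (e (h i l)) * f (e (h j s)) =
      if l = -s then (c * (qi d i - (qi d i)⁻¹)⁻¹) • (f (gammaPow s) - f (gammaPow (-s))) else 0)
    (p : ℤ) :
    f (e (h j s)) * f (psiEl d i p) - f (psiEl d i p) * f (e (h j s)) =
      if s < 0 then c • ((f (gammaPow s) - f (gammaPow (-s))) * f (psiEl d i (p + s))) else 0 := by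
  have hγ : ∀ w, Commute (f (gammaPow s) - f (gammaPow (-s))) (f w) := fun w =>
    (hf.commute_gamma _ w).sub_left (hf.commute_gamma _ w)
  rcases lt_or_ge p 0 with hp | hp
  · have h1 : psiEl d i p = 0 := if_neg (by omega)
    rw [h1]
    split_ifs with hs
    · have h2 : psiEl d i (p + s) = 0 := if_neg (by omega)
      simp [h2]
    · simp
  obtain ⟨p, rfl⟩ := Int.eq_ofNat_of_zero_le hp
  have key := (expRec_Ppos d f i).commutator (y := f (e (h j s)))
    (z := if s < 0 then (c * (qi d i - (qi d i)⁻¹)⁻¹) • (f (gammaPow s) - f (gammaPow (-s))) else 0)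
    (-s - 1).toNat ?_ ?_ p
  · rw [psiEl_natCast, map_mul, ← mul_assoc, hK.eq, mul_assoc, mul_assoc, ← mul_sub, key]
    split_ifs with h1 h2 h3
    · rw [show (p : ℤ) + s = ((p - ((-s - 1).toNat + 1) : ℕ) : ℤ) by omega, psiEl_natCast,
        smul_mul_assoc, smul_smul, mul_comm c, mul_inv_cancel_left₀ hi, mul_smul_comm, map_mul,
        ← mul_assoc, ← mul_assoc, (hγ _).eq]
    · simp
    · have h2 : psiEl d i (p + s) = 0 := if_neg (by omega)
      simp [h2]
    · simp
  · intro l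
    split_ifs
    · exact (hγ _).smul_left _
    · exact Commute.zero_left _
  · intro l
    rw [hh _ (by omega)]
    by_cases hs : s < 0
    · rw [if_pos hs]
      congr 1
      simp only [eq_iff_iff]
      omega
    · rw [if_neg hs, if_neg (by omega), ite_self]

/-- The commutators `[h_{j,s}, φ_{i,p}]`. -/
lemma h_phi_commutator {f : FA N →ₐ[Fq] R} (hf : GammaCentral f) {i j : Fin N} {s : ℤ}
    {c : Fq} (hi : qi d i - (qi d i)⁻¹ ≠ 0)
    (hK : Commute (f (e (h j s))) (f (e (Kinv i))))
    (hh : ∀ l : ℤ, l ≠ 0 → f (e (h j s)) * f (e (h i l)) - f (e (h i l)) * f (e (h j s)) =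
      if l = -s then (c * (qi d i - (qi d i)⁻¹)⁻¹) • (f (gammaPow s) - f (gammaPow (-s))) else 0)
    (p : ℤ) :
    f (e (h j s)) * f (phiEl d i p) - f (phiEl d i p) * f (e (h j s)) =
      if 0 < s then -(c • ((f (gammaPow s) - f (gammaPow (-s))) * f (phiEl d i (p + s))))
      else 0 := by
  have hγ : ∀ w, Commute (f (gammaPow s) - f (gammaPow (-s))) (f w) := fun w =>
    (hf.commute_gamma _ w).sub_left (hf.commute_gamma _ w)
  rcases lt_or_ge 0 p with hp | hp
  · have h1 : phiEl d i p = 0 := if_neg (by omega)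
    rw [h1]
    split_ifs with hs
    · have h2 : phiEl d i (p + s) = 0 := if_neg (by omega)
      simp [h2]
    · simp
  obtain ⟨p', hp'⟩ := Int.eq_ofNat_of_zero_le (show 0 ≤ -p by omega)
  obtain rfl : p = -(p' : ℤ) := by omega
  have key := (expRec_Pneg d f i).commutator (y := f (e (h j s)))
    (z := if 0 < s then (c * (qi d i - (qi d i)⁻¹)⁻¹) • (f (gammaPow s) - f (gammaPow (-s))) else 0)
    (s - 1).toNat ?_ ?_ p'
  · rw [phiEl_neg_natCast, map_mul, ← mul_assoc, hK.eq, mul_assoc, mul_assoc, ← mul_sub, key]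
    split_ifs with h1 h2 h3
    · rw [show -(p' : ℤ) + s = -((p' - ((s - 1).toNat + 1) : ℕ) : ℤ) by omega, phiEl_neg_natCast,
        smul_mul_assoc, smul_smul, mul_comm c, neg_mul, mul_inv_cancel_left₀ hi, mul_smul_comm,
        neg_smul, map_mul, ← mul_assoc, ← mul_assoc, (hγ _).eq]
    · simp
    · have h2 : phiEl d i (-(p' : ℤ) + s) = 0 := if_neg (by omega)
      simp [h2]
    · simp
  · intro l
    split_ifs
    · exact (hγ _).smul_left _
    · exact Commute.zero_left _
  · intro l
    rw [hh _ (by omega)]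
    by_cases hs : 0 < s
    · rw [if_pos hs]
      congr 1
      simp only [eq_iff_iff]
      omega
    · rw [if_neg hs, if_neg (by omega), ite_self]

end HalfCurrents

section BorelRelations

attribute [local instance] natAlgebraFq intAlgebraFq

variable {N : ℕ} (d : Fin N → ℤ) (A : Fin N → Fin N → ℤ)

/-- The relations of the quantum affine algebra which do not involve the `x^+_{i,r}`. -/
inductive BRel (N : ℕ) (d : Fin N → ℤ) (A : Fin N → Fin N → ℤ) : FA N → FA N → Prop
  | K_Kinv (i : Fin N) : BRel N d A (e (K i) * e (Kinv i)) 1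
  | Kinv_K (i : Fin N) : BRel N d A (e (Kinv i) * e (K i)) 1
  | D_Dinv : BRel N d A (e D * e Dinv) 1
  | Dinv_D : BRel N d A (e Dinv * e D) 1
  | g_ginv : BRel N d A (e g2 * e g2inv) 1
  | ginv_g : BRel N d A (e g2inv * e g2) 1
  | g2_comm (x : Gen N) : BRel N d A (e g2 * e x) (e x * e g2)
  | g2inv_comm (x : Gen N) : BRel N d A (e g2inv * e x) (e x * e g2inv)
  | K_comm_K (i j : Fin N) : BRel N d A (e (K i) * e (K j)) (e (K j) * e (K i))
  | K_comm_D (i : Fin N) : BRel N d A (e (K i) * e D) (e D * e (K i))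
  | K_comm_h (i j : Fin N) (s : ℤ) :
      BRel N d A (e (K i) * e (h j s)) (e (h j s) * e (K i))
  | h_zero (i : Fin N) : BRel N d A (e (h i 0)) 0
  | D_h (i : Fin N) (s : ℤ) :
      BRel N d A (e D * e (h i s) * e Dinv) ((qq ^ s) • e (h i s))
  | D_xm (i : Fin N) (r : ℤ) :
      BRel N d A (e D * e (xm i r) * e Dinv) ((qq ^ r) • e (xm i r))
  | K_xm (i j : Fin N) (r : ℤ) :
      BRel N d A (e (K i) * e (xm j r) * e (Kinv i)) ((qp d A i j)⁻¹ • e (xm j r))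
  | h_h (i j : Fin N) (k l : ℤ) (hk : k ≠ 0) (hl : l ≠ 0) :
      BRel N d A (e (h i k) * e (h j l) - e (h j l) * e (h i k))
        (if l = -k then
          ((k : Fq)⁻¹ * qint d i (k * A i j) * (qi d j - (qi d j)⁻¹)⁻¹) •
            (gammaPow k - gammaPow (-k))
         else 0)
  | h_xm (i j : Fin N) (k l : ℤ) (hk : k ≠ 0) :
      BRel N d A (e (h i k) * e (xm j l) - e (xm j l) * e (h i k))
        ((-((k : Fq)⁻¹ * qint d i (k * A i j))) • (gammaHalf |k| * e (xm j (k + l))))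
  | serre_m (i j : Fin N) (k l : ℤ) :
      BRel N d A
        (e (xm i (k+1)) * e (xm j l) - (qp d A i j)⁻¹ • (e (xm j l) * e (xm i (k+1))))
        ((qp d A i j)⁻¹ • (e (xm i k) * e (xm j (l+1))) - e (xm j (l+1)) * e (xm i k))
  | dserre (i j : Fin N) (hij : i ≠ j)
      (ks : Fin (1 - A i j).toNat → ℤ) (l : ℤ) :
      BRel N d A
        (∑ σ : Equiv.Perm (Fin (1 - A i j).toNat),
          ∑ r ∈ Finset.range ((1 - A i j).toNat + 1),
            ((-1 : Fq) ^ r * qbinom d i (1 - A i j).toNat r) •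
              dsTerm false i j (1 - A i j).toNat ks l σ r)
        0

variable {d A}

lemma BRel.toQRel {a b : FA N} (h : BRel N d A a b) : QRel N d A a b := by
  cases h with
  | K_Kinv i => exact .K_Kinv i
  | Kinv_K i => exact .Kinv_K i
  | D_Dinv => exact .D_Dinv
  | Dinv_D => exact .Dinv_D
  | g_ginv => exact .g_ginv
  | ginv_g => exact .ginv_g
  | g2_comm x => exact .g2_comm x
  | g2inv_comm x => exact .g2inv_comm x
  | K_comm_K i j => exact .K_comm_K i j
  | K_comm_D i => exact .K_comm_D i
  | K_comm_h i j s => exact .K_comm_h i j s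
  | h_zero i => exact .h_zero i
  | D_h i s => exact .D_h i s
  | D_xm i r => exact .D_xm i r
  | K_xm i j r => exact .K_xm i j r
  | h_h i j k l hk hl => exact .h_h i j k l hk hl
  | h_xm i j k l hk => exact .h_xm i j k l hk
  | serre_m i j k l => exact .serre_m i j k l
  | dserre i j hij ks l => exact .dserre false i j hij ks l

variable (d A) in
/-- Homomorphisms out of the free algebra compatible with the relations `BRel`. -/
def RespectsB {R : Type*} [Ring R] [Algebra Fq R] (f : FA N →ₐ[Fq] R) : Prop :=
  ∀ a b, BRel N d A a b → f a = f b

variable (d) in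
/-- The right-hand side of the relation for `[x^+_{i,k}, x^-_{i,l}]`. -/
def crossEl (i : Fin N) (k l : ℤ) : FA N :=
  ((qi d i - (qi d i)⁻¹)⁻¹) •
    (gammaHalf (k - l) * psiEl d i (k + l) - gammaHalf (l - k) * phiEl d i (k + l))

variable {R : Type*} [Ring R] [Algebra Fq R] {f : FA N →ₐ[Fq] R}

section Cross

variable (d) in
lemma map_crossEl_eq_currentMode (hf : GammaCentral f) (i : Fin N) (k l : ℤ) :
    f (crossEl d i k l) = currentMode
      (fun p => f ((qi d i - (qi d i)⁻¹)⁻¹ • gammaHalf (2 * k)) *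
        (f (gammaHalf (-1 * p)) * f (psiEl d i p)))
      (fun p => f ((qi d i - (qi d i)⁻¹)⁻¹ • gammaHalf (-2 * k)) *
        (f (gammaHalf (-1 * p)) * f (phiEl d i (-(p : ℤ))))) k l := by
  have h1 : extZ (fun p : ℕ => f ((qi d i - (qi d i)⁻¹)⁻¹ • gammaHalf (2 * k)) *
        (f (gammaHalf (-1 * p)) * f (psiEl d i p))) (l + k) =
      (qi d i - (qi d i)⁻¹)⁻¹ • (f (gammaHalf (k - l)) * f (psiEl d i (k + l))) := by
    rw [extZ]
    split_ifs with h
    · rw [Int.toNat_of_nonneg h, map_smul, smul_mul_assoc, ← mul_assoc, ← hf.map_add,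
        show 2 * k + -1 * (l + k) = k - l by ring, add_comm l k]
    · rw [psiEl, if_neg (by omega), map_zero, mul_zero, smul_zero]
  have h2 : extZ (fun p : ℕ => f ((qi d i - (qi d i)⁻¹)⁻¹ • gammaHalf (-2 * k)) *
        (f (gammaHalf (-1 * p)) * f (phiEl d i (-(p : ℤ))))) (-l - k) =
      (qi d i - (qi d i)⁻¹)⁻¹ • (f (gammaHalf (l - k)) * f (phiEl d i (k + l))) := by
    rw [extZ]
    split_ifs with h
    · rw [Int.toNat_of_nonneg h, map_smul, smul_mul_assoc, ← mul_assoc, ← hf.map_add,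
        show -2 * k + -1 * (-l - k) = l - k by ring, show -(-l - k) = k + l by ring]
    · rw [phiEl, if_neg (by omega), map_zero, mul_zero, smul_zero]
  rw [currentMode, h1, h2, crossEl, map_smul, map_sub, map_mul, map_mul, smul_sub]

variable (d) in
lemma map_crossEl_eq_currentMode' (hf : GammaCentral f) (i : Fin N) (k l : ℤ) :
    f (crossEl d i k l) = currentMode
      (fun p => f ((qi d i - (qi d i)⁻¹)⁻¹ • gammaHalf (-2 * l)) *
        (f (gammaHalf (1 * p)) * f (psiEl d i p)))
      (fun p => f ((qi d i - (qi d i)⁻¹)⁻¹ • gammaHalf (2 * l)) *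
        (f (gammaHalf (1 * p)) * f (phiEl d i (-(p : ℤ))))) l k := by
  have h1 : extZ (fun p : ℕ => f ((qi d i - (qi d i)⁻¹)⁻¹ • gammaHalf (-2 * l)) *
        (f (gammaHalf (1 * p)) * f (psiEl d i p))) (k + l) =
      (qi d i - (qi d i)⁻¹)⁻¹ • (f (gammaHalf (k - l)) * f (psiEl d i (k + l))) := by
    rw [extZ]
    split_ifs with h
    · rw [Int.toNat_of_nonneg h, map_smul, smul_mul_assoc, ← mul_assoc, ← hf.map_add,
        show -2 * l + 1 * (k + l) = k - l by ring]
    · rw [psiEl, if_neg (by omega), map_zero, mul_zero, smul_zero]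
  have h2 : extZ (fun p : ℕ => f ((qi d i - (qi d i)⁻¹)⁻¹ • gammaHalf (2 * l)) *
        (f (gammaHalf (1 * p)) * f (phiEl d i (-(p : ℤ))))) (-k - l) =
      (qi d i - (qi d i)⁻¹)⁻¹ • (f (gammaHalf (l - k)) * f (phiEl d i (k + l))) := by
    rw [extZ]
    split_ifs with h
    · rw [Int.toNat_of_nonneg h, map_smul, smul_mul_assoc, ← mul_assoc, ← hf.map_add,
        show 2 * l + 1 * (-k - l) = l - k by ring, show -(-k - l) = k + l by ring]
    · rw [phiEl, if_neg (by omega), map_zero, mul_zero, smul_zero]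
  rw [currentMode, h1, h2, crossEl, map_smul, map_sub, map_mul, map_mul, smul_sub]

lemma BiExchange.central_mul {b : Fq} {x : ℤ → R} {Ψ Φ : ℕ → R} (h : BiExchange b x Ψ Φ) (z w : R)
    (hz : ∀ m, Commute z (x m)) (hw : ∀ m, Commute w (x m)) :
    BiExchange b x (fun p => z * Ψ p) (fun p => w * Φ p) :=
  ⟨h.1.central_mul z hz, h.2.central_mul w fun m => hw (-m)⟩

end Cross

namespace RespectsB

variable (hf : RespectsB d A f)
include hf

lemma gammaCentral : GammaCentral f where
  mul_inv := by simpa using hf _ _ .g_ginv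
  inv_mul := by simpa using hf _ _ .ginv_g
  comm x := by simpa [Commute, SemiconjBy] using hf _ _ (.g2_comm x)

lemma K_mul_Kinv (i : Fin N) : f (e (K i)) * f (e (Kinv i)) = 1 := by
  simpa using hf _ _ (.K_Kinv i)

lemma Kinv_mul_K (i : Fin N) : f (e (Kinv i)) * f (e (K i)) = 1 := by
  simpa using hf _ _ (.Kinv_K i)

lemma D_mul_Dinv : f (e D) * f (e Dinv) = 1 := by simpa using hf _ _ .D_Dinv

lemma Dinv_mul_D : f (e Dinv) * f (e D) = 1 := by simpa using hf _ _ .Dinv_D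

lemma K_commute_h (i j : Fin N) (s : ℤ) : Commute (f (e (K i))) (f (e (h j s))) := by
  simpa [Commute, SemiconjBy] using hf _ _ (.K_comm_h i j s)

lemma Kinv_commute_of_commute {i : Fin N} {z : R} (hz : Commute (f (e (K i))) z) :
    Commute (f (e (Kinv i))) z := by
  have h1 := hf.K_mul_Kinv i
  have h2 := hf.Kinv_mul_K i
  calc f (e (Kinv i)) * z = f (e (Kinv i)) * (z * f (e (K i))) * f (e (Kinv i)) := by
        rw [mul_assoc, mul_assoc, h1, mul_one]
    _ = z * f (e (Kinv i)) := by rw [← hz.eq, ← mul_assoc, h2, one_mul]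

lemma xm_mul_K (i j : Fin N) (m : ℤ) :
    f (e (xm j m)) * f (e (K i)) = qp d A i j • (f (e (K i)) * f (e (xm j m))) := by
  have h : f (e (K i)) * f (e (xm j m)) * f (e (Kinv i)) = (qp d A i j)⁻¹ • f (e (xm j m)) := by
    simpa using hf _ _ (.K_xm i j m)
  calc _ = qp d A i j • ((qp d A i j)⁻¹ • f (e (xm j m))) * f (e (K i)) := by
        rw [smul_inv_smul₀ (qp_ne_zero d A i j)]
    _ = _ := by rw [← h, smul_mul_assoc, mul_assoc, hf.Kinv_mul_K, mul_one]

lemma xm_mul_Kinv (i j : Fin N) (m : ℤ) :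
    f (e (xm j m)) * f (e (Kinv i)) = (qp d A i j)⁻¹ • (f (e (Kinv i)) * f (e (xm j m))) := by
  have h : f (e (K i)) * f (e (xm j m)) * f (e (Kinv i)) = (qp d A i j)⁻¹ • f (e (xm j m)) := by
    simpa using hf _ _ (.K_xm i j m)
  rw [← mul_smul_comm, ← h, ← mul_assoc, ← mul_assoc, hf.Kinv_mul_K, one_mul]

lemma h_mul_xm {s : ℤ} (hs : s ≠ 0) (i j : Fin N) (m : ℤ) :
    f (e (h i s)) * f (e (xm j m)) - f (e (xm j m)) * f (e (h i s)) =
      (-((s : Fq)⁻¹ * qint d i (s * A i j))) • (f (gammaHalf |s|) * f (e (xm j (s + m)))) := by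
  simpa only [map_sub, map_mul, map_smul] using hf _ _ (.h_xm i j s m hs)

omit hf f in
lemma _root_.int_mul_qint {i : Fin N} (hi : qi d i - (qi d i)⁻¹ ≠ 0) {s : ℤ} (hs : s ≠ 0)
    (j : Fin N) : (s : Fq) * (qi d i - (qi d i)⁻¹) * ((s : Fq)⁻¹ * qint d i (s * A i j)) =
      qp d A i j ^ s - qp d A i j ^ (-s) := by
  have : (s : Fq) ≠ 0 := Int.cast_ne_zero.2 hs
  rw [qint, qp_eq, ← zpow_mul, ← zpow_mul, mul_comm (s : Fq), mul_assoc, mul_inv_cancel_left₀ this,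
    mul_div_cancel₀ _ hi, mul_comm s, mul_neg]

lemma biExchange_xm (hd : ∀ i, 0 < d i) (i j : Fin N) :
    BiExchange (qp d A i j)⁻¹ (fun m => f (e (xm j m)))
      (fun p => f (gammaHalf (-1 * p)) * f (psiEl d i p))
      (fun p => f (gammaHalf (-1 * p)) * f (phiEl d i (-(p : ℤ)))) := by
  have hi := qi_sub_inv_ne_zero (hd i)
  refine biExchange_psi_phi d hf.gammaCentral (inv_ne_zero (qp_ne_zero d A i j)) (-1)
    (fun m => hf.gammaCentral.comm _) ?_ ?_ ?_
  · intro m; rw [inv_inv]; exact hf.xm_mul_K i j m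
  · intro m; exact hf.xm_mul_Kinv i j m
  · intro s m hs
    have hx := hf.h_mul_xm hs i j m
    rw [← neg_sub (f (e (h i s)) * _), hx, smul_neg, ← neg_smul, smul_smul, neg_mul_neg,
      int_mul_qint hi hs, neg_neg, one_mul, inv_zpow', inv_zpow', neg_neg, add_comm s m]

lemma quadRel_xm (i j : Fin N) :
    QuadRel (qp d A i j)⁻¹ (fun m => f (e (xm i m))) (fun m => f (e (xm j m))) := fun k l => by
  have h := hf _ _ (.serre_m i j k l)
  simp only [map_sub, map_mul, map_smul] at h
  rw [smul_add, ← sub_eq_zero]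
  rw [← sub_eq_zero] at h
  rw [← h]
  abel

/-- The modes `[x^+_{i,k}, x^-_{i,l}]`, as a function of `l`, are exchanged with the `x^-_{j,m}`. -/
lemma exists_biExchange_cross (hd : ∀ i, 0 < d i) (i : Fin N) (k : ℤ) :
    ∃ Ψ Φ : ℕ → R, (∀ l, f (crossEl d i k l) = currentMode Ψ Φ k l) ∧
      ∀ j, BiExchange (qp d A i j)⁻¹ (fun m => f (e (xm j m))) Ψ Φ :=
  ⟨_, _, map_crossEl_eq_currentMode d hf.gammaCentral i k, fun j =>
    (hf.biExchange_xm hd i j).central_mul _ _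
      (fun m => by rw [map_smul]; exact (hf.gammaCentral.commute_gamma _ _).smul_left _)
      (fun m => by rw [map_smul]; exact (hf.gammaCentral.commute_gamma _ _).smul_left _)⟩

end RespectsB

end BorelRelations

section CrossBrackets

attribute [local instance] natAlgebraFq intAlgebraFq

variable {N : ℕ} {d : Fin N → ℤ} {A : Fin N → Fin N → ℤ}
  {R : Type*} [Ring R] [Algebra Fq R] {f : FA N →ₐ[Fq] R}

namespace RespectsB

variable (hf : RespectsB d A f)
include hf

lemma K_commute_K (i j : Fin N) : Commute (f (e (K i))) (f (e (K j))) := by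
  simpa [Commute, SemiconjBy] using hf _ _ (.K_comm_K i j)

lemma K_commute_D (i : Fin N) : Commute (f (e (K i))) (f (e D)) := by
  simpa [Commute, SemiconjBy] using hf _ _ (.K_comm_D i)

lemma K_commute_Ppos (i j : Fin N) (p : ℕ) : Commute (f (e (K i))) (f (Ppos d j p)) := by
  induction p using Nat.strong_induction_on with
  | _ p ih =>
  rcases p with - | p
  · simp [Ppos]
  rw [Ppos, map_smul, map_sum]
  refine (Commute.sum_right _ _ _ fun l _ => ?_).smul_right _
  rw [map_smul, map_mul]
  exact ((hf.K_commute_h i j _).mul_right (ih _ (by omega))).smul_right _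

lemma K_commute_Pneg (i j : Fin N) (p : ℕ) : Commute (f (e (K i))) (f (Pneg d j p)) := by
  induction p using Nat.strong_induction_on with
  | _ p ih =>
  rcases p with - | p
  · simp [Pneg]
  rw [Pneg, map_smul, map_sum]
  refine (Commute.sum_right _ _ _ fun l _ => ?_).smul_right _
  rw [map_smul, map_mul]
  exact ((hf.K_commute_h i j _).mul_right (ih _ (by omega))).smul_right _

lemma K_commute_psiEl (i j : Fin N) (p : ℤ) : Commute (f (e (K i))) (f (psiEl d j p)) := by
  rw [psiEl]
  split_ifs
  · rw [map_mul]
    exact (hf.K_commute_K i j).mul_right (hf.K_commute_Ppos i j _)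
  · simp

lemma K_commute_phiEl (i j : Fin N) (p : ℤ) : Commute (f (e (K i))) (f (phiEl d j p)) := by
  rw [phiEl]
  split_ifs
  · rw [map_mul]
    exact (hf.Kinv_commute_of_commute (hf.K_commute_K j i)).symm.mul_right (hf.K_commute_Pneg i j _)
  · simp

lemma K_commute_cross (i j : Fin N) (k l : ℤ) :
    Commute (f (e (K i))) (f (crossEl d j k l)) := by
  have hg : ∀ m w, Commute (f w) (f (gammaHalf m)) := fun m w =>
    (hf.gammaCentral.commute_gamma m w).symm
  rw [crossEl, map_smul, map_sub, map_mul, map_mul]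
  exact (((hg _ _).mul_right (hf.K_commute_psiEl i j _)).sub_right
    ((hg _ _).mul_right (hf.K_commute_phiEl i j _))).smul_right _

lemma D_mul_of_conj {z : R} {c : Fq} (h : f (e D) * z * f (e Dinv) = c • z) :
    f (e D) * z = c • (z * f (e D)) := by
  rw [← smul_mul_assoc, ← h, mul_assoc, hf.Dinv_mul_D, mul_one]

lemma D_mul_h (i : Fin N) (s : ℤ) :
    f (e D) * f (e (h i s)) = (qq ^ s) • (f (e (h i s)) * f (e D)) :=
  hf.D_mul_of_conj (by simpa using hf _ _ (.D_h i s))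

lemma D_mul_Ppos (i : Fin N) (p : ℕ) :
    f (e D) * f (Ppos d i p) = (qq ^ (p : ℤ)) • (f (Ppos d i p) * f (e D)) := by
  induction p using Nat.strong_induction_on with
  | _ p ih =>
  rcases p with - | p
  · simp [Ppos]
  rw [Ppos, map_smul, map_sum, mul_smul_comm, smul_mul_assoc, smul_comm]
  simp only [Finset.mul_sum, Finset.sum_mul, Finset.smul_sum]
  refine Finset.sum_congr rfl fun l hl => congrArg _ ?_
  rw [Finset.mem_range] at hl
  rw [map_smul, map_mul, mul_smul_comm, smul_mul_assoc, smul_comm, ← mul_assoc, hf.D_mul_h,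
    smul_mul_assoc, mul_assoc, ih _ (by omega), mul_smul_comm, smul_smul, smul_smul, smul_smul,
    mul_assoc, ← zpow_add₀ qq_ne_zero, ← mul_assoc (f _)]
  congr 3
  omega

lemma D_mul_Pneg (i : Fin N) (p : ℕ) :
    f (e D) * f (Pneg d i p) = (qq ^ (-(p : ℤ))) • (f (Pneg d i p) * f (e D)) := by
  induction p using Nat.strong_induction_on with
  | _ p ih =>
  rcases p with - | p
  · simp [Pneg]
  rw [Pneg, map_smul, map_sum, mul_smul_comm, smul_mul_assoc, smul_comm]
  simp only [Finset.mul_sum, Finset.sum_mul, Finset.smul_sum]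
  refine Finset.sum_congr rfl fun l hl => congrArg _ ?_
  rw [Finset.mem_range] at hl
  rw [map_smul, map_mul, mul_smul_comm, smul_mul_assoc, smul_comm, ← mul_assoc, hf.D_mul_h,
    smul_mul_assoc, mul_assoc, ih _ (by omega), mul_smul_comm, smul_smul, smul_smul, smul_smul,
    mul_assoc, ← zpow_add₀ qq_ne_zero, ← mul_assoc (f _)]
  congr 3
  omega

lemma D_mul_psiEl (i : Fin N) (p : ℤ) :
    f (e D) * f (psiEl d i p) = (qq ^ p) • (f (psiEl d i p) * f (e D)) := by
  rw [psiEl]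
  split_ifs with h
  · obtain ⟨p, rfl⟩ := Int.eq_ofNat_of_zero_le h
    rw [Int.toNat_natCast, map_mul, ← mul_assoc, ← (hf.K_commute_D i).eq, mul_assoc,
      hf.D_mul_Ppos, mul_smul_comm, mul_assoc]
  · simp

lemma D_mul_phiEl (i : Fin N) (p : ℤ) :
    f (e D) * f (phiEl d i p) = (qq ^ p) • (f (phiEl d i p) * f (e D)) := by
  rw [phiEl]
  split_ifs with h
  · obtain ⟨p', hp'⟩ := Int.eq_ofNat_of_zero_le (show 0 ≤ -p by omega)
    obtain rfl : p = -(p' : ℤ) := by omega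
    rw [neg_neg, Int.toNat_natCast, map_mul, ← mul_assoc,
      ← (hf.Kinv_commute_of_commute (hf.K_commute_D i)).eq, mul_assoc,
      hf.D_mul_Pneg, mul_smul_comm, mul_assoc]
  · simp

lemma D_mul_cross (i : Fin N) (k l : ℤ) :
    f (e D) * f (crossEl d i k l) = (qq ^ (k + l)) • (f (crossEl d i k l) * f (e D)) := by
  have hg : ∀ m, f (e D) * f (gammaHalf m) = f (gammaHalf m) * f (e D) := fun m =>
    (hf.gammaCentral.commute_gamma m _).eq.symm
  rw [crossEl, map_smul, map_sub, map_mul, map_mul, mul_smul_comm, mul_sub, ← mul_assoc,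
    ← mul_assoc, hg, hg, mul_assoc, mul_assoc, hf.D_mul_psiEl, hf.D_mul_phiEl, smul_mul_assoc,
    sub_mul, smul_comm]
  simp only [mul_smul_comm, smul_sub, mul_assoc]

lemma h_mul_h (i j : Fin N) {k l : ℤ} (hk : k ≠ 0) (hl : l ≠ 0) :
    f (e (h i k)) * f (e (h j l)) - f (e (h j l)) * f (e (h i k)) =
      if l = -k then ((k : Fq)⁻¹ * qint d i (k * A i j) * (qi d j - (qi d j)⁻¹)⁻¹) •
        (f (gammaPow k) - f (gammaPow (-k))) else 0 := by
  have h1 := hf _ _ (.h_h i j k l hk hl)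
  rw [map_sub, map_mul, map_mul] at h1
  rw [h1]
  split_ifs
  · rw [map_smul, map_sub]
  · rw [map_zero]

lemma h_mul_cross (hd : ∀ i, 0 < d i) (i j : Fin N) {s : ℤ} (hs : s ≠ 0) (k l : ℤ) :
    f (e (h j s)) * f (crossEl d i k l) - f (crossEl d i k l) * f (e (h j s)) =
      ((s : Fq)⁻¹ * qint d j (s * A j i)) • (f (gammaHalf (-|s|)) * f (crossEl d i (k + s) l) -
        f (gammaHalf |s|) * f (crossEl d i k (l + s))) := by
  have hi := qi_sub_inv_ne_zero (hd i)
  have hψ := h_psi_commutator d hf.gammaCentral hi (hf.K_commute_h i j s).symm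
    (fun l hl => hf.h_mul_h j i hs hl) (k + l)
  have hφ := h_phi_commutator d hf.gammaCentral hi
    (hf.Kinv_commute_of_commute (hf.K_commute_h i j s)).symm
    (fun l hl => hf.h_mul_h j i hs hl) (k + l)
  have hg : ∀ m, f (e (h j s)) * f (gammaHalf m) = f (gammaHalf m) * f (e (h j s)) := fun m =>
    (hf.gammaCentral.commute_gamma m _).eq.symm
  set c := (s : Fq)⁻¹ * qint d j (s * A j i)
  have e1 : f (e (h j s)) * f (crossEl d i k l) - f (crossEl d i k l) * f (e (h j s)) =
      (qi d i - (qi d i)⁻¹)⁻¹ • (f (gammaHalf (k - l)) *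
        (f (e (h j s)) * f (psiEl d i (k + l)) - f (psiEl d i (k + l)) * f (e (h j s))) -
        f (gammaHalf (l - k)) *
        (f (e (h j s)) * f (phiEl d i (k + l)) - f (phiEl d i (k + l)) * f (e (h j s)))) := by
    rw [crossEl, map_smul, map_sub, map_mul, map_mul, mul_smul_comm, smul_mul_assoc, ← smul_sub,
      mul_sub, sub_mul, ← mul_assoc (f (e (h j s))), ← mul_assoc (f (e (h j s))), hg, hg]
    simp only [mul_sub, mul_assoc]
    congr 1
    abel
  rw [e1, hψ, hφ]
  simp only [crossEl, map_smul, map_sub, map_mul, mul_smul_comm, mul_sub, gammaPow]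
  rw [show k + s + l = k + l + s by ring, show k + (l + s) = k + l + s by ring]
  rcases lt_trichotomy s 0 with h | h | h
  · rw [if_pos h, if_neg (by omega), abs_of_neg h]
    simp only [mul_smul_comm, ← mul_assoc, ← hf.gammaCentral.map_add, sub_mul, mul_sub, mul_zero,
      sub_zero]
    rw [show - -s + (k + s - l) = k - l + 2 * s by ring, show - -s + (l - (k + s)) = l - k by ring,
      show -s + (k - (l + s)) = k - l + 2 * -s by ring, show -s + (l + s - k) = l - k by ring,
      ← smul_sub, sub_sub_sub_cancel_right, smul_comm]
  · exact absurd h hs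
  · rw [if_neg (by omega), if_pos h, abs_of_pos h]
    simp only [mul_neg (f _), mul_smul_comm, ← mul_assoc, ← hf.gammaCentral.map_add, sub_mul,
      mul_sub,
      mul_zero, zero_sub, neg_neg]
    rw [show -s + (k + s - l) = k - l by ring, show -s + (l - (k + s)) = l - k + 2 * -s by ring,
      show s + (k - (l + s)) = k - l by ring, show s + (l + s - k) = l - k + 2 * s by ring,
      ← smul_sub, sub_sub_sub_cancel_left, smul_comm]

end RespectsB

end CrossBrackets

section SerreFamilies

attribute [local instance] natAlgebraFq intAlgebraFq

variable {N : ℕ} {d : Fin N → ℤ} {A : Fin N → Fin N → ℤ} {S : Type*} [Ring S] [Algebra Fq S]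

lemma map_dsTerm (F : FA N →ₐ[Fq] S) (pm : Bool) (i j : Fin N) {n : ℕ} (ks : Fin n → ℤ) (l : ℤ)
    (σ : Equiv.Perm (Fin n)) (r : ℕ) :
    F (dsTerm pm i j n ks l σ r) = insertProd (F (e (if pm then xp j l else xm j l))) r
      ((fun t => F (e (if pm then xp i (ks t) else xm i (ks t)))) ∘ σ) := by
  simp only [dsTerm, insertProd, map_mul, map_list_prod, List.map_map]
  rfl

variable (d A) in
/-- The Drinfeld–Serre sum for a family of modes. -/
def serreSum (x : Fin N → ℤ → S) (i j : Fin N) (ks : Fin (1 - A i j).toNat → ℤ) (l : ℤ) : S :=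
  ∑ σ : Equiv.Perm (Fin (1 - A i j).toNat), ∑ r ∈ Finset.range ((1 - A i j).toNat + 1),
    ((-1 : Fq) ^ r * qbinom d i (1 - A i j).toNat r) •
      insertProd (x j l) r ((fun t => x i (ks t)) ∘ σ)

lemma map_serre_sum (F : FA N →ₐ[Fq] S) (pm : Bool) (i j : Fin N)
    (ks : Fin (1 - A i j).toNat → ℤ) (l : ℤ) :
    F (∑ σ : Equiv.Perm (Fin (1 - A i j).toNat),
          ∑ r ∈ Finset.range ((1 - A i j).toNat + 1),
            ((-1 : Fq) ^ r * qbinom d i (1 - A i j).toNat r) •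
              dsTerm pm i j (1 - A i j).toNat ks l σ r) =
      serreSum d A (fun i l => F (e (if pm then xp i l else xm i l))) i j ks l := by
  simp only [map_sum, map_smul, map_dsTerm, serreSum]

/-- A first order deformation of currents by half-currents satisfies the Drinfeld–Serre
relations. -/
lemma snd_serreSum_dual {b : Fin N → Fin N → Fq} {x : Fin N → ℤ → S} {Ψ Φ : Fin N → ℕ → S}
    (hQ : ∀ i j, QuadRel (b i j) (x i) (x j))
    (hB : ∀ i j, BiExchange (b i j) (x j) (Ψ i) (Φ i)) (hb : ∀ i j, b i j = b j i) {i j : Fin N}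
    (hij : A i j ≤ 0)
    (hρ : SerreCoeff (b i i) (b i j) (-A i j).toNat
      (fun r => (-1 : Fq) ^ r * qbinom d i ((-A i j).toNat + 1) r))
    (ks : Fin (1 - A i j).toNat → ℤ) (k l : ℤ) :
    TrivSqZeroExt.snd (serreSum d A
      (fun i m => (dual (x i m) (currentMode (Ψ i) (Φ i) k m) : DualNumber S)) i j ks l) = 0 := by
  have key := fun ks => dserre_dual hρ (hQ i i) (hQ i j) (hB i i) (hB i j)
    (by rw [hb]; exact hB j i) ks k l
  have hn : (1 - A i j).toNat = (-A i j).toNat + 1 := by omega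
  rw [serreSum]
  revert ks
  rw [hn]
  exact key

lemma quadRel_dual {b : Fin N → Fin N → Fq} {x : Fin N → ℤ → S} {Ψ Φ : Fin N → ℕ → S}
    (hQ : ∀ i j, QuadRel (b i j) (x i) (x j)) (hb0 : ∀ i j, b i j ≠ 0)
    (hB : ∀ i j, BiExchange (b i j) (x j) (Ψ i) (Φ i)) (hb : ∀ i j, b i j = b j i) (k : ℤ)
    (i j : Fin N) :
    QuadRel (b i j) (fun m => (dual (x i m) (currentMode (Ψ i) (Φ i) k m) : DualNumber S))
      (fun m => dual (x j m) (currentMode (Ψ j) (Φ j) k m)) :=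
  (hQ i j).dual ((hB i j).quadRel (hb0 i j) k)
    (by rw [hb]; exact ((hB j i).quadRel (hb0 j i) k).swap)

lemma RespectsB.exists_biExchange_ite {f : FA N →ₐ[Fq] S} (hf : RespectsB d A f)
    (hd : ∀ i, 0 < d i) (i₀ : Fin N) (k : ℤ) :
    ∃ Ψ Φ : Fin N → ℕ → S,
      (∀ i l, (if i₀ = i then f (crossEl d i₀ k l) else 0) = currentMode (Ψ i) (Φ i) k l) ∧
      ∀ i j, BiExchange (qp d A i j)⁻¹ (fun m => f (e (xm j m))) (Ψ i) (Φ i) := by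
  obtain ⟨Ψ, Φ, h1, h2⟩ := hf.exists_biExchange_cross hd i₀ k
  refine ⟨fun i => if i₀ = i then Ψ else 0, fun i => if i₀ = i then Φ else 0, fun i l => ?_,
    fun i j => ?_⟩
  · by_cases hi : i₀ = i
    · subst hi
      simpa using h1 l
    · simpa [hi] using (currentMode_zero k l).symm
  · by_cases hi : i₀ = i
    · subst hi
      simpa using h2 j
    · simpa [hi] using BiExchange.zero _ _

end SerreFamilies

section CrossRepresentation

attribute [local instance] natAlgebraFq intAlgebraFq

variable {N : ℕ} (d : Fin N → ℤ) (A : Fin N → Fin N → ℤ)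
  {R : Type*} [Ring R] [Algebra Fq R] (f : FA N →ₐ[Fq] R)

/-- The scalar by which a generator is conjugated when moved past `x^+_{i,k}`. -/
def crossTwist : Gen N → Fin N × ℤ → Fq
  | .K j, ι => (qp d A j ι.1)⁻¹
  | .Kinv j, ι => qp d A j ι.1
  | .D, ι => (qq ^ ι.2)⁻¹
  | .Dinv, ι => qq ^ ι.2
  | _, _ => 1

/-- The contribution of `[h_{j,s}, x^+_{i,k}]`. -/
def crossShift : Gen N → Fin N × ℤ → ((Fin N × ℤ → R) →ₗ[Fq] R)
  | .h j s, ι => ((s : Fq)⁻¹ * qint d j (s * A j ι.1)) •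
      (LinearMap.mulLeft Fq (f (gammaHalf (-|s|))) ∘ₗ LinearMap.proj (ι.1, ι.2 + s))
  | _, _ => 0

/-- The contribution of `[x^+_{i,k}, x^-_{j,l}]`. -/
def crossInhom : Gen N → Fin N × ℤ → R
  | .xm j l, ι => if ι.1 = j then f (crossEl d ι.1 ι.2 l) else 0
  | _, _ => 0

/-- The action of a generator `x` on pairs `(v, (g_{i,k}))`, modelled on left multiplication
of `(u, (x^+_{i,k} u))`. -/
def crossAct (x : Gen N) : Module.End Fq (R × (Fin N × ℤ → R)) :=
  LinearMap.prod (LinearMap.mulLeft Fq (f (e x)) ∘ₗ LinearMap.fst _ _ _)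
    (LinearMap.pi fun ι =>
      crossTwist d A x ι • (LinearMap.mulLeft Fq (f (e x)) ∘ₗ LinearMap.proj ι ∘ₗ
        LinearMap.snd _ _ _) - crossShift d A f x ι ∘ₗ LinearMap.snd _ _ _ +
      LinearMap.mulLeft Fq (crossInhom d f x ι) ∘ₗ LinearMap.fst _ _ _)

/-- The representation of the free algebra by `crossAct`. -/
def crossRep : FA N →ₐ[Fq] Module.End Fq (R × (Fin N × ℤ → R)) :=
  FreeAlgebra.lift Fq (crossAct d A f)

lemma crossRep_e (x : Gen N) : crossRep d A f (e x) = crossAct d A f x :=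
  FreeAlgebra.lift_ι_apply _ _

lemma crossAct_snd (x : Gen N) (v : R × (Fin N × ℤ → R)) (ι : Fin N × ℤ) :
    (crossAct d A f x v).2 ι = crossTwist d A x ι • (f (e x) * v.2 ι) -
      crossShift d A f x ι v.2 + crossInhom d f x ι * v.1 := rfl

lemma crossRep_fst (w : FA N) (v : R × (Fin N × ℤ → R)) : (crossRep d A f w v).1 = f w * v.1 := by
  induction w using FreeAlgebra.induction generalizing v with
  | grade0 r => simp [Algebra.algebraMap_eq_smul_one]
  | grade1 x => rw [← e, crossRep_e]; rfl
  | mul a b ha hb => rw [map_mul, Module.End.mul_apply, ha, hb, map_mul, mul_assoc]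
  | add a b ha hb => rw [map_add, LinearMap.add_apply, Prod.fst_add, ha, hb, map_add, add_mul]

/-- The projection of `crossRep` to the `x^-` part, valued in dual numbers. -/
def crossDual (ι : Fin N × ℤ) : FA N →ₐ[Fq] DualNumber R :=
  FreeAlgebra.lift Fq fun x => match x with
    | .xm j l => dual (f (e (xm j l))) (crossInhom d f (xm j l) ι)
    | _ => 0

lemma crossDual_xm (ι : Fin N × ℤ) (j : Fin N) (l : ℤ) : crossDual d f ι (e (xm j l)) =
    dual (f (e (xm j l))) (if ι.1 = j then f (crossEl d ι.1 ι.2 l) else 0) :=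
  FreeAlgebra.lift_ι_apply _ _

/-- Words on which `crossRep` is computed by `crossDual`. -/
def crossSub (ι : Fin N × ℤ) : Subalgebra Fq (FA N) where
  carrier := {w | ∀ v, dual (crossRep d A f w v).1 ((crossRep d A f w v).2 ι) =
    crossDual d f ι w * dual v.1 (v.2 ι)}
  mul_mem' := fun {a b} ha hb v => by
    rw [map_mul, Module.End.mul_apply, ha, hb, map_mul, mul_assoc]
  add_mem' := fun {a b} ha hb v => by
    rw [map_add, LinearMap.add_apply, map_add, add_mul, ← ha, ← hb]; rfl
  algebraMap_mem' := fun r v => by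
    rw [AlgHom.commutes, AlgHom.commutes, Algebra.algebraMap_eq_smul_one,
      Algebra.algebraMap_eq_smul_one, smul_one_mul]; rfl

variable {d A f}

lemma xm_mem_crossSub (ι : Fin N × ℤ) (j : Fin N) (l : ℤ) : e (xm j l) ∈ crossSub d A f ι := by
  intro v
  rw [crossDual_xm, crossRep_e, crossAct_snd]
  ext
  · rw [TrivSqZeroExt.fst_mul]; rfl
  · rw [TrivSqZeroExt.snd_mul]
    simp [crossTwist, crossShift, crossInhom]

lemma crossRep_eq_zero_of_mem {ι : Fin N × ℤ} {w : FA N} (hw : w ∈ crossSub d A f ι)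
    (h0 : f w = 0) (h1 : TrivSqZeroExt.snd (crossDual d f ι w) = 0) (v : R × (Fin N × ℤ → R)) :
    (crossRep d A f w v).2 ι = 0 := by
  have h2 : TrivSqZeroExt.fst (crossDual d f ι w) = 0 := by
    have := congrArg TrivSqZeroExt.fst (hw (1, 0))
    rw [TrivSqZeroExt.fst_mul, fst_dual, fst_dual, crossRep_fst] at this
    simpa [h0] using this.symm
  have := congrArg TrivSqZeroExt.snd (hw v)
  rw [TrivSqZeroExt.snd_mul, snd_dual, h1, h2] at this
  simpa using this

end CrossRepresentation

section CrossRepresentationRelations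

attribute [local instance] natAlgebraFq intAlgebraFq

variable {N : ℕ} {d : Fin N → ℤ} {A : Fin N → Fin N → ℤ}
  {R : Type*} [Ring R] [Algebra Fq R] {f : FA N →ₐ[Fq] R}

section
variable (v : R × (Fin N × ℤ → R)) (ι : Fin N × ℤ)

lemma crossAct_K (j : Fin N) : (crossAct d A f (K j) v).2 ι =
    (qp d A j ι.1)⁻¹ • (f (e (K j)) * v.2 ι) := by
  simp [crossAct_snd, crossTwist, crossShift, crossInhom]

lemma crossAct_Kinv (j : Fin N) : (crossAct d A f (Kinv j) v).2 ι =
    qp d A j ι.1 • (f (e (Kinv j)) * v.2 ι) := by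
  simp [crossAct_snd, crossTwist, crossShift, crossInhom]

lemma crossAct_D : (crossAct d A f D v).2 ι = (qq ^ ι.2)⁻¹ • (f (e D) * v.2 ι) := by
  simp [crossAct_snd, crossTwist, crossShift, crossInhom]

lemma crossAct_Dinv : (crossAct d A f Dinv v).2 ι = (qq ^ ι.2) • (f (e Dinv) * v.2 ι) := by
  simp [crossAct_snd, crossTwist, crossShift, crossInhom]

lemma crossAct_g2 : (crossAct d A f g2 v).2 ι = f (e g2) * v.2 ι := by
  simp [crossAct_snd, crossTwist, crossShift, crossInhom]

lemma crossAct_g2inv : (crossAct d A f g2inv v).2 ι = f (e g2inv) * v.2 ι := by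
  simp [crossAct_snd, crossTwist, crossShift, crossInhom]

lemma crossAct_xp (j : Fin N) (l : ℤ) : (crossAct d A f (xp j l) v).2 ι =
    f (e (xp j l)) * v.2 ι := by
  simp [crossAct_snd, crossTwist, crossShift, crossInhom]

lemma crossAct_xm (j : Fin N) (l : ℤ) : (crossAct d A f (xm j l) v).2 ι =
    f (e (xm j l)) * v.2 ι + (if ι.1 = j then f (crossEl d ι.1 ι.2 l) else 0) * v.1 := by
  simp [crossAct_snd, crossTwist, crossShift, crossInhom]

lemma crossAct_h (j : Fin N) (s : ℤ) : (crossAct d A f (Gen.h j s) v).2 ι =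
    f (e (Gen.h j s)) * v.2 ι - ((s : Fq)⁻¹ * qint d j (s * A j ι.1)) •
      (f (gammaHalf (-|s|)) * v.2 (ι.1, ι.2 + s)) := by
  simp [crossAct_snd, crossTwist, crossShift, crossInhom]

end

lemma crossAct_mul_central {z : R} (hz : ∀ w, Commute z (f w)) (x : Gen N)
    (v : R × (Fin N × ℤ → R)) (ι : Fin N × ℤ) :
    (crossAct d A f x (z * v.1, fun ι => z * v.2 ι)).2 ι = z * (crossAct d A f x v).2 ι := by
  have hz' : ∀ w y, f w * (z * y) = z * (f w * y) := fun w y => by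
    rw [← mul_assoc, ← (hz w).eq, mul_assoc]
  cases x with
  | h j s => simp only [crossAct_h, hz', mul_sub, mul_smul_comm]
  | K j => simp only [crossAct_K, hz', mul_smul_comm]
  | Kinv j => simp only [crossAct_Kinv, hz', mul_smul_comm]
  | D => simp only [crossAct_D, hz', mul_smul_comm]
  | Dinv => simp only [crossAct_Dinv, hz', mul_smul_comm]
  | g2 => simp only [crossAct_g2, hz']
  | g2inv => simp only [crossAct_g2inv, hz']
  | xp j l => simp only [crossAct_xp, hz']
  | xm j l =>
    simp only [crossAct_xm, hz', mul_add]
    split_ifs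
    · rw [hz']
    · simp

lemma crossRep_gammaHalf (m : ℤ) (v : R × (Fin N × ℤ → R)) (ι : Fin N × ℤ) :
    (crossRep d A f (gammaHalf m) v).2 ι = f (gammaHalf m) * v.2 ι := by
  rw [gammaHalf]
  split_ifs
  · generalize m.toNat = n
    induction n generalizing v with
    | zero => simp
    | succ n ih => rw [pow_succ, map_mul, Module.End.mul_apply, ih, crossRep_e, crossAct_g2,
        map_mul, mul_assoc]
  · generalize (-m).toNat = n
    induction n generalizing v with
    | zero => simp
    | succ n ih => rw [pow_succ, map_mul, Module.End.mul_apply, ih, crossRep_e, crossAct_g2inv,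
        map_mul, mul_assoc]

variable (hf : RespectsB d A f)
include hf

lemma RespectsB.commute_g2inv (w : FA N) : Commute (f (e g2inv)) (f w) := by
  simpa [gammaHalf] using hf.gammaCentral.commute_gamma (-1) w

/-- Left multiplications together with the operators `x^+_{i,k}` satisfy the relations `BRel`. -/
lemma RespectsB.crossRep (hd : ∀ i, 0 < d i) (hdiag : ∀ i, A i i = 2)
    (hoff : ∀ i j, i ≠ j → A i j ≤ 0) (hsym : ∀ i j, d i * A i j = d j * A j i) :
    RespectsB d A (crossRep d A f) := by
  have hb : ∀ i j, (qp d A i j)⁻¹ = (qp d A j i)⁻¹ := fun i j => by rw [qp, qp, hsym]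
  have hfst : ∀ a b, BRel N d A a b → ∀ v, (_root_.crossRep d A f a v).1 =
      (_root_.crossRep d A f b v).1 := fun a b hab v => by
    rw [crossRep_fst, crossRep_fst, hf a b hab]
  have hsnd : ∀ a b, BRel N d A a b → ∀ v ι, (_root_.crossRep d A f a v).2 ι =
      (_root_.crossRep d A f b v).2 ι := fun a b hab v ι => by
    have hqp := fun i j => qp_ne_zero d A i j
    have hqq : ∀ k : ℤ, qq ^ k ≠ 0 := fun k => zpow_ne_zero k qq_ne_zero
    have hgc : ∀ m w y, f w * (f (gammaHalf m) * y) = f (gammaHalf m) * (f w * y) :=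
      fun m w y => by rw [← mul_assoc, ← (hf.gammaCentral.commute_gamma m w).eq, mul_assoc]
    cases hab with
    | K_Kinv i =>
      simp only [map_mul, Module.End.mul_apply, crossRep_e, crossAct_K, crossAct_Kinv,
        mul_smul_comm, inv_smul_smul₀ (hqp _ _), ← mul_assoc, hf.K_mul_Kinv, one_mul, map_one,
        Module.End.one_apply]
    | Kinv_K i =>
      simp only [map_mul, Module.End.mul_apply, crossRep_e, crossAct_K, crossAct_Kinv,
        mul_smul_comm, smul_inv_smul₀ (hqp _ _), ← mul_assoc, hf.Kinv_mul_K, one_mul, map_one,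
        Module.End.one_apply]
    | D_Dinv =>
      simp only [map_mul, Module.End.mul_apply, crossRep_e, crossAct_D, crossAct_Dinv,
        mul_smul_comm, inv_smul_smul₀ (hqq _), ← mul_assoc, hf.D_mul_Dinv, one_mul, map_one,
        Module.End.one_apply]
    | Dinv_D =>
      simp only [map_mul, Module.End.mul_apply, crossRep_e, crossAct_D, crossAct_Dinv,
        mul_smul_comm, smul_inv_smul₀ (hqq _), ← mul_assoc, hf.Dinv_mul_D, one_mul, map_one,
        Module.End.one_apply]
    | g_ginv =>
      simp only [map_mul, Module.End.mul_apply, crossRep_e, crossAct_g2, crossAct_g2inv,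
        ← mul_assoc, hf.gammaCentral.mul_inv, one_mul, map_one, Module.End.one_apply]
    | ginv_g =>
      simp only [map_mul, Module.End.mul_apply, crossRep_e, crossAct_g2, crossAct_g2inv,
        ← mul_assoc, hf.gammaCentral.inv_mul, one_mul, map_one, Module.End.one_apply]
    | g2_comm x =>
      simp only [map_mul, Module.End.mul_apply, crossRep_e, crossAct_g2]
      exact (crossAct_mul_central hf.gammaCentral.commute_map x v ι).symm.trans
        (congrArg (fun u => (crossAct d A f x u).2 ι) (Prod.ext rfl (funext fun ι =>
          (crossAct_g2 v ι).symm)))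
    | g2inv_comm x =>
      simp only [map_mul, Module.End.mul_apply, crossRep_e, crossAct_g2inv]
      exact (crossAct_mul_central hf.commute_g2inv x v ι).symm.trans
        (congrArg (fun u => (crossAct d A f x u).2 ι) (Prod.ext rfl (funext fun ι =>
          (crossAct_g2inv v ι).symm)))
    | K_comm_K i j =>
      simp only [map_mul, Module.End.mul_apply, crossRep_e, crossAct_K, mul_smul_comm,
        ← mul_assoc, (hf.K_commute_K i j).eq]
      rw [smul_comm]
    | K_comm_D i =>
      simp only [map_mul, Module.End.mul_apply, crossRep_e, crossAct_K, crossAct_D, mul_smul_comm,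
        ← mul_assoc, (hf.K_commute_D i).eq]
      rw [smul_comm]
    | K_comm_h i j s =>
      simp only [map_mul, Module.End.mul_apply, crossRep_e, crossAct_K, crossAct_h, mul_smul_comm,
        mul_sub, smul_sub, ← mul_assoc, (hf.K_commute_h i j s).eq,
        (hf.gammaCentral.commute_gamma _ _).eq]
      rw [smul_comm ((s : Fq)⁻¹ * _)]
    | h_zero i =>
      have h0 : f (e (Gen.h i 0)) = 0 := by simpa using hf _ _ (.h_zero i)
      simp [crossRep_e, crossAct_h, h0]
    | D_h i s =>
      have h0 : f (e D) * f (e (Gen.h i s)) * f (e Dinv) = qq ^ s • f (e (Gen.h i s)) := by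
        simpa using hf _ _ (.D_h i s)
      simp only [map_mul, map_smul, Module.End.mul_apply, LinearMap.smul_apply, Prod.smul_snd,
        Pi.smul_apply, crossRep_e, crossAct_D, crossAct_Dinv, crossAct_h, mul_smul_comm, mul_sub,
        smul_sub, ← mul_assoc, h0]
      rw [inv_smul_smul₀ (hqq _), smul_mul_assoc, ← (hf.gammaCentral.commute_gamma _ _).eq,
        mul_assoc _ (f (e D)), hf.D_mul_Dinv, mul_one, smul_smul, smul_smul, smul_smul,
        zpow_add₀ qq_ne_zero]
      congr 2
      rw [mul_comm _ (qq ^ ι.2 * _), ← mul_assoc, mul_right_comm (qq ^ ι.2),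
        mul_inv_cancel₀ (hqq _),
        one_mul]
    | D_xm i r =>
      have h0 : f (e D) * f (e (xm i r)) * f (e Dinv) = qq ^ r • f (e (xm i r)) := by
        simpa using hf _ _ (.D_xm i r)
      have h1 : f (e D) * f (crossEl d ι.1 ι.2 r) * f (e Dinv) =
          qq ^ (ι.2 + r) • f (crossEl d ι.1 ι.2 r) := by
        rw [hf.D_mul_cross, smul_mul_assoc, mul_assoc, hf.D_mul_Dinv, mul_one]
      simp only [map_mul, map_smul, Module.End.mul_apply, LinearMap.smul_apply, Prod.smul_snd,
        Pi.smul_apply, crossRep_e, crossAct_D, crossAct_Dinv, crossAct_xm, mul_smul_comm, mul_add,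
        smul_add, ← mul_assoc, h0]
      rw [inv_smul_smul₀ (hqq _), smul_mul_assoc]
      congr 1
      split_ifs
      · rw [show (crossAct d A f Dinv v).1 = f (e Dinv) * v.1 from rfl, ← mul_assoc, h1,
          smul_mul_assoc, smul_smul, zpow_add₀ qq_ne_zero, inv_mul_cancel_left₀ (hqq _)]
      · simp
    | K_xm i j r =>
      have h0 : f (e (K i)) * f (e (xm j r)) * f (e (Kinv i)) =
          (qp d A i j)⁻¹ • f (e (xm j r)) := by
        simpa using hf _ _ (.K_xm i j r)
      have h1 : f (e (K i)) * f (crossEl d ι.1 ι.2 r) * f (e (Kinv i)) =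
          f (crossEl d ι.1 ι.2 r) := by
        rw [(hf.K_commute_cross _ _ _ _).eq, mul_assoc, hf.K_mul_Kinv, mul_one]
      simp only [map_mul, map_smul, Module.End.mul_apply, LinearMap.smul_apply, Prod.smul_snd,
        Pi.smul_apply, crossRep_e, crossAct_K, crossAct_Kinv, crossAct_xm, mul_smul_comm, mul_add,
        smul_add, ← mul_assoc, h0]
      rw [inv_smul_smul₀ (hqp _ _), smul_mul_assoc]
      congr 1
      split_ifs with hj
      · rw [show (crossAct d A f (Kinv i) v).1 = f (e (Kinv i)) * v.1 from rfl, ← mul_assoc, h1, hj]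
      · simp
    | h_h i j k l hk hl =>
      have h0 := congrArg (· * v.2 ι) (hf.h_mul_h i j hk hl)
      have hRHS : (_root_.crossRep d A f (if l = -k then
          ((k : Fq)⁻¹ * qint d i (k * A i j) * (qi d j - (qi d j)⁻¹)⁻¹) •
            (gammaPow k - gammaPow (-k)) else 0) v).2 ι =
          (if l = -k then ((k : Fq)⁻¹ * qint d i (k * A i j) * (qi d j - (qi d j)⁻¹)⁻¹) •
            (f (gammaPow k) - f (gammaPow (-k))) else 0) * v.2 ι := by
        split_ifs
        · simp only [map_smul, map_sub, LinearMap.smul_apply, LinearMap.sub_apply, Prod.smul_snd,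
            Prod.snd_sub, Pi.smul_apply, Pi.sub_apply, gammaPow, crossRep_gammaHalf,
            smul_mul_assoc, sub_mul]
        · simp
      rw [hRHS, ← h0]
      have e1 := fun m => hgc m (e (Gen.h i k))
      have e2 := fun m => hgc m (e (Gen.h j l))
      have e3 := hgc (-|l|) (gammaHalf (-|k|)) (v.2 (ι.1, ι.2 + k + l))
      simp only [map_sub, map_mul, Module.End.mul_apply, LinearMap.sub_apply, Prod.snd_sub,
        Pi.sub_apply, crossRep_e, crossAct_h, mul_sub, smul_sub, mul_smul_comm, e1, e2, e3, sub_mul,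
        mul_assoc (f _), add_right_comm ι.2 l k]
      rw [smul_comm (_ * qint d i _) (_ * qint d j _)]
      abel
    | h_xm i j k l hk =>
      have h0 := congrArg (· * v.2 ι) (hf.h_mul_xm hk i j l)
      have e1 := fun m => hgc m (e (xm j l))
      simp only [map_sub, map_mul, map_smul, Module.End.mul_apply, LinearMap.sub_apply,
        LinearMap.smul_apply, Prod.snd_sub, Prod.smul_snd, Pi.smul_apply,
        Pi.sub_apply, crossRep_e, crossRep_gammaHalf, crossAct_h, crossAct_xm, mul_sub, mul_add,
        smul_add, mul_smul_comm, e1]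
      simp only [sub_mul, smul_mul_assoc, mul_assoc (f _)] at h0
      by_cases hj : ι.1 = j
      · have h1 := congrArg (· * v.1) (hf.h_mul_cross hd ι.1 i hk ι.2 l)
        simp only [sub_mul, smul_mul_assoc, mul_assoc (f _), smul_sub] at h1
        simp only [if_pos hj]
        rw [show (crossAct d A f (Gen.h i k) v).1 = f (e (Gen.h i k)) * v.1 from rfl, ← h0,
          neg_smul, add_comm k l, ← hj]
        rw [sub_eq_iff_eq_add] at h1
        rw [h1]
        abel
      · simp only [if_neg hj, zero_mul, mul_zero, smul_zero, add_zero]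
        rw [← h0]
        abel
    | serre_m i j k l =>
      rw [← sub_eq_zero, ← Pi.sub_apply, ← Prod.snd_sub, ← LinearMap.sub_apply, ← map_sub]
      have hm := fun i l => xm_mem_crossSub (d := d) (A := A) (f := f) ι i l
      refine crossRep_eq_zero_of_mem ?_ ?_ ?_ v
      · exact sub_mem (sub_mem (mul_mem (hm _ _) (hm _ _)) (Subalgebra.smul_mem _
          (mul_mem (hm _ _) (hm _ _)) _)) (sub_mem (Subalgebra.smul_mem _
          (mul_mem (hm _ _) (hm _ _)) _) (mul_mem (hm _ _) (hm _ _)))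
      · rw [map_sub, sub_eq_zero]
        exact hf _ _ (.serre_m i j k l)
      · obtain ⟨Ψ, Φ, h1, h2⟩ := hf.exists_biExchange_ite hd ι.1 ι.2
        have h3 := quadRel_dual (fun i j => hf.quadRel_xm i j)
          (fun i j => inv_ne_zero (hqp i j)) h2 hb ι.2 i j k l
        simp only [← h1, ← crossDual_xm] at h3
        rw [← map_mul, ← map_mul, ← map_mul, ← map_mul] at h3
        rw [← sub_eq_zero] at h3
        refine (congrArg TrivSqZeroExt.snd ?_).trans TrivSqZeroExt.snd_zero
        refine Eq.trans ?_ h3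
        simp only [map_sub, map_smul, smul_add]
        abel
    | dserre i j hij ks l =>
      have hm := fun i l => xm_mem_crossSub (d := d) (A := A) (f := f) ι i l
      rw [map_zero]
      refine crossRep_eq_zero_of_mem ?_ ?_ ?_ v
      · refine sum_mem fun σ _ => sum_mem fun r _ => Subalgebra.smul_mem _ ?_ _
        refine mul_mem (mul_mem (Subalgebra.list_prod_mem _ ?_) (hm _ _))
          (Subalgebra.list_prod_mem _ ?_)
        · intro y hy
          obtain ⟨t, -, rfl⟩ := List.mem_map.1 hy
          exact hm _ _
        · intro y hy
          obtain ⟨t, -, rfl⟩ := List.mem_map.1 hy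
          exact hm _ _
      · simpa using hf _ _ (.dserre i j hij ks l)
      · obtain ⟨Ψ, Φ, h1, h2⟩ := hf.exists_biExchange_ite hd ι.1 ι.2
        rw [map_serre_sum]
        have h3 := snd_serreSum_dual (fun i j => hf.quadRel_xm i j) h2 hb (hoff i j hij)
          (serreCoeff_qbinom (hd i) (hdiag i) (hoff i j hij)) ks ι.2 l
        simp only [← h1, ← crossDual_xm] at h3
        exact h3
  intro a b hab
  refine LinearMap.ext fun v => Prod.ext (hfst a b hab v) (funext fun ι => hsnd a b hab v ι)

end CrossRepresentationRelations

section BorelAlgebra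

attribute [local instance] natAlgebraFq intAlgebraFq

variable {N : ℕ} {d : Fin N → ℤ} {A : Fin N → Fin N → ℤ}

variable (d A) in
/-- `A` is a generalized Cartan matrix symmetrized by the positive integers `d`. -/
structure IsSymmCartan : Prop where
  pos : ∀ i, 0 < d i
  diag : ∀ i, A i i = 2
  off : ∀ i j, i ≠ j → A i j ≤ 0
  symm : ∀ i j, d i * A i j = d j * A j i

lemma IsSymmCartan.qp_symm (hA : IsSymmCartan d A) (i j : Fin N) : qp d A i j = qp d A j i := by
  rw [qp, qp, hA.symm]

/-- The relations `BRel` together with the vanishing of the unused generators `x^+_{i,r}`. -/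
inductive BorelRel (N : ℕ) (d : Fin N → ℤ) (A : Fin N → Fin N → ℤ) : FA N → FA N → Prop
  | of {a b : FA N} (hab : BRel N d A a b) : BorelRel N d A a b
  | xp (i : Fin N) (r : ℤ) : BorelRel N d A (e (xp i r)) 0

variable (d A) in
/-- The algebra presented by the generators other than the `x^+_{i,r}` and their relations. -/
def BorelAlg : Type := RingQuot (BorelRel N d A)

instance : Ring (BorelAlg d A) := inferInstanceAs (Ring (RingQuot (BorelRel N d A)))

instance : Algebra Fq (BorelAlg d A) := inferInstanceAs (Algebra Fq (RingQuot (BorelRel N d A)))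

variable (d A) in
/-- The quotient map onto `BorelAlg`. -/
def borelMk : FA N →ₐ[Fq] BorelAlg d A := RingQuot.mkAlgHom Fq (BorelRel N d A)

lemma borelMk_respectsB : RespectsB d A (borelMk d A) := fun _ _ hab =>
  RingQuot.mkAlgHom_rel Fq (.of hab)

lemma borelMk_xp (i : Fin N) (r : ℤ) : borelMk d A (e (xp i r)) = 0 :=
  (RingQuot.mkAlgHom_rel Fq (.xp i r)).trans (map_zero _)

lemma borelMk_surjective : Function.Surjective (borelMk d A) := RingQuot.mkAlgHom_surjective _ _

/-- `crossRep` on the algebra `BorelAlg`. -/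
def borelCrossRep (hA : IsSymmCartan d A) :
    BorelAlg d A →ₐ[Fq] Module.End Fq (BorelAlg d A × (Fin N × ℤ → BorelAlg d A)) :=
  RingQuot.liftAlgHom Fq ⟨crossRep d A (borelMk d A), fun a b hab => by
    cases hab with
    | of hab => exact borelMk_respectsB.crossRep hA.pos hA.diag hA.off hA.symm a b hab
    | xp i r =>
      rw [map_zero, crossRep_e]
      refine LinearMap.ext fun v => Prod.ext ?_ (funext fun ι => ?_)
      · exact (congrArg (· * v.1) (borelMk_xp i r)).trans (zero_mul _)
      · rw [crossAct_xp, borelMk_xp, zero_mul]; rfl⟩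

variable (hA : IsSymmCartan d A)

lemma borelCrossRep_borelMk (w : FA N) :
    borelCrossRep hA (borelMk d A w) = crossRep d A (borelMk d A) w :=
  RingQuot.liftAlgHom_mkAlgHom_apply ..

/-- The operator by which `x^+_{i,k}` acts on `BorelAlg`, the highest weight vector being `1`. -/
def raise (i : Fin N) (k : ℤ) : Module.End Fq (BorelAlg d A) :=
  LinearMap.proj (i, k) ∘ₗ LinearMap.snd _ _ _ ∘ₗ LinearMap.applyₗ (1, 0) ∘ₗ
    (borelCrossRep hA).toLinearMap

lemma borelCrossRep_apply (u : BorelAlg d A) :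
    borelCrossRep hA u (1, 0) = (u, fun ι => raise hA ι.1 ι.2 u) := by
  refine Prod.ext ?_ rfl
  obtain ⟨w, rfl⟩ := borelMk_surjective u
  rw [borelCrossRep_borelMk, crossRep_fst, mul_one]

lemma raise_one (i : Fin N) (k : ℤ) : raise hA i k 1 = 0 := by
  simp [raise]

lemma raise_mul (x : Gen N) (u : BorelAlg d A) (i : Fin N) (k : ℤ) :
    raise hA i k (borelMk d A (e x) * u) =
      (crossAct d A (borelMk d A) x (u, fun ι => raise hA ι.1 ι.2 u)).2 (i, k) := by
  rw [← borelCrossRep_apply, ← crossRep_e, ← borelCrossRep_borelMk, ← Module.End.mul_apply,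
    ← map_mul]
  rfl

variable (d A) in
/-- The left regular representation. -/
def leftMul : FA N →ₐ[Fq] Module.End Fq (BorelAlg d A) :=
  (Algebra.lmul Fq (BorelAlg d A)).comp (borelMk d A)

lemma leftMul_apply (w : FA N) (u : BorelAlg d A) : leftMul d A w u = borelMk d A w * u := rfl

lemma leftMul_respectsB : RespectsB d A (leftMul d A) := fun a b hab =>
  congrArg (Algebra.lmul Fq (BorelAlg d A)) (borelMk_respectsB a b hab)

section
variable (i j : Fin N) (k l : ℤ)

lemma raise_mul_K : raise hA i k * leftMul d A (e (K j)) =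
    (qp d A j i)⁻¹ • (leftMul d A (e (K j)) * raise hA i k) :=
  LinearMap.ext fun u => (raise_mul hA _ u i k).trans (crossAct_K ..)

lemma raise_mul_Kinv : raise hA i k * leftMul d A (e (Kinv j)) =
    qp d A j i • (leftMul d A (e (Kinv j)) * raise hA i k) :=
  LinearMap.ext fun u => (raise_mul hA _ u i k).trans (crossAct_Kinv ..)

lemma raise_mul_D : raise hA i k * leftMul d A (e D) =
    (qq ^ k)⁻¹ • (leftMul d A (e D) * raise hA i k) :=
  LinearMap.ext fun u => (raise_mul hA _ u i k).trans (crossAct_D ..)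

lemma raise_mul_Dinv : raise hA i k * leftMul d A (e Dinv) =
    qq ^ k • (leftMul d A (e Dinv) * raise hA i k) :=
  LinearMap.ext fun u => (raise_mul hA _ u i k).trans (crossAct_Dinv ..)

lemma raise_mul_g2 : raise hA i k * leftMul d A (e g2) = leftMul d A (e g2) * raise hA i k :=
  LinearMap.ext fun u => (raise_mul hA _ u i k).trans (crossAct_g2 ..)

lemma raise_mul_g2inv :
    raise hA i k * leftMul d A (e g2inv) = leftMul d A (e g2inv) * raise hA i k :=
  LinearMap.ext fun u => (raise_mul hA _ u i k).trans (crossAct_g2inv ..)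

lemma raise_mul_xm : raise hA i k * leftMul d A (e (xm j l)) =
    leftMul d A (e (xm j l)) * raise hA i k +
      if i = j then leftMul d A (crossEl d i k l) else 0 :=
  LinearMap.ext fun u => (raise_mul hA _ u i k).trans <| (crossAct_xm ..).trans <| by
    simp only [LinearMap.add_apply]
    split_ifs
    · rfl
    · rw [zero_mul]; rfl

lemma raise_mul_h (s : ℤ) : raise hA i k * leftMul d A (e (Gen.h j s)) =
    leftMul d A (e (Gen.h j s)) * raise hA i k - ((s : Fq)⁻¹ * qint d j (s * A j i)) •
      (leftMul d A (gammaHalf (-|s|)) * raise hA i (k + s)) :=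
  LinearMap.ext fun u => (raise_mul hA _ u i k).trans (crossAct_h ..)

end

lemma biExchange_raise (i j : Fin N) :
    BiExchange (qp d A i j) (raise hA j)
      (fun p => leftMul d A (gammaHalf (1 * p)) * leftMul d A (psiEl d i p))
      (fun p => leftMul d A (gammaHalf (1 * p)) * leftMul d A (phiEl d i (-(p : ℤ)))) := by
  have hi := qi_sub_inv_ne_zero (hA.pos i)
  refine biExchange_psi_phi d leftMul_respectsB.gammaCentral (qp_ne_zero d A i j) 1
    (fun m => (raise_mul_g2 hA j m).symm) (fun m => raise_mul_K hA j i m)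
    (fun m => raise_mul_Kinv hA j i m) fun s m hs => ?_
  rw [raise_mul_h, sub_right_comm, sub_self, zero_sub, smul_neg, ← neg_smul, smul_smul, neg_mul,
    int_mul_qint hi hs, neg_sub, neg_mul, one_mul]

/-- `[x^+_{i,k}, x^-_{j,l}]` as a current in `x^+`. -/
lemma exists_biExchange_raise (j : Fin N) (l : ℤ) :
    ∃ Ψ Φ : Fin N → ℕ → Module.End Fq (BorelAlg d A),
      (∀ i k, raise hA i k * leftMul d A (e (xm j l)) - leftMul d A (e (xm j l)) * raise hA i k =
        currentMode (Ψ i) (Φ i) l k) ∧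
      ∀ i i', BiExchange (qp d A i i') (raise hA i') (Ψ i) (Φ i) := by
  have hc : ∀ m i k, Commute (leftMul d A ((qi d j - (qi d j)⁻¹)⁻¹ • gammaHalf m))
      (raise hA i k) := fun m i k => by
    rw [map_smul]
    exact (leftMul_respectsB.gammaCentral.commute_of_commute (raise_mul_g2 hA i k).symm
      m).smul_left _
  obtain ⟨Ψ, Φ, h1, h2⟩ : ∃ Ψ Φ : ℕ → Module.End Fq (BorelAlg d A),
      (∀ k, leftMul d A (crossEl d j k l) = currentMode Ψ Φ l k) ∧
      ∀ i', BiExchange (qp d A j i') (raise hA i') Ψ Φ :=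
    ⟨_, _, fun k => map_crossEl_eq_currentMode' d leftMul_respectsB.gammaCentral j k l,
      fun i' => (biExchange_raise hA j i').central_mul _ _ (fun m => hc _ _ _) fun m => hc _ _ _⟩
  refine ⟨fun i => if i = j then Ψ else 0, fun i => if i = j then Φ else 0, fun i k => ?_,
    fun i i' => ?_⟩
  · rw [raise_mul_xm, add_sub_cancel_left]
    by_cases hi : i = j
    · subst hi
      simpa only [if_true] using h1 k
    · simpa [hi] using (currentMode_zero l k).symm
  · by_cases hi : i = j
    · subst hi
      simpa only [if_true] using h2 i'
    · simpa [hi] using BiExchange.zero _ _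

end BorelAlgebra

section FockRepresentation

attribute [local instance] natAlgebraFq intAlgebraFq

variable {N : ℕ} {d : Fin N → ℤ} {A : Fin N → Fin N → ℤ}

lemma gammaHalf_mem {S : Subalgebra Fq (FA N)} (h1 : e g2 ∈ S) (h2 : e g2inv ∈ S) (m : ℤ) :
    gammaHalf m ∈ S := by
  rw [gammaHalf]
  split_ifs
  exacts [pow_mem h1 _, pow_mem h2 _]

/-- The elements of the free algebra preserving a subspace of `BorelAlg`. -/
def stabilizer (V : Submodule Fq (BorelAlg d A)) : Subalgebra Fq (FA N) where
  carrier := {w | ∀ v ∈ V, leftMul d A w v ∈ V}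
  mul_mem' := fun {a b} ha hb v hv => by rw [map_mul]; exact ha _ (hb v hv)
  add_mem' := fun {a b} ha hb v hv => by rw [map_add]; exact V.add_mem (ha v hv) (hb v hv)
  algebraMap_mem' := fun r v hv => by
    rw [AlgHom.commutes, Module.algebraMap_end_apply]; exact V.smul_mem _ hv

lemma freeAlgebra_eq_top {S : Subalgebra Fq (FA N)} (h : ∀ x, e x ∈ S) : S = ⊤ := by
  rw [eq_top_iff, ← FreeAlgebra.adjoin_range_ι]
  exact Algebra.adjoin_le (Set.range_subset_iff.2 h)

variable (hA : IsSymmCartan d A)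

/-- Products of an element killed by all raising operators with the `x^-_{j,l}` and
`γ^{±1/2}`. -/
inductive LoweredVector : BorelAlg d A → Prop
  | base (u : BorelAlg d A) (hu : ∀ i k, raise hA i k u = 0) : LoweredVector u
  | xm (j : Fin N) (l : ℤ) (u : BorelAlg d A) (hu : LoweredVector u) :
      LoweredVector (leftMul d A (e (xm j l)) u)
  | g2 (u : BorelAlg d A) (hu : LoweredVector u) : LoweredVector (leftMul d A (e g2) u)
  | g2inv (u : BorelAlg d A) (hu : LoweredVector u) : LoweredVector (leftMul d A (e g2inv) u)

/-- The span of the lowered vectors. -/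
def loweredSpan : Submodule Fq (BorelAlg d A) := Submodule.span Fq {u | LoweredVector hA u}

lemma mem_stabilizer_loweredSpan {w : FA N}
    (h : ∀ u, LoweredVector hA u → leftMul d A w u ∈ loweredSpan hA) :
    w ∈ stabilizer (loweredSpan hA) :=
  (Submodule.span_le (p := (loweredSpan hA).comap (leftMul d A w))).2 h

lemma xm_mem_stabilizer (j : Fin N) (l : ℤ) : e (xm j l) ∈ stabilizer (loweredSpan hA) :=
  mem_stabilizer_loweredSpan hA fun _ hu => Submodule.subset_span (hu.xm j l)

lemma g2_mem_stabilizer : e g2 ∈ stabilizer (loweredSpan hA) :=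
  mem_stabilizer_loweredSpan hA fun _ hu => Submodule.subset_span hu.g2

lemma g2inv_mem_stabilizer : e g2inv ∈ stabilizer (loweredSpan hA) :=
  mem_stabilizer_loweredSpan hA fun _ hu => Submodule.subset_span hu.g2inv

/-- A generator which preserves the vectors killed by the raising operators, and moves past the
`x^-_{j,l}` and the `γ^{±1/2}`, preserves the span of the lowered vectors. -/
lemma mem_stabilizer_of_base {x : Gen N}
    (h0 : ∀ u, (∀ i k, raise hA i k u = 0) → ∀ i k, raise hA i k (leftMul d A (e x) u) = 0)
    (hxm : ∀ j l, ∃ (c c' : Fq) (m l' : ℤ), leftMul d A (e x) * leftMul d A (e (xm j l)) =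
      c • (leftMul d A (e (xm j l)) * leftMul d A (e x)) +
        c' • leftMul d A (gammaHalf m * e (xm j l'))) :
    e x ∈ stabilizer (loweredSpan hA) := by
  refine mem_stabilizer_loweredSpan hA fun u hu => ?_
  induction hu with
  | base u hu => exact Submodule.subset_span (.base _ (h0 u hu))
  | xm j l u hu ih =>
    obtain ⟨c, c', m, l', h⟩ := hxm j l
    rw [← Module.End.mul_apply, h]
    exact Submodule.add_mem _ (Submodule.smul_mem _ _ (xm_mem_stabilizer hA j l _ ih))
      (Submodule.smul_mem _ _ (mul_mem (gammaHalf_mem (g2_mem_stabilizer hA)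
        (g2inv_mem_stabilizer hA) m) (xm_mem_stabilizer hA j l') _ (Submodule.subset_span hu)))
  | g2 u hu ih =>
    rw [← Module.End.mul_apply, ← (leftMul_respectsB.gammaCentral.commute_map (e x)).eq]
    exact g2_mem_stabilizer hA _ ih
  | g2inv u hu ih =>
    rw [← Module.End.mul_apply, ← (leftMul_respectsB.commute_g2inv (e x)).eq]
    exact g2inv_mem_stabilizer hA _ ih

lemma loweredSpan_eq_top : loweredSpan hA = ⊤ := by
  have hB := leftMul_respectsB (d := d) (A := A)
  have apply_eq : ∀ {S T : Module.End Fq (BorelAlg d A)}, S = T → ∀ u, S u = T u :=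
    fun hST u => by rw [hST]
  have htop : stabilizer (loweredSpan hA) = ⊤ := by
    refine freeAlgebra_eq_top fun x => ?_
    cases x with
    | xp i r =>
      intro v _
      rw [leftMul_apply, borelMk_xp, zero_mul]
      exact Submodule.zero_mem _
    | xm j l => exact xm_mem_stabilizer hA j l
    | g2 => exact g2_mem_stabilizer hA
    | g2inv => exact g2inv_mem_stabilizer hA
    | K j =>
      refine mem_stabilizer_of_base hA (fun u hu i k => ?_)
        fun i l => ⟨(qp d A j i)⁻¹, 0, 0, 0, ?_⟩
      · exact (apply_eq (raise_mul_K hA i j k) u).trans (by simp [hu])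
      · rw [hB.xm_mul_K, inv_smul_smul₀ (qp_ne_zero d A j i), zero_smul, add_zero]
    | Kinv j =>
      refine mem_stabilizer_of_base hA (fun u hu i k => ?_)
        fun i l => ⟨qp d A j i, 0, 0, 0, ?_⟩
      · exact (apply_eq (raise_mul_Kinv hA i j k) u).trans (by simp [hu])
      · rw [hB.xm_mul_Kinv, smul_inv_smul₀ (qp_ne_zero d A j i), zero_smul, add_zero]
    | D =>
      refine mem_stabilizer_of_base hA (fun u hu i k => ?_)
        fun i l => ⟨qq ^ l, 0, 0, 0, ?_⟩
      · exact (apply_eq (raise_mul_D hA i k) u).trans (by simp [hu])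
      · have := hB _ _ (.D_xm i l)
        rw [map_mul, map_mul, map_smul] at this
        rw [zero_smul, add_zero, ← smul_mul_assoc, ← this, mul_assoc, hB.Dinv_mul_D, mul_one]
    | Dinv =>
      refine mem_stabilizer_of_base hA (fun u hu i k => ?_)
        fun i l => ⟨(qq ^ l)⁻¹, 0, 0, 0, ?_⟩
      · exact (apply_eq (raise_mul_Dinv hA i k) u).trans (by simp [hu])
      · have := hB _ _ (.D_xm i l)
        rw [map_mul, map_mul, map_smul] at this
        rw [zero_smul, add_zero, eq_inv_smul_iff₀ (zpow_ne_zero l qq_ne_zero), ← mul_smul_comm,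
          ← this, ← mul_assoc, ← mul_assoc, hB.Dinv_mul_D, one_mul]
    | h j s =>
      rcases eq_or_ne s 0 with rfl | hs
      · intro v _
        have := hB _ _ (.h_zero j)
        rw [this, map_zero]
        exact Submodule.zero_mem _
      refine mem_stabilizer_of_base hA (fun u hu i k => ?_)
        fun i l => ⟨1, -((s : Fq)⁻¹ * qint d j (s * A j i)), |s|, s + l, ?_⟩
      · exact (apply_eq (raise_mul_h hA i j k s) u).trans (by simp [hu])
      · rw [one_smul, map_mul, add_comm, ← sub_eq_iff_eq_add, hB.h_mul_xm hs]
  rw [eq_top_iff]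
  intro u _
  obtain ⟨w, rfl⟩ := borelMk_surjective u
  have hw : w ∈ stabilizer (loweredSpan hA) := htop ▸ trivial
  simpa [leftMul_apply] using hw 1 (Submodule.subset_span (.base _ (raise_one hA)))

/-- An operator commuting with the `x^-_{j,l}` and `γ^{±1/2}` is determined by its restriction to
the vectors killed by the raising operators. -/
lemma eq_zero_of_commute_lowering {T : Module.End Fq (BorelAlg d A)}
    (hxm : ∀ j l, T * leftMul d A (e (xm j l)) = leftMul d A (e (xm j l)) * T)
    (hg : T * leftMul d A (e g2) = leftMul d A (e g2) * T)
    (hg' : T * leftMul d A (e g2inv) = leftMul d A (e g2inv) * T)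
    (h0 : ∀ u, (∀ i k, raise hA i k u = 0) → T u = 0) : T = 0 := by
  rw [← LinearMap.ker_eq_top, eq_top_iff, ← loweredSpan_eq_top hA, loweredSpan,
    Submodule.span_le]
  intro u hu
  rw [SetLike.mem_coe, LinearMap.mem_ker]
  induction hu with
  | base u hu => exact h0 u hu
  | xm j l u hu ih => rw [← Module.End.mul_apply, hxm, Module.End.mul_apply, ih, map_zero]
  | g2 u hu ih => rw [← Module.End.mul_apply, hg, Module.End.mul_apply, ih, map_zero]
  | g2inv u hu ih => rw [← Module.End.mul_apply, hg', Module.End.mul_apply, ih, map_zero]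

/-- The representation by raising operators of the subalgebra generated by the `x^+_{i,k}`. -/
def raiseRep : FA N →ₐ[Fq] Module.End Fq (BorelAlg d A) :=
  FreeAlgebra.lift Fq fun x => match x with
    | .xp i k => raise hA i k
    | _ => 0

lemma raiseRep_xp (i : Fin N) (k : ℤ) : raiseRep hA (e (xp i k)) = raise hA i k :=
  FreeAlgebra.lift_ι_apply _ _

lemma raiseRep_mem {S : Subalgebra Fq (Module.End Fq (BorelAlg d A))}
    (hS : ∀ i k, raise hA i k ∈ S) (w : FA N) : raiseRep hA w ∈ S := by
  have : S.comap (raiseRep hA) = ⊤ := freeAlgebra_eq_top fun x => by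
    rw [Subalgebra.mem_comap, raiseRep, e, FreeAlgebra.lift_ι_apply]
    cases x <;> first | exact hS _ _ | exact S.zero_mem
  exact this.ge (Set.mem_univ w)

lemma raiseRep_apply {u : BorelAlg d A} (hu : ∀ i k, raise hA i k u = 0) (w : FA N) :
    raiseRep hA w u = FreeAlgebra.algebraMapInv w • u := by
  induction w using FreeAlgebra.induction with
  | grade0 r => simp
  | grade1 x =>
    rw [raiseRep, FreeAlgebra.lift_ι_apply, FreeAlgebra.algebraMapInv, FreeAlgebra.lift_ι_apply]
    cases x <;> simp [hu]
  | mul a b ha hb => rw [map_mul, Module.End.mul_apply, hb, map_smul, ha, map_mul, smul_smul,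
      mul_comm]
  | add a b ha hb => rw [map_add, LinearMap.add_apply, ha, hb, map_add, add_smul]

lemma raiseRep_eq_zero {w : FA N} (hw : FreeAlgebra.algebraMapInv w = 0)
    (hxm : ∀ j l, raiseRep hA w * leftMul d A (e (xm j l)) -
      leftMul d A (e (xm j l)) * raiseRep hA w = 0) : raiseRep hA w = 0 := by
  refine eq_zero_of_commute_lowering hA (fun j l => sub_eq_zero.1 (hxm j l)) ?_ ?_ fun u hu => ?_
  · have := raiseRep_mem hA (S := Subalgebra.centralizer Fq {leftMul d A (e g2)})
      (fun i k => by simpa [Subalgebra.mem_centralizer_iff] using (raise_mul_g2 hA i k).symm) w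
    simpa [Subalgebra.mem_centralizer_iff, eq_comm] using this
  · have := raiseRep_mem hA (S := Subalgebra.centralizer Fq {leftMul d A (e g2inv)})
      (fun i k => by simpa [Subalgebra.mem_centralizer_iff] using (raise_mul_g2inv hA i k).symm) w
    simpa [Subalgebra.mem_centralizer_iff, eq_comm] using this
  · rw [raiseRep_apply hA hu, hw, zero_smul]

lemma algebraMapInv_e (x : Gen N) : FreeAlgebra.algebraMapInv (R := Fq) (e x) = 0 :=
  FreeAlgebra.lift_ι_apply _ _

lemma quadRel_raise (i j : Fin N) : QuadRel (qp d A i j) (raise hA i) (raise hA j) := by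
  intro k l
  rw [← sub_eq_zero]
  have key := raiseRep_eq_zero hA (w := e (xp i (k + 1)) * e (xp j l) +
    e (xp j (l + 1)) * e (xp i k) - qp d A i j • (e (xp j l) * e (xp i (k + 1)) +
      e (xp i k) * e (xp j (l + 1)))) (by simp [algebraMapInv_e]) fun j₀ l₀ => by
    obtain ⟨Ψ, Φ, h1, h2⟩ := exists_biExchange_raise hA j₀ l₀
    have h3 := (h2 i j).quadRel (qp_ne_zero d A i j) l₀ k l
    have h4 := ((h2 j i).quadRel (qp_ne_zero d A j i) l₀).swap k l
    rw [hA.qp_symm j i] at h4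
    simp only [← h1] at h3 h4
    rw [← sub_eq_zero] at h3 h4
    have h5 := congrArg₂ (· + ·) h3 h4
    simp only [add_zero] at h5
    rw [← h5]
    simp only [map_sub, map_add, map_mul, map_smul, raiseRep_xp, sub_mul, mul_sub, add_mul,
      mul_add, smul_mul_assoc, mul_smul_comm, smul_add, smul_sub, mul_assoc]
    abel
  simpa only [map_sub, map_add, map_mul, map_smul, raiseRep_xp] using key

/-- The homomorphism `a ↦ a + ε [a, X]`. -/
def commDual {R : Type*} [Ring R] [Algebra Fq R] (X : R) : R →ₐ[Fq] DualNumber R where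
  toFun a := dual a (a * X - X * a)
  map_one' := by ext <;> simp
  map_zero' := by ext <;> simp
  map_mul' a b := by
    ext
    · simp
    · simp [mul_sub, sub_mul, mul_assoc]
  map_add' a b := by
    ext
    · simp
    · simp [mul_add, add_mul]; abel
  commutes' r := by
    ext
    · simp [TrivSqZeroExt.algebraMap_eq_inl']
    · simp [TrivSqZeroExt.algebraMap_eq_inl', (Algebra.commutes r X)]

lemma serreSum_raise {i j : Fin N} (hij : i ≠ j) (ks : Fin (1 - A i j).toNat → ℤ) (l : ℤ) :
    serreSum d A (raise hA) i j ks l = 0 := by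
  have hoff := hA.off i j hij
  have hmap := fun {S : Type} [Ring S] [Algebra Fq S] (F : FA N →ₐ[Fq] S) =>
    map_serre_sum F (d := d) (A := A) true i j ks l
  simp only [if_true] at hmap
  have key := raiseRep_eq_zero hA (w := ∑ σ : Equiv.Perm (Fin (1 - A i j).toNat),
    ∑ r ∈ Finset.range ((1 - A i j).toNat + 1),
      ((-1 : Fq) ^ r * qbinom d i (1 - A i j).toNat r) •
        dsTerm true i j (1 - A i j).toNat ks l σ r)
    (by rw [hmap]; simp [algebraMapInv_e, serreSum, insertProd]) fun j₀ l₀ => by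
    obtain ⟨Ψ, Φ, h1, h2⟩ := exists_biExchange_raise hA j₀ l₀
    have h3 := snd_serreSum_dual (quadRel_raise hA) h2 hA.qp_symm hoff
      (by simpa only [inv_inv] using (serreCoeff_qbinom (hA.pos i) (hA.diag i) hoff).inv) ks l₀ l
    simp only [← h1] at h3
    have h4 := hmap ((commDual (leftMul d A (e (xm j₀ l₀)))).comp (raiseRep hA))
    simp only [AlgHom.comp_apply, raiseRep_xp] at h4
    exact (congrArg TrivSqZeroExt.snd h4).trans h3
  rw [hmap] at key
  simpa only [raiseRep_xp] using key

end FockRepresentation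

section Independence

attribute [local instance] natAlgebraFq intAlgebraFq

variable {N : ℕ} {d : Fin N → ℤ} {A : Fin N → Fin N → ℤ}

/-- The subalgebra generated by the generators other than the `x^+_{i,r}`. -/
def xpFree (N : ℕ) : Subalgebra Fq (FA N) :=
  Algebra.adjoin Fq {w | ∃ x : Gen N, (∀ i r, x ≠ xp i r) ∧ e x = w}

lemma e_mem_xpFree {x : Gen N} (hx : ∀ i r, x ≠ xp i r) : e x ∈ xpFree N :=
  Algebra.subset_adjoin ⟨x, hx, rfl⟩

lemma eqOn_xpFree {R : Type*} [Ring R] [Algebra Fq R] {F F' : FA N →ₐ[Fq] R}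
    (hF : ∀ x, (∀ i r, x ≠ xp i r) → F (e x) = F' (e x)) {w : FA N} (hw : w ∈ xpFree N) :
    F w = F' w := by
  have : xpFree N ≤ AlgHom.equalizer F F' := Algebra.adjoin_le (by
    rintro _ ⟨x, hx, rfl⟩
    exact hF x hx)
  exact this hw

lemma gammaHalf_mem_xpFree (m : ℤ) : gammaHalf m ∈ xpFree N :=
  gammaHalf_mem (e_mem_xpFree (by simp)) (e_mem_xpFree (by simp)) m

lemma Ppos_mem_xpFree (i : Fin N) (p : ℕ) : Ppos d i p ∈ xpFree N := by
  induction p using Nat.strong_induction_on with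
  | _ p ih =>
    cases p with
    | zero => rw [Ppos]; exact one_mem _
    | succ p =>
      rw [Ppos]
      exact Subalgebra.smul_mem _ (sum_mem fun l _ => Subalgebra.smul_mem _
        (mul_mem (e_mem_xpFree (by simp)) (ih _ (by omega))) _) _

lemma Pneg_mem_xpFree (i : Fin N) (p : ℕ) : Pneg d i p ∈ xpFree N := by
  induction p using Nat.strong_induction_on with
  | _ p ih =>
    cases p with
    | zero => rw [Pneg]; exact one_mem _
    | succ p =>
      rw [Pneg]
      exact Subalgebra.smul_mem _ (sum_mem fun l _ => Subalgebra.smul_mem _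
        (mul_mem (e_mem_xpFree (by simp)) (ih _ (by omega))) _) _

lemma psiEl_mem_xpFree (i : Fin N) (m : ℤ) : psiEl d i m ∈ xpFree N := by
  rw [psiEl]
  split_ifs
  exacts [mul_mem (e_mem_xpFree (by simp)) (Ppos_mem_xpFree i _), zero_mem _]

lemma phiEl_mem_xpFree (i : Fin N) (m : ℤ) : phiEl d i m ∈ xpFree N := by
  rw [phiEl]
  split_ifs
  exacts [mul_mem (e_mem_xpFree (by simp)) (Pneg_mem_xpFree i _), zero_mem _]

lemma crossEl_mem_xpFree (i : Fin N) (k l : ℤ) : crossEl d i k l ∈ xpFree N :=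
  Subalgebra.smul_mem _ (sub_mem (mul_mem (gammaHalf_mem_xpFree _) (psiEl_mem_xpFree i _))
    (mul_mem (gammaHalf_mem_xpFree _) (phiEl_mem_xpFree i _))) _

variable (hA : IsSymmCartan d A)

/-- The action of the free algebra on `BorelAlg`, with the `x^+_{i,r}` acting by the raising
operators. -/
def fockRep : FA N →ₐ[Fq] Module.End Fq (BorelAlg d A) :=
  FreeAlgebra.lift Fq fun x => match x with
    | .xp i k => raise hA i k
    | x => leftMul d A (e x)

lemma fockRep_xp (i : Fin N) (k : ℤ) : fockRep hA (e (xp i k)) = raise hA i k :=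
  FreeAlgebra.lift_ι_apply _ _

lemma fockRep_of_ne {x : Gen N} (hx : ∀ i r, x ≠ xp i r) :
    fockRep hA (e x) = leftMul d A (e x) := by
  rw [fockRep]
  refine (FreeAlgebra.lift_ι_apply _ _).trans ?_
  cases x <;> first | rfl | exact absurd rfl (hx _ _)

lemma fockRep_eq {w : FA N} (hw : w ∈ xpFree N) : fockRep hA w = leftMul d A w :=
  eqOn_xpFree (fun _ hx => fockRep_of_ne hA hx) hw

lemma fockRep_rel {a b : FA N} (hab : QRel N d A a b) : fockRep hA a = fockRep hA b := by
  have hB := leftMul_respectsB (d := d) (A := A)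
  have hne : ∀ {x : Gen N}, (∀ i r, x ≠ xp i r) → fockRep hA (e x) = leftMul d A (e x) :=
    fockRep_of_ne hA
  have hg := fun m => fockRep_eq hA (gammaHalf_mem_xpFree m)
  have hgp : ∀ m, fockRep hA (gammaPow m) = leftMul d A (gammaPow m) := fun m => hg _
  have hK := fun i : Fin N => hne (x := K i) (by simp)
  have hKinv := fun i : Fin N => hne (x := Kinv i) (by simp)
  have hD := hne (x := D) (by simp)
  have hDinv := hne (x := Dinv) (by simp)
  have hg2 := hne (x := g2) (by simp)
  have hg2inv := hne (x := g2inv) (by simp)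
  have hh := fun (i : Fin N) s => hne (x := Gen.h i s) (by simp)
  have hxm := fun (i : Fin N) s => hne (x := xm i s) (by simp)
  have hxp := fockRep_xp hA
  cases hab with
  | K_Kinv i => simpa only [map_mul, hK, hKinv, map_one] using hB _ _ (.K_Kinv i)
  | Kinv_K i => simpa only [map_mul, hK, hKinv, map_one] using hB _ _ (.Kinv_K i)
  | D_Dinv => simpa only [map_mul, hD, hDinv, map_one] using hB _ _ .D_Dinv
  | Dinv_D => simpa only [map_mul, hD, hDinv, map_one] using hB _ _ .Dinv_D
  | g_ginv => simpa only [map_mul, hg2, hg2inv, map_one] using hB _ _ .g_ginv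
  | ginv_g => simpa only [map_mul, hg2, hg2inv, map_one] using hB _ _ .ginv_g
  | g2_comm x =>
    by_cases hx : ∀ i r, x ≠ xp i r
    · simpa only [map_mul, hg2, hne hx] using hB _ _ (.g2_comm x)
    · push Not at hx
      obtain ⟨i, r, rfl⟩ := hx
      rw [map_mul, map_mul, hxp, hg2, raise_mul_g2]
  | g2inv_comm x =>
    by_cases hx : ∀ i r, x ≠ xp i r
    · simpa only [map_mul, hg2inv, hne hx] using hB _ _ (.g2inv_comm x)
    · push Not at hx
      obtain ⟨i, r, rfl⟩ := hx
      rw [map_mul, map_mul, hxp, hg2inv, raise_mul_g2inv]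
  | K_comm_K i j => simpa only [map_mul, hK] using hB _ _ (.K_comm_K i j)
  | K_comm_D i => simpa only [map_mul, hK, hD] using hB _ _ (.K_comm_D i)
  | K_comm_h i j s => simpa only [map_mul, hK, hh] using hB _ _ (.K_comm_h i j s)
  | h_zero i => simpa only [hh, map_zero] using hB _ _ (.h_zero i)
  | D_h i s => simpa only [map_mul, map_smul, hD, hDinv, hh] using hB _ _ (.D_h i s)
  | D_xp i r =>
    rw [map_mul, map_mul, map_smul, hxp, hD, hDinv, mul_assoc, raise_mul_Dinv, mul_smul_comm,
      ← mul_assoc, hB.D_mul_Dinv, one_mul]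
  | D_xm i r => simpa only [map_mul, map_smul, hD, hDinv, hxm] using hB _ _ (.D_xm i r)
  | K_xp i j r =>
    rw [map_mul, map_mul, map_smul, hxp, hK, hKinv, mul_assoc, raise_mul_Kinv, mul_smul_comm,
      ← mul_assoc, hB.K_mul_Kinv, one_mul]
  | K_xm i j r => simpa only [map_mul, map_smul, hK, hKinv, hxm] using hB _ _ (.K_xm i j r)
  | h_h i j k l hk hl =>
    have := hB _ _ (.h_h i j k l hk hl)
    rw [apply_ite (fockRep hA)]
    rw [apply_ite (leftMul d A)] at this
    simpa only [map_mul, map_sub, map_smul, map_zero, hgp, hh] using this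
  | h_xp i j k l hk =>
    rw [map_sub, map_mul, map_mul, map_smul, map_mul, hh, hxp, hg, hxp, raise_mul_h,
      sub_sub_cancel, add_comm]
  | h_xm i j k l hk =>
    simpa only [map_mul, map_sub, map_smul, hg, hh, hxm] using hB _ _ (.h_xm i j k l hk)
  | serre_p i j k l =>
    have := quadRel_raise hA i j k l
    simp only [map_sub, map_mul, map_smul, hxp]
    rw [smul_add, ← sub_eq_zero] at this
    rw [← sub_eq_zero, ← this]
    abel
  | serre_m i j k l =>
    simpa only [map_mul, map_sub, map_smul, hxm] using hB _ _ (.serre_m i j k l)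
  | xp_xm i j k l =>
    rw [apply_ite (fockRep hA), map_sub, map_mul, map_mul, hxp, hxm, raise_mul_xm,
      add_sub_cancel_left, map_zero]
    split_ifs with hij
    · exact (fockRep_eq hA (crossEl_mem_xpFree i k l)).symm
    · rfl
  | dserre pm i j hij ks l =>
    rw [map_serre_sum, map_zero]
    cases pm with
    | true =>
      simp only [if_true, hxp]
      exact serreSum_raise hA hij ks l
    | false =>
      have := hB _ _ (.dserre i j hij ks l)
      rw [map_serre_sum, map_zero] at this
      simpa [hxm] using this

/-- The representation of `U_q` on `BorelAlg`. -/
def uqRep : Uq N d A →ₐ[Fq] Module.End Fq (BorelAlg d A) :=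
  RingQuot.liftAlgHom Fq ⟨fockRep hA, fun _ _ hab => fockRep_rel hA hab⟩

variable (d A) in
/-- The quotient map onto `U_q`. -/
def uqMk : FA N →ₐ[Fq] Uq N d A := RingQuot.mkAlgHom Fq (QRel N d A)

lemma uqMk_rel {a b : FA N} (hab : QRel N d A a b) : uqMk d A a = uqMk d A b :=
  RingQuot.mkAlgHom_rel Fq hab

lemma uqMk_respectsB : RespectsB d A (uqMk d A) := fun _ _ hab => uqMk_rel hab.toQRel

lemma uqRep_uqMk {w : FA N} (hw : w ∈ xpFree N) : uqRep hA (uqMk d A w) 1 = borelMk d A w := by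
  rw [uqRep, uqMk, RingQuot.liftAlgHom_mkAlgHom_apply, fockRep_eq hA hw, leftMul_apply, mul_one]

variable (d A) in
/-- The homomorphism rescaling the `K_i` by `c` and killing the `x^+_{i,r}`. -/
def scaleHom (c : Fq) : FA N →ₐ[Fq] Uq N d A :=
  FreeAlgebra.lift Fq fun x => match x with
    | .xp _ _ => 0
    | .K i => c • uqMk d A (e (K i))
    | .Kinv i => c⁻¹ • uqMk d A (e (Kinv i))
    | x => uqMk d A (e x)

section
variable (c : Fq)

lemma scaleHom_xp (i : Fin N) (r : ℤ) : scaleHom d A c (e (xp i r)) = 0 :=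
  FreeAlgebra.lift_ι_apply _ _

lemma scaleHom_K (i : Fin N) : scaleHom d A c (e (K i)) = c • uqMk d A (e (K i)) :=
  FreeAlgebra.lift_ι_apply _ _

lemma scaleHom_Kinv (i : Fin N) : scaleHom d A c (e (Kinv i)) = c⁻¹ • uqMk d A (e (Kinv i)) :=
  FreeAlgebra.lift_ι_apply _ _

lemma scaleHom_D : scaleHom d A c (e D) = uqMk d A (e D) := FreeAlgebra.lift_ι_apply _ _

lemma scaleHom_Dinv : scaleHom d A c (e Dinv) = uqMk d A (e Dinv) := FreeAlgebra.lift_ι_apply _ _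

lemma scaleHom_g2 : scaleHom d A c (e g2) = uqMk d A (e g2) := FreeAlgebra.lift_ι_apply _ _

lemma scaleHom_g2inv : scaleHom d A c (e g2inv) = uqMk d A (e g2inv) :=
  FreeAlgebra.lift_ι_apply _ _

lemma scaleHom_h (i : Fin N) (s : ℤ) : scaleHom d A c (e (Gen.h i s)) = uqMk d A (e (Gen.h i s)) :=
  FreeAlgebra.lift_ι_apply _ _

lemma scaleHom_xm (i : Fin N) (s : ℤ) : scaleHom d A c (e (xm i s)) = uqMk d A (e (xm i s)) :=
  FreeAlgebra.lift_ι_apply _ _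

lemma scaleHom_gammaHalf (m : ℤ) : scaleHom d A c (gammaHalf m) = uqMk d A (gammaHalf m) := by
  rw [gammaHalf]
  split_ifs <;> simp only [map_pow, scaleHom_g2, scaleHom_g2inv]

lemma scaleHom_psiEl (i : Fin N) (m : ℤ) :
    scaleHom d A c (psiEl d i m) = c • uqMk d A (psiEl d i m) := by
  have hP : ∀ p, scaleHom d A c (Ppos d i p) = uqMk d A (Ppos d i p) := fun p => by
    induction p using Nat.strong_induction_on with
    | _ p ih =>
      cases p with
      | zero => simp [Ppos]
      | succ p =>
        simp only [Ppos, map_smul, map_sum, map_mul, scaleHom_h]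
        congr 1
        exact Finset.sum_congr rfl fun l _ => by rw [ih _ (by omega)]
  rw [psiEl]
  split_ifs
  · rw [map_mul, map_mul, hP, scaleHom_K, smul_mul_assoc]
  · simp

lemma scaleHom_phiEl (i : Fin N) (m : ℤ) :
    scaleHom d A c (phiEl d i m) = c⁻¹ • uqMk d A (phiEl d i m) := by
  have hP : ∀ p, scaleHom d A c (Pneg d i p) = uqMk d A (Pneg d i p) := fun p => by
    induction p using Nat.strong_induction_on with
    | _ p ih =>
      cases p with
      | zero => simp [Pneg]
      | succ p =>
        simp only [Pneg, map_smul, map_sum, map_mul, scaleHom_h]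
        congr 1
        exact Finset.sum_congr rfl fun l _ => by rw [ih _ (by omega)]
  rw [phiEl]
  split_ifs
  · rw [map_mul, map_mul, hP, scaleHom_Kinv, smul_mul_assoc]
  · simp

lemma scaleHom_rel {c : Fq} (hc : c ≠ 0) {a b : FA N} (hab : BRel N d A a b) :
    scaleHom d A c a = scaleHom d A c b := by
  have hB := uqMk_respectsB (d := d) (A := A)
  have hgp : ∀ m, scaleHom d A c (gammaPow m) = uqMk d A (gammaPow m) :=
    fun m => scaleHom_gammaHalf c _
  cases hab with
  | K_Kinv i =>
    rw [map_mul, scaleHom_K, scaleHom_Kinv, smul_mul_smul_comm, mul_inv_cancel₀ hc,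
      hB.K_mul_Kinv, one_smul, map_one]
  | Kinv_K i =>
    rw [map_mul, scaleHom_K, scaleHom_Kinv, smul_mul_smul_comm, inv_mul_cancel₀ hc,
      hB.Kinv_mul_K, one_smul, map_one]
  | D_Dinv => rw [map_mul, scaleHom_D, scaleHom_Dinv, hB.D_mul_Dinv, map_one]
  | Dinv_D => rw [map_mul, scaleHom_D, scaleHom_Dinv, hB.Dinv_mul_D, map_one]
  | g_ginv => rw [map_mul, scaleHom_g2, scaleHom_g2inv, hB.gammaCentral.mul_inv, map_one]
  | ginv_g => rw [map_mul, scaleHom_g2, scaleHom_g2inv, hB.gammaCentral.inv_mul, map_one]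
  | g2_comm x =>
    have := hB _ _ (.g2_comm x)
    rw [map_mul, map_mul] at this
    cases x <;> simp only [map_mul, scaleHom_g2, scaleHom_xp, scaleHom_K, scaleHom_Kinv,
      scaleHom_D, scaleHom_Dinv, scaleHom_g2inv, scaleHom_h, scaleHom_xm, mul_zero, zero_mul,
      mul_smul_comm, smul_mul_assoc, this]
  | g2inv_comm x =>
    have := hB _ _ (.g2inv_comm x)
    rw [map_mul, map_mul] at this
    cases x <;> simp only [map_mul, scaleHom_g2, scaleHom_xp, scaleHom_K, scaleHom_Kinv,
      scaleHom_D, scaleHom_Dinv, scaleHom_g2inv, scaleHom_h, scaleHom_xm, mul_zero, zero_mul,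
      mul_smul_comm, smul_mul_assoc, this]
  | K_comm_K i j =>
    simp only [map_mul, scaleHom_K, smul_mul_smul_comm, (hB.K_commute_K i j).eq]
  | K_comm_D i =>
    simp only [map_mul, scaleHom_K, scaleHom_D, smul_mul_assoc, mul_smul_comm,
      (hB.K_commute_D i).eq]
  | K_comm_h i j s =>
    simp only [map_mul, scaleHom_K, scaleHom_h, smul_mul_assoc, mul_smul_comm,
      (hB.K_commute_h i j s).eq]
  | h_zero i => simpa only [scaleHom_h, map_zero] using hB _ _ (.h_zero i)
  | D_h i s =>
    simpa only [map_mul, map_smul, scaleHom_D, scaleHom_Dinv, scaleHom_h] using hB _ _ (.D_h i s)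
  | D_xm i r =>
    simpa only [map_mul, map_smul, scaleHom_D, scaleHom_Dinv, scaleHom_xm]
      using hB _ _ (.D_xm i r)
  | K_xm i j r =>
    rw [map_mul, map_mul, map_smul, scaleHom_K, scaleHom_Kinv, scaleHom_xm, smul_mul_assoc,
      smul_mul_smul_comm, mul_inv_cancel₀ hc, one_smul]
    simpa only [map_mul, map_smul] using hB _ _ (.K_xm i j r)
  | h_h i j k l hk hl =>
    have := hB _ _ (.h_h i j k l hk hl)
    rw [apply_ite (scaleHom d A c)]
    rw [apply_ite (uqMk d A)] at this
    simpa only [map_mul, map_sub, map_smul, map_zero, hgp, scaleHom_h] using this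
  | h_xm i j k l hk =>
    simpa only [map_mul, map_sub, map_smul, scaleHom_gammaHalf, scaleHom_h, scaleHom_xm]
      using hB _ _ (.h_xm i j k l hk)
  | serre_m i j k l =>
    simpa only [map_mul, map_sub, map_smul, scaleHom_xm] using hB _ _ (.serre_m i j k l)
  | dserre i j hij ks l =>
    have := hB _ _ (.dserre i j hij ks l)
    rw [map_serre_sum, map_zero] at this ⊢
    simpa only [scaleHom_xm, Bool.false_eq_true, if_false] using this

end

/-- The homomorphism induced by `scaleHom` on `BorelAlg`. -/
def borelScale {c : Fq} (hc : c ≠ 0) : BorelAlg d A →ₐ[Fq] Uq N d A :=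
  RingQuot.liftAlgHom Fq ⟨scaleHom d A c, fun a b hab => by
    cases hab with
    | of hab => exact scaleHom_rel hc hab
    | xp i r => rw [scaleHom_xp, map_zero]⟩

include hA in
/-- `scaleHom` descends from the subalgebra `xpFree` to its image in `U_q`. -/
lemma exists_scale {c : Fq} (hc : c ≠ 0) : ∃ θ : Uq N d A →ₗ[Fq] Uq N d A,
    ∀ w ∈ xpFree N, θ (uqMk d A w) = scaleHom d A c w :=
  ⟨(borelScale hc).toLinearMap ∘ₗ LinearMap.applyₗ 1 ∘ₗ (uqRep hA).toLinearMap, fun _ hw =>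
    (congrArg (borelScale hc) (uqRep_uqMk hA hw)).trans (RingQuot.liftAlgHom_mkAlgHom_apply ..)⟩

end Independence

section HalfSum

variable {R : Type*} [Ring R]

/-- `X` is the sum `∑_{p ≥ 0} Ψ_p T_{k-p}`, of which only finitely many terms are nonzero because
`T_{k-p} = 0` for large `p`. -/
def HalfSum (Ψ : ℕ → R) (T : ℤ → R) (k : ℤ) (X : R) : Prop :=
  ∃ M : ℕ, (∀ p : ℕ, M < p → T (k - p) = 0) ∧ X = ∑ p ∈ Finset.range (M + 1), Ψ p * T (k - p)

namespace HalfSum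

variable {Ψ : ℕ → R} {T T₁ T₂ : ℤ → R} {k : ℤ} {X X₁ X₂ : R}

lemma sum_range_eq {M : Type*} [AddCommMonoid M] {f : ℕ → M} {m n : ℕ} (hm : ∀ p, m < p → f p = 0)
    (hn : ∀ p, n < p → f p = 0) :
    ∑ p ∈ Finset.range (m + 1), f p = ∑ p ∈ Finset.range (n + 1), f p := by
  have key : ∀ {m n : ℕ}, m ≤ n → (∀ p, m < p → f p = 0) →
      ∑ p ∈ Finset.range (m + 1), f p = ∑ p ∈ Finset.range (n + 1), f p := fun hmn h0 =>
    Finset.sum_subset (Finset.range_subset_range.2 (by omega)) fun p _ hp =>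
      h0 p (by simp only [Finset.mem_range] at hp; omega)
  rcases le_total m n with hmn | hmn
  exacts [key hmn hm, (key hmn hn).symm]

lemma eq_sum (hX : HalfSum Ψ T k X) {n : ℕ} (hn : ∀ p : ℕ, n < p → T (k - p) = 0) :
    X = ∑ p ∈ Finset.range (n + 1), Ψ p * T (k - p) := by
  obtain ⟨M, hM, rfl⟩ := hX
  exact sum_range_eq (fun p hp => by rw [hM p hp, mul_zero]) fun p hp => by rw [hn p hp, mul_zero]

lemma congr (hX : HalfSum Ψ T₁ k X) (hT : ∀ m, T₁ m = T₂ m) : HalfSum Ψ T₂ k X :=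
  funext hT ▸ hX

lemma add (h₁ : HalfSum Ψ T₁ k X₁) (h₂ : HalfSum Ψ T₂ k X₂) :
    HalfSum Ψ (T₁ + T₂) k (X₁ + X₂) := by
  obtain ⟨M₁, hM₁, -⟩ := id h₁
  obtain ⟨M₂, hM₂, -⟩ := id h₂
  have e₁ := h₁.eq_sum (n := max M₁ M₂) fun p hp => hM₁ p (by omega)
  have e₂ := h₂.eq_sum (n := max M₁ M₂) fun p hp => hM₂ p (by omega)
  refine ⟨max M₁ M₂, fun p hp => ?_, ?_⟩
  · rw [Pi.add_apply, hM₁ p (by omega), hM₂ p (by omega), add_zero]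
  · simp only [Pi.add_apply, mul_add, Finset.sum_add_distrib, ← e₁, ← e₂]

lemma neg (h₁ : HalfSum Ψ T k X) : HalfSum Ψ (-T) k (-X) := by
  obtain ⟨M, hM, rfl⟩ := h₁
  exact ⟨M, fun p hp => by rw [Pi.neg_apply, hM p hp, neg_zero], by simp⟩

lemma sub (h₁ : HalfSum Ψ T₁ k X₁) (h₂ : HalfSum Ψ T₂ k X₂) :
    HalfSum Ψ (T₁ - T₂) k (X₁ - X₂) := by
  rw [sub_eq_add_neg, sub_eq_add_neg]
  exact h₁.add h₂.neg

lemma central_mul (h₁ : HalfSum Ψ T k X) {z : R} (hz : ∀ p, Commute z (Ψ p)) :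
    HalfSum Ψ (fun m => z * T m) k (z * X) := by
  obtain ⟨M, hM, rfl⟩ := h₁
  refine ⟨M, fun p hp => by simp only [hM p hp, mul_zero], ?_⟩
  rw [Finset.mul_sum]
  exact Finset.sum_congr rfl fun p _ => by rw [← mul_assoc, (hz p).eq, mul_assoc]

lemma single {l : ℤ} {y : R} (hX : X = extZ Ψ (k - l) * y) :
    HalfSum Ψ (fun m => if m = l then y else 0) k X := by
  refine ⟨(k - l).toNat, fun p hp => if_neg (by omega), ?_⟩
  rw [hX, extZ]
  split_ifs with hkl
  · rw [Finset.sum_eq_single (k - l).toNat]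
    · beta_reduce
      rw [if_pos (by omega)]
    · intro p _ hp
      beta_reduce
      rw [if_neg (by omega), mul_zero]
    · simp
  · rw [zero_mul]
    exact (Finset.sum_eq_zero fun p _ => by
      beta_reduce
      rw [if_neg (by omega), mul_zero]).symm

/-- Left multiplication by an element which is moved past the `Ψ_p`. -/
lemma mul_left (hX : HalfSum Ψ T k X) {b : ℤ} (hb : ∀ m ≤ b, T m = 0) {x : R} {Y : ℕ → R}
    (hx : ∀ p, x * Ψ p = ∑ r ∈ Finset.range (p + 1), Ψ (p - r) * Y r) :
    HalfSum Ψ (fun m => ∑ r ∈ Finset.range ((m - b).toNat + 1), Y r * T (m - r)) k (x * X) := by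
  have hk : ∀ p : ℕ, (k - b).toNat < p → T (k - p) = 0 := fun p hp => hb _ (by omega)
  refine ⟨(k - b).toNat, fun p hp => Finset.sum_eq_zero fun r _ => ?_, ?_⟩
  · rw [hb _ (by omega), mul_zero]
  rw [hX.eq_sum hk]
  simp only [Finset.mul_sum, ← mul_assoc, hx, Finset.sum_mul]
  rw [Finset.sum_sigma', Finset.sum_sigma']
  refine Finset.sum_bij_ne_zero (fun a _ _ => ⟨a.1 - a.2, a.2⟩) ?_ ?_ ?_ ?_
  · rintro ⟨p, r⟩ hpr -
    simp only [Finset.mem_sigma, Finset.mem_range] at hpr ⊢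
    omega
  · rintro ⟨p, r⟩ hpr - ⟨p', r'⟩ hpr' - heq
    simp only [Finset.mem_sigma, Finset.mem_range, Sigma.mk.injEq, heq_eq_eq] at hpr hpr' heq ⊢
    omega
  · rintro ⟨s, r⟩ hsr hne
    simp only [Finset.mem_sigma, Finset.mem_range] at hsr
    have hle : s + r ≤ (k - b).toNat := by
      by_contra hlt
      exact hne (by rw [hb _ (by omega), mul_zero])
    refine ⟨⟨s + r, r⟩, ?_, ?_, ?_⟩
    · simp only [Finset.mem_sigma, Finset.mem_range]; omega
    · rwa [Nat.add_sub_cancel, Nat.cast_add, ← sub_sub]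
    · simp
  · rintro ⟨p, r⟩ hpr -
    simp only [Finset.mem_sigma, Finset.mem_range] at hpr ⊢
    rw [show k - ((p - r : ℕ) : ℤ) - r = k - p by omega]

lemma eq_zero (hT : ∀ k, HalfSum Ψ T k 0) {b : ℤ} (hb : ∀ m ≤ b, T m = 0) {u : R}
    (hu : u * Ψ 0 = 1) (m : ℤ) : T m = 0 := by
  have key : ∀ n : ℕ, ∀ m ≤ b + n, T m = 0 := fun n => by
    induction n with
    | zero => simpa using hb
    | succ n ih =>
      intro m hm
      have h1 := (hT m).eq_sum (n := 0) fun p hp => ih _ (by push_cast at hm; omega)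
      rw [zero_add, Finset.sum_range_one, Nat.cast_zero, sub_zero] at h1
      rw [← one_mul (T m), ← hu, mul_assoc, ← h1, mul_zero]
  exact key (m - b).toNat m (by omega)

end HalfSum

end HalfSum

section Uniqueness

attribute [local instance] natAlgebraFq intAlgebraFq

variable {N : ℕ} {d : Fin N → ℤ} {A : Fin N → Fin N → ℤ}

lemma gU_add (m n : ℤ) : gU d A (m + n) = gU d A m * gU d A n :=
  uqMk_respectsB.gammaCentral.map_add m n

lemma gU_zero : gU d A 0 = 1 := by
  change uqMk d A (gammaHalf 0) = 1
  rw [gammaHalf_zero, map_one]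

lemma commute_gU (m : ℤ) (X : Uq N d A) : Commute (gU d A m) X := by
  obtain ⟨w, rfl⟩ := RingQuot.mkAlgHom_surjective Fq (QRel N d A) X
  exact (uqMk_respectsB (d := d) (A := A)).gammaCentral.commute_gamma m w

lemma exists_lift_mem_Nq {X : Uq N d A} (hX : X ∈ Nq d A) :
    ∃ w ∈ xpFree N, uqMk d A w = X ∧ ∀ c, scaleHom d A c w = X := by
  induction hX using Algebra.adjoin_induction with
  | mem X hX =>
    rcases hX with (rfl | rfl) | ⟨⟨i, r⟩, rfl⟩
    · exact ⟨e g2, e_mem_xpFree (by simp), rfl, fun c => scaleHom_g2 c⟩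
    · exact ⟨e g2inv, e_mem_xpFree (by simp), rfl, fun c => scaleHom_g2inv c⟩
    · exact ⟨e (xm i r), e_mem_xpFree (by simp), rfl, fun c => scaleHom_xm c i r⟩
  | algebraMap a =>
    exact ⟨algebraMap _ _ a, Subalgebra.algebraMap_mem _ _, AlgHom.commutes _ _,
      fun c => AlgHom.commutes _ _⟩
  | add X Y _ _ hX hY =>
    obtain ⟨w, hw, rfl, hw'⟩ := hX
    obtain ⟨v, hv, rfl, hv'⟩ := hY
    exact ⟨w + v, add_mem hw hv, map_add _ _ _, fun c => by rw [map_add, hw', hv']⟩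
  | mul X Y _ _ hX hY =>
    obtain ⟨w, hw, rfl, hw'⟩ := hX
    obtain ⟨v, hv, rfl, hv'⟩ := hY
    exact ⟨w * v, mul_mem hw hv, map_mul _ _ _, fun c => by rw [map_mul, hw', hv']⟩

variable (d A) in
/-- `ψ_{i,p} γ^{p/2}`. -/
def psiHat (i : Fin N) (p : ℕ) : Uq N d A := psiU d A i p * gU d A p

variable (d A) in
/-- `φ_{i,-p} γ^{p/2}`. -/
def phiHat (i : Fin N) (p : ℕ) : Uq N d A := phiU d A i (-(p : ℤ)) * gU d A p

lemma HalfSum.exists_lift {Ψ : ℕ → Uq N d A} {a : Fq → Fq}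
    (hΨ : ∀ p, ∃ w ∈ xpFree N, uqMk d A w = Ψ p ∧ ∀ c, scaleHom d A c w = a c • Ψ p)
    {T : ℤ → Uq N d A} (hT : ∀ m, T m ∈ Nq d A) {k : ℤ} {X : Uq N d A} (hX : HalfSum Ψ T k X) :
    ∃ w ∈ xpFree N, uqMk d A w = X ∧ ∀ c, scaleHom d A c w = a c • X := by
  obtain ⟨M, -, rfl⟩ := hX
  choose w hw hw1 hw2 using hΨ
  choose v hv hv1 hv2 using fun m => exists_lift_mem_Nq (hT m)
  refine ⟨∑ p ∈ Finset.range (M + 1), w p * v (k - p),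
    sum_mem fun p _ => mul_mem (hw p) (hv _), ?_, fun c => ?_⟩
  · simp only [map_sum, map_mul, hw1, hv1]
  · simp only [map_sum, map_mul, hw2, hv2, Finset.smul_sum, smul_mul_assoc]

lemma psiHat_lift (i : Fin N) (p : ℕ) : ∃ w ∈ xpFree N, uqMk d A w = psiHat d A i p ∧
    ∀ c, scaleHom d A c w = c • psiHat d A i p :=
  ⟨psiEl d i p * gammaHalf p, mul_mem (psiEl_mem_xpFree _ _) (gammaHalf_mem_xpFree _),
    map_mul _ _ _, fun c => by
      rw [map_mul, scaleHom_psiEl, scaleHom_gammaHalf, smul_mul_assoc]; rfl⟩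

lemma phiHat_lift (i : Fin N) (p : ℕ) : ∃ w ∈ xpFree N, uqMk d A w = phiHat d A i p ∧
    ∀ c, scaleHom d A c w = c⁻¹ • phiHat d A i p :=
  ⟨phiEl d i (-(p : ℤ)) * gammaHalf p, mul_mem (phiEl_mem_xpFree _ _) (gammaHalf_mem_xpFree _),
    map_mul _ _ _, fun c => by
      rw [map_mul, scaleHom_phiEl, scaleHom_gammaHalf, smul_mul_assoc]; rfl⟩

lemma eq_zero_of_inv_smul_eq_smul {F M : Type*} [Field F] [AddCommGroup M] [Module F M] {c : F}
    (hc : c - c⁻¹ ≠ 0) {X : M} (hX : c⁻¹ • X = c • X) : X = 0 :=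
  (smul_eq_zero.1 (show (c - c⁻¹) • X = 0 by rw [sub_smul, hX, sub_self])).resolve_left hc

lemma HalfSum.eq_zero_of_eq (hA : IsSymmCartan d A) {i : Fin N} {T T' : ℤ → Uq N d A}
    (hT : ∀ m, T m ∈ Nq d A) (hT' : ∀ m, T' m ∈ Nq d A) {k l : ℤ} {X : Uq N d A}
    (hX : HalfSum (psiHat d A i) T k X) (hX' : HalfSum (phiHat d A i) T' l X) : X = 0 := by
  obtain ⟨θ, hθ⟩ := exists_scale hA (two_ne_zero (α := Fq))
  obtain ⟨w, hw, hw1, hw2⟩ := hX.exists_lift (a := fun c => c) (psiHat_lift i) hT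
  obtain ⟨v, hv, hv1, hv2⟩ := hX'.exists_lift (a := fun c => c⁻¹) (phiHat_lift i) hT'
  have h1 := hθ w hw
  rw [hw1, ← hv1, hθ v hv, hv2, hw2] at h1
  exact eq_zero_of_inv_smul_eq_smul (by norm_num) h1

lemma Kinv_mul_psiHat (i : Fin N) : uqMk d A (e (Kinv i)) * psiHat d A i 0 = 1 := by
  rw [psiHat, Nat.cast_zero, gU_zero, mul_one]
  change uqMk d A (e (Kinv i)) * uqMk d A (psiEl d i 0) = 1
  rw [← map_mul, psiEl, if_pos le_rfl, Int.toNat_zero, Ppos, mul_one, map_mul,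
    uqMk_respectsB.Kinv_mul_K]

lemma K_mul_phiHat (i : Fin N) : uqMk d A (e (K i)) * phiHat d A i 0 = 1 := by
  rw [phiHat, Nat.cast_zero, gU_zero, mul_one, neg_zero]
  change uqMk d A (e (K i)) * uqMk d A (phiEl d i 0) = 1
  rw [← map_mul, phiEl, if_pos le_rfl, neg_zero, Int.toNat_zero, Pneg, mul_one, map_mul,
    uqMk_respectsB.K_mul_Kinv]

/-- The families `T`, `T'` of elements of `N_q^-` describe the commutators `[x^+_{i,k}, P]`. -/
structure IsCommRep (i : Fin N) (P : Uq N d A) (T T' : ℤ → Uq N d A) : Prop where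
  mem : ∀ m, T m ∈ Nq d A
  mem' : ∀ m, T' m ∈ Nq d A
  bdd : ∃ b : ℤ, ∀ m ≤ b, T m = 0
  bdd' : ∃ b : ℤ, ∀ m ≥ b, T' m = 0
  comm : ∀ k : ℤ, ∃ X Y, HalfSum (psiHat d A i) T k X ∧
    HalfSum (phiHat d A i) (fun m => T' (-m)) (-k) Y ∧
      G d A (xp i k) * P - P * G d A (xp i k) = (qi d i - (qi d i)⁻¹)⁻¹ • (X - Y)

lemma IsCommRep.unique (hA : IsSymmCartan d A) {i : Fin N} {P : Uq N d A}
    {T₁ T₂ T₁' T₂' : ℤ → Uq N d A} (h₁ : IsCommRep i P T₁ T₁') (h₂ : IsCommRep i P T₂ T₂') :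
    T₁ = T₂ ∧ T₁' = T₂' := by
  have hc : (qi d i - (qi d i)⁻¹)⁻¹ ≠ 0 := inv_ne_zero (qi_sub_inv_ne_zero (hA.pos i))
  have key : ∀ k, HalfSum (psiHat d A i) (T₁ - T₂) k 0 ∧
      HalfSum (phiHat d A i) ((fun m => T₁' (-m)) - fun m => T₂' (-m)) (-k) 0 := fun k => by
    obtain ⟨X₁, Y₁, hX₁, hY₁, e₁⟩ := h₁.comm k
    obtain ⟨X₂, Y₂, hX₂, hY₂, e₂⟩ := h₂.comm k
    have e₃ : X₁ - Y₁ = X₂ - Y₂ := smul_right_injective _ hc (e₁.symm.trans e₂)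
    have e₄ : Y₁ - Y₂ = X₁ - X₂ := by
      rw [sub_eq_sub_iff_add_eq_add] at e₃ ⊢
      rw [add_comm, ← e₃]
    have hX := hX₁.sub hX₂
    have hY := hY₁.sub hY₂
    rw [e₄] at hY
    have h0 := hX.eq_zero_of_eq hA (fun m => sub_mem (h₁.mem m) (h₂.mem m))
      (fun m => sub_mem (h₁.mem' _) (h₂.mem' _)) hY
    rw [h0] at hX hY
    exact ⟨hX, hY⟩
  obtain ⟨b₁, hb₁⟩ := h₁.bdd
  obtain ⟨b₂, hb₂⟩ := h₂.bdd
  obtain ⟨b₁', hb₁'⟩ := h₁.bdd'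
  obtain ⟨b₂', hb₂'⟩ := h₂.bdd'
  constructor
  · funext m
    refine sub_eq_zero.1 (HalfSum.eq_zero (fun k => (key k).1) (b := min b₁ b₂) (fun m hm => ?_)
      (Kinv_mul_psiHat i) m)
    rw [Pi.sub_apply, hb₁ m (by omega), hb₂ m (by omega), sub_zero]
  · funext m
    have := sub_eq_zero.1 (HalfSum.eq_zero (fun k => neg_neg k ▸ (key (-k)).2)
      (b := min (-b₁') (-b₂')) (fun m hm => ?_) (K_mul_phiHat i) (-m))
    · simpa using this
    · rw [Pi.sub_apply, hb₁' _ (by omega), hb₂' _ (by omega), sub_zero]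

variable {Ωψ Ωφ : Fin N → ℤ → (Nq d A →ₗ[Fq] Nq d A)}

lemma IsOmegaFamily.isCommRep (hfam : IsOmegaFamily d A Ωψ Ωφ) (i : Fin N) (P : Nq d A) :
    IsCommRep i (P : Uq N d A) (fun m => Ωψ i m P) fun m => Ωφ i m P where
  mem m := (Ωψ i m P).2
  mem' m := (Ωφ i m P).2
  bdd := (hfam.1 i P).imp fun b hb m hm => by rw [hb m hm, ZeroMemClass.coe_zero]
  bdd' := (hfam.2.1 i P).imp fun b hb m hm => by rw [hb m hm, ZeroMemClass.coe_zero]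
  comm k := by
    obtain ⟨M, hM, hsum⟩ := hfam.2.2 i k P
    refine ⟨_, _, ⟨M, fun p hp => ?_, rfl⟩, ⟨M, fun p hp => ?_, rfl⟩, hsum.trans ?_⟩
    · beta_reduce; rw [(hM p hp).1, ZeroMemClass.coe_zero]
    · beta_reduce; rw [show -(-k - (p : ℤ)) = k + p by ring, (hM p hp).2, ZeroMemClass.coe_zero]
    · simp only [show ∀ p : ℕ, -(-k - (p : ℤ)) = k + p from fun p => by ring]
      rfl

lemma IsOmegaFamily.eq_of_isCommRep (hA : IsSymmCartan d A) (hfam : IsOmegaFamily d A Ωψ Ωφ)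
    {i : Fin N} {P : Nq d A} {T T' : ℤ → Nq d A}
    (hT : IsCommRep i (P : Uq N d A) (fun m => (T m : Uq N d A)) fun m => (T' m : Uq N d A))
    (m : ℤ) : Ωψ i m P = T m ∧ Ωφ i m P = T' m := by
  obtain ⟨h1, h2⟩ := (hfam.isCommRep i P).unique hA hT
  exact ⟨Subtype.ext (congrFun h1 m), Subtype.ext (congrFun h2 m)⟩

end Uniqueness

section LeftMul

attribute [local instance] natAlgebraFq intAlgebraFq

variable {N : ℕ} {d : Fin N → ℤ} {A : Fin N → Fin N → ℤ}

lemma Exchange.mul_gU_mul {β : Fq} {x : ℤ → Uq N d A} {Ψ Ψ' : ℕ → Uq N d A}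
    (hx : Exchange β x Ψ) (hΨ : ∀ p : ℕ, Ψ' p = gU d A (2 * p) * Ψ p) (m : ℤ) (p : ℕ) :
    x m * Ψ' p = ∑ r ∈ Finset.range (p + 1),
      Ψ' (p - r) * (gcoef β r • (gU d A (2 * r) * x (m + r))) := by
  rw [hΨ, ← mul_assoc, ← (commute_gU _ (x m)).eq, mul_assoc, hx, Finset.mul_sum]
  refine Finset.sum_congr rfl fun r hr => ?_
  rw [Finset.mem_range] at hr
  have h2 : (2 : ℤ) * p = 2 * (p - r : ℕ) + 2 * r := by omega
  rw [hΨ, h2, gU_add, mul_smul_comm, mul_smul_comm]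
  congr 1
  rw [mul_assoc, mul_assoc, ← mul_assoc (gU d A (2 * r)), (commute_gU (2 * (r : ℤ)) _).eq]
  simp only [mul_assoc]

lemma xm_mul_psiHat (hA : IsSymmCartan d A) (i l : Fin N) (t : ℤ) (p : ℕ) :
    G d A (xm l t) * psiHat d A i p = ∑ r ∈ Finset.range (p + 1),
      psiHat d A i (p - r) *
        (gcoef (qp d A i l)⁻¹ r • (gU d A (2 * r) * G d A (xm l (t + r)))) := by
  refine Exchange.mul_gU_mul ((uqMk_respectsB (d := d) (A := A)).biExchange_xm hA.pos i l).1
    (fun p => ?_) t p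
  rw [psiHat, ← (commute_gU _ _).eq, show (p : ℤ) = 2 * p + -1 * p by ring, gU_add, mul_assoc,
    show 2 * (p : ℤ) + -1 * p = p by ring]
  rfl

lemma xm_mul_phiHat (hA : IsSymmCartan d A) (i l : Fin N) (t : ℤ) (p : ℕ) :
    G d A (xm l t) * phiHat d A i p = ∑ r ∈ Finset.range (p + 1),
      phiHat d A i (p - r) *
        (gcoef (qp d A i l) r • (gU d A (2 * r) * G d A (xm l (t - r)))) := by
  have h1 := ((uqMk_respectsB (d := d) (A := A)).biExchange_xm hA.pos i l).2
  rw [inv_inv] at h1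
  have h2 := Exchange.mul_gU_mul (Ψ' := phiHat d A i) h1 (fun p => ?_) (-t) p
  · simp only [neg_neg, neg_add, ← sub_eq_add_neg] at h2
    exact h2
  rw [phiHat, ← (commute_gU _ _).eq]
  nth_rw 1 [show (p : ℤ) = 2 * p + -1 * p by ring]
  rw [gU_add, mul_assoc]
  rfl

lemma xp_mul_xm_sub (i l : Fin N) (k t : ℤ) :
    G d A (xp i k) * G d A (xm l t) - G d A (xm l t) * G d A (xp i k) =
      (qi d i - (qi d i)⁻¹)⁻¹ • ((if i = l then extZ (psiHat d A i) (k + t) * gU d A (-2 * t)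
        else 0)
        - if i = l then extZ (phiHat d A i) (-k - t) * gU d A (2 * t) else 0) := by
  have h1 := uqMk_rel (QRel.xp_xm (d := d) (A := A) i l k t)
  rw [map_sub, map_mul, map_mul] at h1
  refine h1.trans ?_
  split_ifs
  · rw [map_smul, map_sub, map_mul, map_mul]
    congr 2
    · rw [extZ]
      split_ifs with hk
      · rw [psiHat, mul_assoc, ← gU_add, Int.toNat_of_nonneg hk,
          show k + t + -2 * t = k - t by ring]
        exact (commute_gU _ _).eq
      · rw [zero_mul, psiEl, if_neg hk, map_zero, mul_zero]
    · rw [extZ]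
      split_ifs with hk
      · rw [phiHat, mul_assoc, ← gU_add, Int.toNat_of_nonneg hk,
          show -k - t + 2 * t = t - k by ring, show -(-k - t) = k + t by ring]
        exact (commute_gU _ _).eq
      · rw [zero_mul, phiEl, if_neg (by omega), map_zero, mul_zero]
  · rw [map_zero, sub_self, smul_zero]

lemma gU_mem_Nq (m : ℤ) : gU d A m ∈ Nq d A := by
  have h1 : ∀ m, (gN d A m : Uq N d A) = gU d A m := fun m => by
    rw [gN, gU, gammaHalf]
    split_ifs <;> rw [map_pow] <;> rfl
  exact h1 m ▸ (gN d A m).2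

lemma xm_mem_Nq (i : Fin N) (m : ℤ) : G d A (xm i m) ∈ Nq d A := (xmN d A i m).2

lemma IsCommRep.xm_mul (hA : IsSymmCartan d A) {i : Fin N} {P : Uq N d A} {T T' : ℤ → Uq N d A}
    (hP : P ∈ Nq d A) (hT : IsCommRep i P T T') {b b' : ℤ} (hb : ∀ m ≤ b, T m = 0)
    (hb' : ∀ m ≥ b', T' m = 0) (l : Fin N) (t : ℤ) :
    IsCommRep i (G d A (xm l t) * P)
      ((fun m => if m = -t then (if i = l then gU d A (-2 * t) * P else 0) else 0) +
        fun m => ∑ r ∈ Finset.range ((m - b).toNat + 1),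
          (gcoef (qp d A i l)⁻¹ r • (gU d A (2 * r) * G d A (xm l (t + r)))) * T (m - r))
      ((fun m => if -m = t then (if i = l then gU d A (2 * t) * P else 0) else 0) +
        fun m => ∑ r ∈ Finset.range ((-m - -b').toNat + 1),
          (gcoef (qp d A i l) r • (gU d A (2 * r) * G d A (xm l (t - r)))) * T' (-(-m - r))) where
  mem m := by
    rw [Pi.add_apply]
    refine add_mem ?_ (sum_mem fun r _ => mul_mem (Subalgebra.smul_mem _
      (mul_mem (gU_mem_Nq _) (xm_mem_Nq _ _)) _) (hT.mem _))
    split_ifs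
    exacts [mul_mem (gU_mem_Nq _) hP, zero_mem _, zero_mem _]
  mem' m := by
    rw [Pi.add_apply]
    refine add_mem ?_ (sum_mem fun r _ => mul_mem (Subalgebra.smul_mem _
      (mul_mem (gU_mem_Nq _) (xm_mem_Nq _ _)) _) (hT.mem' _))
    split_ifs
    exacts [mul_mem (gU_mem_Nq _) hP, zero_mem _, zero_mem _]
  bdd := by
    refine ⟨min b (-t - 1), fun m hm => ?_⟩
    rw [Pi.add_apply, if_neg (by omega), zero_add]
    exact Finset.sum_eq_zero fun r _ => by rw [hb _ (by omega), mul_zero]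
  bdd' := by
    refine ⟨max b' (-t + 1), fun m hm => ?_⟩
    rw [Pi.add_apply, if_neg (by omega), zero_add]
    exact Finset.sum_eq_zero fun r _ => by rw [hb' _ (by omega), mul_zero]
  comm k := by
    obtain ⟨X, Y, hX, hY, hXY⟩ := hT.comm k
    have h1 := HalfSum.single (Ψ := psiHat d A i) (k := k) (l := -t)
      (y := if i = l then gU d A (-2 * t) * P else 0) rfl
    have h2 := HalfSum.single (Ψ := phiHat d A i) (k := -k) (l := t)
      (y := if i = l then gU d A (2 * t) * P else 0) rfl
    have h3 := hX.mul_left hb (xm_mul_psiHat hA i l t)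
    have h4 := hY.mul_left (b := -b') (fun m hm => hb' _ (by omega)) (xm_mul_phiHat hA i l t)
    refine ⟨_, _, h1.add h3, (h2.add h4).congr fun m => ?_, ?_⟩
    · simp only [Pi.add_apply, neg_neg]
    · have h5 : G d A (xp i k) * (G d A (xm l t) * P) - G d A (xm l t) * P * G d A (xp i k) =
          (G d A (xp i k) * G d A (xm l t) - G d A (xm l t) * G d A (xp i k)) * P +
            G d A (xm l t) * (G d A (xp i k) * P - P * G d A (xp i k)) := by
        simp only [sub_mul, mul_sub, mul_assoc]
        abel
      rw [h5, xp_mul_xm_sub, hXY, smul_mul_assoc, mul_smul_comm, ← smul_add, sub_neg_eq_add]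
      congr 1
      split_ifs <;> simp only [mul_assoc, sub_mul, mul_sub, zero_mul, mul_zero] <;> abel

end LeftMul

section Defect

attribute [local instance] natAlgebraFq intAlgebraFq

variable {B : Type*} [Ring B] [Algebra Fq B]

/-- The family `γ^{m/2}` of central elements. -/
structure IsCentralPower (γ : ℤ → B) : Prop where
  add : ∀ m n, γ (m + n) = γ m * γ n
  zero : γ 0 = 1
  comm : ∀ m P, Commute (γ m) P

/-- The rule describing how the `Ψ_k` act on left multiples of the `x_t`. -/
def LeftRule (γ x : ℤ → B) (δ β : Fq) (Ψ : ℤ → B →ₗ[Fq] B) : Prop :=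
  ∀ (k t : ℤ) (P : B) (n : ℕ), (∀ r : ℕ, n < r → Ψ (k - r) P = 0) →
    Ψ k (x t * P) = (if k = -t then δ • (γ (-2 * t) * P) else 0) +
      ∑ r ∈ Finset.range (n + 1), gcoef β r • (γ (2 * r) * x (t + r) * Ψ (k - r) P)

/-- The sequence `1, 0, 0, …` extended by zero to negative indices. -/
def unitMode (m : ℤ) : Fq := if m = 0 then 1 else 0

lemma gcoef_succ {a : Fq} (ha : a ≠ 0) (r : ℕ) : gcoef a (r + 2) * a = gcoef a (r + 1) := by
  simp only [gcoef]
  rw [sub_mul, ← zpow_add_one₀ ha, ← zpow_add_one₀ ha]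
  congr 2 <;> push_cast <;> ring

lemma extZ_gcoef_recurrence {a : Fq} (ha : a ≠ 0) (m : ℤ) :
    extZ (gcoef a) (m - 1) - a * extZ (gcoef a) m - a * unitMode (m - 1) + unitMode m = 0 := by
  have h1 : a * a⁻¹ = 1 := mul_inv_cancel₀ ha
  rcases lt_trichotomy m 0 with hm | rfl | hm
  · simp only [extZ, unitMode]
    rw [if_neg (by omega), if_neg (by omega), if_neg (by omega), if_neg (by omega)]
    ring
  · simp [extZ, unitMode, gcoef, h1]
  · obtain ⟨n, rfl⟩ := Int.eq_ofNat_of_zero_le hm.le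
    obtain ⟨n, rfl⟩ := Nat.exists_eq_succ_of_ne_zero (by omega : n ≠ 0)
    rcases n with - | n
    · have h2 : a ^ (-2 : ℤ) = a⁻¹ * a⁻¹ := by rw [zpow_neg, zpow_two, mul_inv]
      simp [extZ, unitMode, gcoef, h2]
      linear_combination (-a⁻¹) * h1
    · simp only [extZ, unitMode]
      rw [if_pos (by omega), if_pos (by omega), if_neg (by omega), if_neg (by omega),
        show ((((n + 1).succ : ℕ) : ℤ) - 1).toNat = n + 1 by omega,
        show ((((n + 1).succ : ℕ) : ℤ)).toNat = n + 2 by omega, ← gcoef_succ ha]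
      ring

lemma extZ_gcoef_inv_recurrence {a : Fq} (ha : a ≠ 0) (m : ℤ) :
    unitMode (m - 1) - a * unitMode m - a * extZ (gcoef a⁻¹) (m - 1) + extZ (gcoef a⁻¹) m = 0 := by
  have h1 := extZ_gcoef_recurrence (inv_ne_zero ha) m
  have h2 : a * a⁻¹ = 1 := mul_inv_cancel₀ ha
  linear_combination (-a) * h1 - (unitMode (m - 1) + extZ (gcoef a⁻¹) m) * h2

variable {γ x : ℤ → B} {δ₁ δ₂ β₁ β₂ : Fq} {Ψ₁ Ψ₂ : ℤ → B →ₗ[Fq] B}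

/-- The values of two composed families on a left multiple of `x_{-t}`. -/
lemma LeftRule.comp (hγ : IsCentralPower γ) (h₁ : LeftRule γ x δ₁ β₁ Ψ₁)
    (h₂ : LeftRule γ (fun t => x (-t)) δ₂ β₂ Ψ₂) (hΨ : ∀ k m P, Ψ₁ k (γ m * P) = γ m * Ψ₁ k P)
    (k m t : ℤ) (P : B) (n : ℕ) (hn₂ : ∀ r : ℕ, n < r → Ψ₂ (m - r) P = 0)
    (hn₁ : ∀ r s : ℕ, n < s → Ψ₁ (k - s) (Ψ₂ (m - r) P) = 0) :
    Ψ₁ k (Ψ₂ m (x (-t) * P)) =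
      (δ₂ * unitMode (m + t)) • (γ (4 * (m + t) - 2 * t) * Ψ₁ (k - (m + t)) P) +
      (δ₁ * extZ (gcoef β₂) (k - t)) • (γ (4 * (k - t) + 2 * t) * Ψ₂ (m - (k - t)) P) +
      ∑ r ∈ Finset.range (n + 1), ∑ s ∈ Finset.range (n + 1),
        (gcoef β₂ r * gcoef β₁ s) •
          (γ (2 * r + 2 * s) * x (s - r - t) * Ψ₁ (k - s) (Ψ₂ (m - r) P)) := by
  have e1 := h₂ m t P n hn₂
  beta_reduce at e1
  rw [e1, map_add, map_sum, add_assoc]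
  congr 1
  · rw [unitMode]
    by_cases hm : m = -t
    · subst hm
      rw [if_pos rfl, if_pos (by ring), map_smul, hΨ, mul_one]
      congr 3
      · ring
      · congr 1; ring
    · rw [if_neg hm, if_neg (by omega), map_zero, mul_zero, zero_smul]
  · have e2 : ∀ r ∈ Finset.range (n + 1),
        Ψ₁ k (gcoef β₂ r • (γ (2 * r) * x (-(t + r)) * Ψ₂ (m - r) P)) =
        (if k - t = r then (δ₁ * gcoef β₂ r) • (γ (4 * r + 2 * t) * Ψ₂ (m - r) P) else 0) +
        ∑ s ∈ Finset.range (n + 1), (gcoef β₂ r * gcoef β₁ s) •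
          (γ (2 * r + 2 * s) * x (s - r - t) * Ψ₁ (k - s) (Ψ₂ (m - r) P)) := fun r _ => by
      rw [map_smul, mul_assoc, hΨ, h₁ k _ _ n (hn₁ r), mul_add, smul_add]
      congr 1
      · by_cases hk : k - t = r
        · rw [if_pos (by omega), if_pos hk, mul_smul_comm, smul_smul, ← mul_assoc, ← hγ.add,
            mul_comm δ₁]
          congr 3; ring
        · rw [if_neg (by omega), if_neg hk, mul_zero, smul_zero]
      · simp only [Finset.mul_sum, Finset.smul_sum]
        refine Finset.sum_congr rfl fun s _ => ?_
        rw [mul_smul_comm, smul_smul, hγ.add]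
        simp only [mul_assoc]
        congr 5; ring
    rw [Finset.sum_congr rfl e2, Finset.sum_add_distrib]
    congr 1
    rw [extZ]
    split_ifs with hk
    · obtain ⟨q, hq⟩ := Int.eq_ofNat_of_zero_le hk
      rw [hq, Int.toNat_natCast]
      rcases lt_or_ge n q with hnq | hnq
      · rw [hn₂ q hnq, mul_zero, smul_zero]
        refine Finset.sum_eq_zero fun r hr => if_neg ?_
        rw [Finset.mem_range] at hr; omega
      · rw [Finset.sum_eq_single q (fun r _ hr => if_neg (by omega))
          (fun hr => absurd (Finset.mem_range.2 (by omega)) hr), if_pos rfl]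
    · rw [mul_zero, zero_smul]
      exact Finset.sum_eq_zero fun r _ => if_neg (by omega)

end Defect

section DefectVanishing

attribute [local instance] natAlgebraFq intAlgebraFq

variable {B : Type*} [Ring B] [Algebra Fq B]

/-- Every element is annihilated by the members of the family of small index. -/
def IsLocallyBounded (Ψ : ℤ → B →ₗ[Fq] B) : Prop := ∀ P, ∃ b : ℤ, ∀ m ≤ b, Ψ m P = 0

lemma IsLocallyBounded.exists_bound {Ψ : ℤ → B →ₗ[Fq] B} (hΨ : IsLocallyBounded Ψ) (k : ℤ) (P : B) :
    ∃ n : ℕ, ∀ r : ℕ, n < r → Ψ (k - r) P = 0 := by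
  obtain ⟨b, hb⟩ := hΨ P
  exact ⟨(k - b).toNat, fun r hr => hb _ (by omega)⟩

lemma IsLocallyBounded.exists_bound_comp {Ψ₁ Ψ₂ : ℤ → B →ₗ[Fq] B} (h₁ : IsLocallyBounded Ψ₁)
    (h₂ : IsLocallyBounded Ψ₂) (k m : ℤ) (P : B) :
    ∃ n₀ : ℕ, ∀ n ≥ n₀, (∀ r : ℕ, n < r → Ψ₂ (m - r) P = 0) ∧
      ∀ r s : ℕ, n < s → Ψ₁ (k - s) (Ψ₂ (m - r) P) = 0 := by
  obtain ⟨n₂, hn₂⟩ := h₂.exists_bound m P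
  choose f hf using fun r : ℕ => h₁.exists_bound k (Ψ₂ (m - r) P)
  refine ⟨max n₂ ((Finset.range (n₂ + 1)).sup f), fun n hn =>
    ⟨fun r hr => hn₂ r (by omega), fun r s hs => ?_⟩⟩
  rcases lt_or_ge n₂ r with hr | hr
  · rw [hn₂ r hr, map_zero]
  · have := Finset.le_sup (f := f) (Finset.mem_range.2 (Nat.lt_add_one_of_le hr))
    exact hf r s (by omega)

/-- The failure of the commutation rule, cleared of its denominator. -/
def defect (γ : ℤ → B) (a : Fq) (Ψ₁ Ψ₂ : ℤ → B →ₗ[Fq] B) (k m : ℤ) : B →ₗ[Fq] B :=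
  LinearMap.mulLeft Fq (γ 4) ∘ₗ Ψ₁ (k - 1) ∘ₗ Ψ₂ (m - 1) - a • (Ψ₁ k ∘ₗ Ψ₂ m) -
    a • (LinearMap.mulLeft Fq (γ 4) ∘ₗ Ψ₂ (m - 1) ∘ₗ Ψ₁ (k - 1)) + Ψ₂ m ∘ₗ Ψ₁ k

variable {γ x : ℤ → B} {δ₁ δ₂ β₁ β₂ a : Fq} {Ψ₁ Ψ₂ : ℤ → B →ₗ[Fq] B}

lemma defect_apply (k m : ℤ) (P : B) : defect γ a Ψ₁ Ψ₂ k m P =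
    γ 4 * Ψ₁ (k - 1) (Ψ₂ (m - 1) P) - a • Ψ₁ k (Ψ₂ m P) -
      a • (γ 4 * Ψ₂ (m - 1) (Ψ₁ (k - 1) P)) + Ψ₂ m (Ψ₁ k P) := rfl

lemma defect_central_mul (hγ : IsCentralPower γ) (hΨ₁ : ∀ k m P, Ψ₁ k (γ m * P) = γ m * Ψ₁ k P)
    (hΨ₂ : ∀ k m P, Ψ₂ k (γ m * P) = γ m * Ψ₂ k P) (k m l : ℤ) (P : B) :
    defect γ a Ψ₁ Ψ₂ k m (γ l * P) = γ l * defect γ a Ψ₁ Ψ₂ k m P := by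
  have h4 : ∀ Q, γ 4 * (γ l * Q) = γ l * (γ 4 * Q) := fun Q => by
    rw [← mul_assoc, (hγ.comm 4 _).eq, mul_assoc]
  simp only [defect_apply, hΨ₁, hΨ₂, h4, mul_add, mul_sub, mul_smul_comm]

/-- `LeftRule.comp` with the indices given up to equality. -/
lemma LeftRule.comp_of_eq (hγ : IsCentralPower γ) (h₁ : LeftRule γ x δ₁ β₁ Ψ₁)
    (h₂ : LeftRule γ (fun t => x (-t)) δ₂ β₂ Ψ₂) (hΨ : ∀ k m P, Ψ₁ k (γ m * P) = γ m * Ψ₁ k P)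
    (k m v z : ℤ) (P : B) (n : ℕ) (hn : (∀ r : ℕ, n < r → Ψ₂ (m - r) P = 0) ∧
      ∀ r s : ℕ, n < s → Ψ₁ (k - s) (Ψ₂ (m - r) P) = 0)
    {σ ρ w₁ w₂ p₁ p₂ : ℤ} (hσ : σ = m - v) (hρ : ρ = k + v) (hw₂ : w₂ = z + 4 * σ + 2 * v)
    (hw₁ : w₁ = z + 4 * ρ - 2 * v) (hp₁ : p₁ = k - σ) (hp₂ : p₂ = m - ρ) :
    γ z * Ψ₁ k (Ψ₂ m (x v * P)) = (δ₂ * unitMode σ) • (γ w₂ * Ψ₁ p₁ P) +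
      (δ₁ * extZ (gcoef β₂) ρ) • (γ w₁ * Ψ₂ p₂ P) +
      ∑ r ∈ Finset.range (n + 1), ∑ s ∈ Finset.range (n + 1), (gcoef β₂ r * gcoef β₁ s) •
          (γ (2 * r + 2 * s) * x (s - r + v) * (γ z * Ψ₁ (k - s) (Ψ₂ (m - r) P))) := by
  have e₁ := h₁.comp hγ h₂ hΨ k m (-v) P n hn.1 hn.2
  rw [neg_neg] at e₁
  subst hσ hρ hw₁ hw₂ hp₁ hp₂
  rw [e₁, mul_add, mul_add]
  simp only [sub_neg_eq_add, ← sub_eq_add_neg, mul_smul_comm, ← mul_assoc, ← hγ.add, Finset.mul_sum]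
  congr 1
  · congr 4 <;> ring
  · refine Finset.sum_congr rfl fun r _ => Finset.sum_congr rfl fun s _ => ?_
    rw [mul_assoc (γ _) (x _) (γ z), ← (hγ.comm z (x _)).eq, add_comm z, hγ.add _ z]
    simp only [mul_assoc]

lemma defect_x_mul (hγ : IsCentralPower γ) (ha : a ≠ 0) (h₁ : LeftRule γ x δ₁ β₁ Ψ₁)
    (h₂ : LeftRule γ (fun t => x (-t)) δ₂ β₂ Ψ₂)
    (hΨ₁ : ∀ k m P, Ψ₁ k (γ m * P) = γ m * Ψ₁ k P) (hΨ₂ : ∀ k m P, Ψ₂ k (γ m * P) = γ m * Ψ₂ k P)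
    (hb₁ : IsLocallyBounded Ψ₁) (hb₂ : IsLocallyBounded Ψ₂)
    (hδ₁ : δ₁ = 0 ∨ β₂ = a) (hδ₂ : δ₂ = 0 ∨ β₁ = a⁻¹) {P : B}
    (hP : ∀ k m, defect γ a Ψ₁ Ψ₂ k m P = 0) (k m u : ℤ) :
    defect γ a Ψ₁ Ψ₂ k m (x u * P) = 0 := by
  obtain ⟨n₁, hn₁⟩ := hb₁.exists_bound_comp hb₂ k m P
  obtain ⟨n₂, hn₂⟩ := hb₂.exists_bound_comp hb₁ m k P
  obtain ⟨n₃, hn₃⟩ := hb₁.exists_bound_comp hb₂ (k - 1) (m - 1) P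
  obtain ⟨n₄, hn₄⟩ := hb₂.exists_bound_comp hb₁ (m - 1) (k - 1) P
  obtain ⟨n, hn⟩ : ∃ n, n ≥ n₁ ∧ n ≥ n₂ ∧ n ≥ n₃ ∧ n ≥ n₄ :=
    ⟨max (max n₁ n₂) (max n₃ n₄), by omega⟩
  have h₁' : LeftRule γ (fun t => x (- -t)) δ₁ β₁ Ψ₁ := by simpa only [neg_neg] using h₁
  have e₁ := h₁.comp_of_eq hγ h₂ hΨ₁ k m u 0 P n (hn₁ n hn.1) rfl rfl rfl rfl rfl rfl
  have e₂ := h₂.comp_of_eq hγ h₁' hΨ₂ m k (-u) 0 P n (hn₂ n hn.2.1) (σ := k + u) (ρ := m - u)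
    (w₁ := 0 + 4 * (m - u) + 2 * u) (w₂ := 0 + 4 * (k + u) - 2 * u) (p₁ := m - (k + u))
    (p₂ := k - (m - u)) (by ring) (by ring) (by ring) (by ring) (by ring) (by ring)
  have e₃ := h₁.comp_of_eq hγ h₂ hΨ₁ (k - 1) (m - 1) u 4 P n (hn₃ n hn.2.2.1)
    (σ := m - u - 1) (ρ := k + u - 1) (w₂ := 0 + 4 * (m - u) + 2 * u)
    (w₁ := 0 + 4 * (k + u) - 2 * u) (p₂ := m - (k + u))
    (p₁ := k - (m - u)) (by ring) (by ring) (by ring) (by ring) (by ring) (by ring)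
  have e₄ := h₂.comp_of_eq hγ h₁' hΨ₂ (m - 1) (k - 1) (-u) 4 P n (hn₄ n hn.2.2.2)
    (σ := k + u - 1) (ρ := m - u - 1)
    (w₁ := 0 + 4 * (m - u) + 2 * u) (w₂ := 0 + 4 * (k + u) - 2 * u) (p₁ := m - (k + u))
    (p₂ := k - (m - u)) (by ring) (by ring) (by ring) (by ring) (by ring) (by ring)
  rw [Finset.sum_comm] at e₂ e₄
  simp only [neg_neg] at e₂ e₄
  simp only [hγ.zero, one_mul] at e₁ e₂
  rw [defect_apply, e₁, e₂, e₃, e₄]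
  have c₁ : δ₁ * (extZ (gcoef β₂) (k + u - 1) - a * extZ (gcoef β₂) (k + u) -
      a * unitMode (k + u - 1) + unitMode (k + u)) = 0 := by
    rcases hδ₁ with rfl | rfl
    · rw [zero_mul]
    · rw [extZ_gcoef_recurrence ha, mul_zero]
  have c₂ : δ₂ * (unitMode (m - u - 1) - a * unitMode (m - u) -
      a * extZ (gcoef β₁) (m - u - 1) + extZ (gcoef β₁) (m - u)) = 0 := by
    rcases hδ₂ with rfl | rfl
    · rw [zero_mul]
    · rw [extZ_gcoef_inv_recurrence ha, mul_zero]
  set E₁ := γ (0 + 4 * (k + u) - 2 * u) * Ψ₂ (m - (k + u)) P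
  set E₂ := γ (0 + 4 * (m - u) + 2 * u) * Ψ₁ (k - (m - u)) P
  have hS : ∀ S₁ S₂ S₃ S₄ : B, S₃ - a • S₁ - a • S₄ + S₂ = 0 →
      (δ₂ * unitMode (m - u - 1)) • E₂ + (δ₁ * extZ (gcoef β₂) (k + u - 1)) • E₁ + S₃ -
        a • ((δ₂ * unitMode (m - u)) • E₂ + (δ₁ * extZ (gcoef β₂) (k + u)) • E₁ + S₁) -
        a • ((δ₁ * unitMode (k + u - 1)) • E₁ + (δ₂ * extZ (gcoef β₁) (m - u - 1)) • E₂ + S₄) +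
        ((δ₁ * unitMode (k + u)) • E₁ + (δ₂ * extZ (gcoef β₁) (m - u)) • E₂ + S₂) = 0 :=
    fun S₁ S₂ S₃ S₄ hS => by
      have e₁ := congrArg (· • E₁) c₁
      have e₂ := congrArg (· • E₂) c₂
      simp only [zero_smul] at e₁ e₂
      linear_combination (norm := module) hS + e₁ + e₂
  refine hS _ _ _ _ ?_
  simp only [Finset.smul_sum, ← Finset.sum_sub_distrib, ← Finset.sum_add_distrib]
  refine Finset.sum_eq_zero fun r _ => Finset.sum_eq_zero fun s _ => ?_
  have h0 := hP (k - s) (m - r)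
  rw [defect_apply, sub_right_comm k, sub_right_comm m] at h0
  have h5 : -((r : ℤ) - s + -u) = s - r + u := by ring
  rw [h5, mul_comm (gcoef β₁ s), add_comm (2 * (s : ℤ)), smul_comm a, smul_comm a, ← smul_sub,
    ← smul_sub, ← smul_add, ← mul_smul_comm, ← mul_smul_comm, ← mul_sub, ← mul_sub, ← mul_add, h0,
    mul_zero, smul_zero]

/-- Solving the cleared commutation rule for one of the two compositions. -/
lemma eq_sum_gcoef_of_recurrence (ha : a ≠ 0) (n : ℕ) {Z W : ℕ → B}
    (hZW : ∀ r, a • Z r = Z (r + 1) - a • W (r + 1) + W r) (hZ : ∀ r ≥ n, Z r = 0)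
    (hW : ∀ r ≥ n, W r = 0) : Z 0 = ∑ r ∈ Finset.range n, gcoef a r • W r := by
  induction n generalizing Z W with
  | zero => simpa using hZ 0 le_rfl
  | succ n ih =>
    have e₁ := ih (Z := fun r => Z (r + 1)) (W := fun r => W (r + 1)) (fun r => hZW (r + 1))
      (fun r hr => hZ (r + 1) (by omega)) (fun r hr => hW (r + 1) (by omega))
    rw [← smul_right_injective B ha |>.eq_iff, hZW]
    beta_reduce at e₁
    rw [zero_add] at e₁ ⊢
    rw [e₁, Finset.sum_range_succ', smul_add, smul_smul, show a * gcoef a 0 = 1 by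
      simp [gcoef, ha], one_smul, Finset.smul_sum]
    congr 1
    rcases n with - | n
    · simp [hW 1 le_rfl]
    · rw [Finset.sum_range_succ' _ n, Finset.sum_range_succ' _ n, add_sub_assoc]
      congr 1
      · refine Finset.sum_congr rfl fun r _ => ?_
        rw [smul_smul, mul_comm, gcoef_succ ha]
      · rw [zero_add, smul_smul, ← sub_smul]
        congr 1
        have h1 : a * a⁻¹ = 1 := mul_inv_cancel₀ ha
        have h2 : a ^ (-2 : ℤ) = a⁻¹ * a⁻¹ := by rw [zpow_neg, zpow_two, mul_inv]
        simp [gcoef, h2]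
        linear_combination (-a⁻¹) * h1

lemma comp_eq_sum_of_defect_eq_zero (hγ : IsCentralPower γ) (ha : a ≠ 0) {k m : ℤ} {P : B} {n : ℕ}
    (hP : ∀ k m, defect γ a Ψ₁ Ψ₂ k m P = 0) (h₁ : ∀ r : ℕ, n < r → Ψ₁ (k - r) P = 0)
    (h₂ : ∀ r : ℕ, n < r → Ψ₂ (m - r) P = 0) : Ψ₁ k (Ψ₂ m P) =
      ∑ r ∈ Finset.range (n + 1), gcoef a r • (γ (4 * (r : ℤ)) * Ψ₂ (m - r) (Ψ₁ (k - r) P)) := by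
  have e₁ := eq_sum_gcoef_of_recurrence ha (n + 1)
    (Z := fun r => γ (4 * (r : ℤ)) * Ψ₁ (k - r) (Ψ₂ (m - r) P))
    (W := fun r => γ (4 * (r : ℤ)) * Ψ₂ (m - r) (Ψ₁ (k - r) P)) (fun r => ?_)
    (fun r hr => by simp only [h₂ r (by omega), map_zero, mul_zero])
    (fun r hr => by simp only [h₁ r (by omega), map_zero, mul_zero])
  · simpa [hγ.zero] using e₁
  · have h0 := congrArg (γ (4 * (r : ℤ)) * ·) (hP (k - r) (m - r))
    simp only [defect_apply, mul_zero, mul_add, mul_sub, mul_smul_comm] at h0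
    simp only [← mul_assoc, ← hγ.add] at h0
    push_cast
    simp only [mul_add, mul_one, ← sub_sub]
    linear_combination (norm := module) -h0

end DefectVanishing

section OmegaFamily

attribute [local instance] natAlgebraFq intAlgebraFq

variable {N : ℕ} {d : Fin N → ℤ} {A : Fin N → Fin N → ℤ}

lemma coe_gN (m : ℤ) : (gN d A m : Uq N d A) = gU d A m := by
  rw [gN, gU, gammaHalf]
  split_ifs <;> rw [map_pow] <;> rfl

lemma isCentralPower_gN : IsCentralPower (gN d A) where
  add m n := Subtype.ext <| by rw [MulMemClass.coe_mul, coe_gN, coe_gN, coe_gN, gU_add]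
  zero := Subtype.ext <| (coe_gN 0).trans gU_zero
  comm m P := Subtype.ext <| by
    rw [MulMemClass.coe_mul, MulMemClass.coe_mul, coe_gN, (commute_gU m _).eq]

lemma IsCommRep.one (i : Fin N) : IsCommRep i (1 : Uq N d A) (fun _ => 0) fun _ => 0 where
  mem _ := zero_mem _
  mem' _ := zero_mem _
  bdd := ⟨0, fun _ _ => rfl⟩
  bdd' := ⟨0, fun _ _ => rfl⟩
  comm k := ⟨0, 0, ⟨0, fun _ _ => rfl, by simp⟩, ⟨0, fun _ _ => rfl, by simp⟩, by simp⟩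

lemma IsCommRep.gU_mul {i : Fin N} {P : Uq N d A} {T T' : ℤ → Uq N d A} (hT : IsCommRep i P T T')
    (n : ℤ) : IsCommRep i (gU d A n * P) (fun m => gU d A n * T m) fun m => gU d A n * T' m where
  mem m := mul_mem (gU_mem_Nq _) (hT.mem m)
  mem' m := mul_mem (gU_mem_Nq _) (hT.mem' m)
  bdd := hT.bdd.imp fun b hb m hm => by rw [hb m hm, mul_zero]
  bdd' := hT.bdd'.imp fun b hb m hm => by rw [hb m hm, mul_zero]
  comm k := by
    obtain ⟨X, Y, hX, hY, hXY⟩ := hT.comm k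
    refine ⟨_, _, hX.central_mul fun p => commute_gU n _,
      hY.central_mul fun p => commute_gU n _, ?_⟩
    rw [← mul_assoc, ← (commute_gU n _).eq, mul_assoc, mul_assoc, ← mul_sub, hXY, mul_smul_comm,
      mul_sub]

variable {Ωψ Ωφ : Fin N → ℤ → (Nq d A →ₗ[Fq] Nq d A)}

namespace IsOmegaFamily

lemma map_one (hfam : IsOmegaFamily d A Ωψ Ωφ) (hA : IsSymmCartan d A) (i : Fin N) (m : ℤ) :
    Ωψ i m 1 = 0 ∧ Ωφ i m 1 = 0 :=
  hfam.eq_of_isCommRep hA (T := fun _ => 0) (T' := fun _ => 0) (IsCommRep.one i) m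

lemma map_gN_mul (hfam : IsOmegaFamily d A Ωψ Ωφ) (hA : IsSymmCartan d A) (i : Fin N) (m n : ℤ)
    (P : Nq d A) :
    Ωψ i m (gN d A n * P) = gN d A n * Ωψ i m P ∧ Ωφ i m (gN d A n * P) = gN d A n * Ωφ i m P := by
  refine hfam.eq_of_isCommRep hA (T := fun m => gN d A n * Ωψ i m P)
    (T' := fun m => gN d A n * Ωφ i m P) ?_ m
  simp only [MulMemClass.coe_mul, coe_gN]
  exact (hfam.isCommRep i P).gU_mul n

lemma leftRule_psi (hfam : IsOmegaFamily d A Ωψ Ωφ) (hA : IsSymmCartan d A) (i l : Fin N) :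
    LeftRule (gN d A) (xmN d A l) (if i = l then 1 else 0) (qp d A i l)⁻¹ (Ωψ i) := by
  intro k t P n hn
  obtain ⟨b, hb⟩ := (hfam.isCommRep i P).bdd
  obtain ⟨b', hb'⟩ := (hfam.isCommRep i P).bdd'
  have h1 := (hfam.isCommRep i (xmN d A l t * P)).unique hA
    ((hfam.isCommRep i P).xm_mul hA P.2 hb hb' l t)
  refine Subtype.ext ((congrFun h1.1 k).trans ?_)
  rw [Pi.add_apply, HalfSum.sum_range_eq (n := n) (fun p hp => by rw [hb _ (by omega), mul_zero])
    fun p hp => by rw [hn p hp, ZeroMemClass.coe_zero, mul_zero]]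
  rw [AddMemClass.coe_add, AddSubmonoidClass.coe_finsetSum]
  congr 1
  · split_ifs
    · rw [one_smul, MulMemClass.coe_mul, coe_gN]
    · rw [zero_smul, ZeroMemClass.coe_zero]
    · rfl
  · refine Finset.sum_congr rfl fun r _ => ?_
    rw [smul_mul_assoc, ← coe_gN]
    rfl

lemma leftRule_phi (hfam : IsOmegaFamily d A Ωψ Ωφ) (hA : IsSymmCartan d A) (i l : Fin N) :
    LeftRule (gN d A) (fun t => xmN d A l (-t)) (if i = l then 1 else 0) (qp d A i l)
      fun m => Ωφ i (-m) := by
  intro k t P n hn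
  obtain ⟨b, hb⟩ := (hfam.isCommRep i P).bdd
  obtain ⟨b', hb'⟩ := (hfam.isCommRep i P).bdd'
  have h1 := (hfam.isCommRep i (xmN d A l (-t) * P)).unique hA
    ((hfam.isCommRep i P).xm_mul hA P.2 hb hb' l (-t))
  refine Subtype.ext ((congrFun h1.2 (-k)).trans ?_)
  rw [Pi.add_apply, HalfSum.sum_range_eq (n := n) (fun p hp => by rw [hb' _ (by omega), mul_zero])
    fun p hp => by rw [neg_neg, hn p hp, ZeroMemClass.coe_zero, mul_zero]]
  rw [AddMemClass.coe_add, AddSubmonoidClass.coe_finsetSum, neg_neg]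
  congr 1
  · rw [mul_neg, ← neg_mul]
    split_ifs
    · rw [one_smul, MulMemClass.coe_mul, coe_gN]
    · rw [zero_smul, ZeroMemClass.coe_zero]
    · rfl
  · refine Finset.sum_congr rfl fun r _ => ?_
    have h2 : -(t + (r : ℤ)) = -t - r := by ring
    rw [smul_mul_assoc, ← coe_gN]
    beta_reduce
    rw [h2]
    rfl

lemma isLocallyBounded_psi (hfam : IsOmegaFamily d A Ωψ Ωφ) (i : Fin N) :
    IsLocallyBounded (B := Nq d A) (Ωψ i) := hfam.1 i

lemma isLocallyBounded_phi (hfam : IsOmegaFamily d A Ωψ Ωφ) (i : Fin N) :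
    IsLocallyBounded (B := Nq d A) fun m => Ωφ i (-m) := fun P => by
  obtain ⟨b, hb⟩ := hfam.2.1 i P
  exact ⟨-b, fun m hm => hb _ (by omega)⟩

lemma defect_eq_zero (hfam : IsOmegaFamily d A Ωψ Ωφ) (hA : IsSymmCartan d A) (i j : Fin N)
    (P : Nq d A) (k m : ℤ) :
    defect (gN d A) (qp d A i j) (Ωψ i) (fun m => Ωφ j (-m)) k m P = 0 := by
  have hψ := fun k m P => (hfam.map_gN_mul hA i k m P).1
  have hφ := fun k m P => (hfam.map_gN_mul hA j (-k) m P).2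
  have hg : ∀ (l : ℤ) (Q : Nq d A),
      (∀ k m, defect (gN d A) (qp d A i j) (Ωψ i) (fun m => Ωφ j (-m)) k m Q = 0) → ∀ k m,
        defect (gN d A) (qp d A i j) (Ωψ i) (fun m => Ωφ j (-m)) k m (gN d A l * Q) = 0 :=
    fun l Q hQ k m => by rw [defect_central_mul isCentralPower_gN hψ hφ, hQ, mul_zero]
  suffices key : ∀ x (hx : x ∈ Nq d A) (Q : Nq d A),
      (∀ k m, defect (gN d A) (qp d A i j) (Ωψ i) (fun m => Ωφ j (-m)) k m Q = 0) → ∀ k m,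
        defect (gN d A) (qp d A i j) (Ωψ i) (fun m => Ωφ j (-m)) k m (⟨x, hx⟩ * Q) = 0 by
    rw [← mul_one P]
    refine key P P.2 1 (fun k m => ?_) k m
    rw [defect_apply]
    simp only [(hfam.map_one hA _ _).1, (hfam.map_one hA _ _).2, map_zero, mul_zero,
      smul_zero, add_zero]
    exact (sub_zero (0 - 0 : Nq d A)).trans (sub_zero (0 : Nq d A))
  intro x hx
  induction hx using Algebra.adjoin_induction with
  | mem x hx =>
    rcases hx with (rfl | rfl) | ⟨⟨l, t⟩, rfl⟩
    · intro Q hQ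
      convert hg 1 Q hQ using 5
      exact Subtype.ext (pow_one _).symm
    · intro Q hQ
      convert hg (-1) Q hQ using 5
      exact Subtype.ext (pow_one _).symm
    · intro Q hQ k m
      refine defect_x_mul isCentralPower_gN (qp_ne_zero d A i j) (hfam.leftRule_psi hA i l)
        (hfam.leftRule_phi hA j l) hψ hφ (hfam.isLocallyBounded_psi i)
        (hfam.isLocallyBounded_phi j) ?_ ?_ hQ k m t
      · by_cases hil : i = l
        · exact .inr (by rw [← hil, hA.qp_symm])
        · exact .inl (if_neg hil)
      · by_cases hjl : j = l
        · exact .inr (by rw [← hjl])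
        · exact .inl (if_neg hjl)
  | algebraMap c =>
    intro Q hQ k m
    have h1 : (⟨algebraMap Fq (Uq N d A) c, Subalgebra.algebraMap_mem _ c⟩ : Nq d A) * Q = c • Q :=
      (Algebra.smul_def c Q).symm
    exact (congrArg _ h1).trans (by rw [map_smul, hQ, smul_zero])
  | add x y hx hy ihx ihy =>
    intro Q hQ k m
    have h1 : (⟨x + y, add_mem hx hy⟩ : Nq d A) * Q = ⟨x, hx⟩ * Q + ⟨y, hy⟩ * Q :=
      add_mul (⟨x, hx⟩ : Nq d A) ⟨y, hy⟩ Q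
    exact (congrArg _ h1).trans (by rw [map_add, ihx Q hQ, ihy Q hQ, add_zero])
  | mul x y hx hy ihx ihy =>
    intro Q hQ k m
    have h1 : (⟨x * y, mul_mem hx hy⟩ : Nq d A) * Q = ⟨x, hx⟩ * (⟨y, hy⟩ * Q) :=
      mul_assoc (⟨x, hx⟩ : Nq d A) ⟨y, hy⟩ Q
    exact (congrArg _ h1).trans (ihx _ (ihy Q hQ) k m)

end IsOmegaFamily

end OmegaFamily

/-- `Ω_{ψ_i}(k)(Ω_{φ_j}(m)(P)) =
∑_{r ≥ 0} g_{i,j}(r) γ^{2r} Ω_{φ_j}(m+r)(Ω_{ψ_i}(k-r)(P))`,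
with only finitely many nonzero summands. -/
theorem omega_psi_phi_commutation
    (hN : 0 < N)
    (hdpos : ∀ i, 0 < d i)
    (hgcd : Finset.univ.gcd (fun i => (d i).natAbs) = 1)
    (hdiag : ∀ i, A i i = 2)
    (hoff : ∀ i j, i ≠ j → A i j ≤ 0)
    (hsym : ∀ i j, d i * A i j = d j * A j i)
    (Ωψ Ωφ : Fin N → ℤ → ((Nq d A) →ₗ[Fq] (Nq d A)))
    (hfam : IsOmegaFamily d A Ωψ Ωφ)
    (i j : Fin N) (k m : ℤ) (P : Nq d A) :
    ∃ M : ℕ, (∀ r : ℕ, M < r → Ωψ i (k - (r : ℤ)) P = 0) ∧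
      Ωψ i k (Ωφ j m P) =
        ∑ r ∈ Finset.range (M + 1),
          gcoef (qp d A i j) r •
            (gN d A (4 * (r : ℤ)) * Ωφ j (m + (r : ℤ)) (Ωψ i (k - (r : ℤ)) P)) := by
  obtain ⟨n₁, hn₁⟩ := (hfam.isLocallyBounded_psi i).exists_bound k P
  obtain ⟨n₂, hn₂⟩ := (hfam.isLocallyBounded_phi j).exists_bound (-m) P
  refine ⟨max n₁ n₂, fun r hr => hn₁ r (by omega), ?_⟩
  have h1 := comp_eq_sum_of_defect_eq_zero isCentralPower_gN (qp_ne_zero d A i j) (m := -m)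
    (hfam.defect_eq_zero ⟨hdpos, hdiag, hoff, hsym⟩ i j P) (n := max n₁ n₂)
    (fun r hr => hn₁ r (by omega)) (fun r hr => hn₂ r (by omega))
  simpa only [neg_sub, sub_neg_eq_add, neg_neg, add_comm _ m] using h1

end
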